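/- Under the standing assumptions, there exist constants κ₀, c₃ > 0, depending only on n, the AD-regularity constant C₀, A, and the constants in the weak-A∞ condition in B_{R₀}, such that for every cube Q ∈ G there exists a point x_Q ∈ 2B_Q ∩ Ω with δ_Ω(x_Q) ≥ κ₀ ℓ(Q) and g(p, x_Q) > c₃ ℓ(Q)/μ(R₀). -/

import Mathlib

open Metric MeasureTheory Set Filter Topology

noncomputable section

/-- Euclidean space `ℝ^d`. -/
abbrev Euc (d : ℕ) : Type := EuclideanSpace ℝ (Fin d)

namespace HarmMeas

/-- Distance between two sets. -/
def setD {d : ℕ} (s t : Set (Euc d)) : ℝ := sInf (Set.image2 dist s t)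

/-- A continuous function is subharmonic on `U` if it satisfies the sub-mean-value
property on every ball whose closure is contained in `U`. -/
def SubharmonicOn {d : ℕ} (u : Euc d → ℝ) (U : Set (Euc d)) : Prop :=
  ContinuousOn u U ∧ ∀ x ∈ U, ∀ r : ℝ, 0 < r → closedBall x r ⊆ U →
    u x ≤ ⨍ y in ball x r, u y

/-- Harmonic (continuous) functions: both `u` and `-u` are subharmonic. -/
def HarmonicOnS {d : ℕ} (u : Euc d → ℝ) (U : Set (Euc d)) : Prop :=
  SubharmonicOn u U ∧ SubharmonicOn (fun y => -u y) U

/-- The upper (Perron) class associated to boundary data `f` on the open set `Ω`: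
superharmonic functions on `Ω`, bounded below, whose liminf at each boundary point
dominates `f` there. -/
def upperFamily {d : ℕ} (Ω : Set (Euc d)) (f : Euc d → ℝ) : Set (Euc d → ℝ) :=
  {u | SubharmonicOn (fun y => -u y) Ω ∧ BddBelow (u '' Ω) ∧
       ∀ ξ ∈ frontier Ω, f ξ ≤ Filter.liminf u (nhdsWithin ξ Ω)}

/-- The (upper) Perron solution of the Dirichlet problem in `Ω` with boundary data `f`,
evaluated at `p`. -/
def perron {d : ℕ} (Ω : Set (Euc d)) (f : Euc d → ℝ) (p : Euc d) : ℝ :=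
  sInf ((fun u => u p) '' upperFamily Ω f)

/-- Harmonic measure `ω^p(A)` of `A` for the open set `Ω` with pole `p`: the value at `p`
of the Perron solution with boundary data the characteristic function of `A`. -/
def hMeasure {d : ℕ} (Ω : Set (Euc d)) (p : Euc d) (A : Set (Euc d)) : ℝ :=
  perron Ω (A.indicator fun _ => 1) p

/-- The Green function `g(p,x)` of `Ω ⊆ ℝ^{n+1}` with pole `p`: the fundamental solution
`|x-p|^{1-n}` minus the Perron solution with the fundamental solution as boundary data. -/
def greenFn (n : ℕ) (Ω : Set (Euc (n+1))) (p x : Euc (n+1)) : ℝ :=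
  ‖x - p‖ ^ ((1 : ℤ) - n) - perron Ω (fun ξ => ‖ξ - p‖ ^ ((1 : ℤ) - n)) x

/-- `F ⊆ ℝ^{n+1}` is `n`-AD-regular with constant `C₀`. -/
def ADRegular (n : ℕ) (C₀ : ℝ) (F : Set (Euc (n+1))) : Prop :=
  ∀ x ∈ F, ∀ r : ℝ, 0 < r → ENNReal.ofReal r ≤ EMetric.diam F →
    ENNReal.ofReal (C₀⁻¹ * r ^ n) ≤ μH[n] (F ∩ ball x r) ∧
      μH[n] (F ∩ ball x r) ≤ ENNReal.ofReal (C₀ * r ^ n)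

/-- A `λ`-carrot curve from `x` to `y` in `Ω`: a curve `γ ⊆ Ω ∪ {y}` with endpoints `x`
and `y` such that `dist(z, ∂Ω) ≥ λ ⋅ ℋ¹(γ(y,z))` for every point `z = γ(t)` of the curve,
where `γ(y,z)` is the arc of `γ` between `y` and `z`. -/
def CarrotCurve {d : ℕ} (Ω : Set (Euc d)) (lam : ℝ) (x y : Euc d) : Prop :=
  ∃ γ : ℝ → Euc d, ContinuousOn γ (Icc 0 1) ∧ γ 0 = x ∧ γ 1 = y ∧
    γ '' Icc 0 1 ⊆ Ω ∪ {y} ∧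
    ∀ t ∈ Icc (0:ℝ) 1,
      ENNReal.ofReal lam * μH[1] (γ '' Icc t 1) ≤
        ENNReal.ofReal (infDist (γ t) (frontier Ω))

/-- A `C`-good Harnack chain from `x ∈ Ω` to `y ∈ cl Ω`, all of whose balls are moreover
contained in the set `W`: consecutive balls meet, each ball has radius comparable (with
constant `C`) to its distance to `∂Ω`, radii are quasi-monotone, and for each `t > 0`
there are at most `C` balls of radius in `(t, 2t]`.  If `y ∈ Ω` the chain is finite and
`y` lies in its last ball; if `y ∈ ∂Ω` the chain is infinite and the balls converge
to `y`. -/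
def GoodChainIn {d : ℕ} (Ω W : Set (Euc d)) (C : ℝ) (x y : Euc d) : Prop :=
  (y ∈ Ω ∧ ∃ (N : ℕ) (c : ℕ → Euc d) (r : ℕ → ℝ),
    x ∈ ball (c 0) (r 0) ∧ y ∈ ball (c N) (r N) ∧
    (∀ j ≤ N, 0 < r j ∧ ball (c j) (r j) ⊆ Ω ∩ W) ∧
    (∀ j < N, (ball (c j) (r j) ∩ ball (c (j+1)) (r (j+1))).Nonempty) ∧
    (∀ j ≤ N, C⁻¹ * setD (ball (c j) (r j)) (frontier Ω) ≤ r j ∧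
      r j ≤ C * setD (ball (c j) (r j)) (frontier Ω)) ∧
    (∀ i j, i ≤ N → j ≤ N → i < j → r j ≤ C * r i) ∧
    (∀ t : ℝ, 0 < t →
      {j | j ≤ N ∧ t < r j ∧ r j ≤ 2 * t}.Finite ∧
      (Nat.card {j | j ≤ N ∧ t < r j ∧ r j ≤ 2 * t} : ℝ) ≤ C))
  ∨ (y ∈ frontier Ω ∧ ∃ (c : ℕ → Euc d) (r : ℕ → ℝ),
    x ∈ ball (c 0) (r 0) ∧
    Filter.Tendsto (fun j => infDist y (ball (c j) (r j))) atTop (nhds 0) ∧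
    (∀ j, 0 < r j ∧ ball (c j) (r j) ⊆ Ω ∩ W) ∧
    (∀ j, (ball (c j) (r j) ∩ ball (c (j+1)) (r (j+1))).Nonempty) ∧
    (∀ j, C⁻¹ * setD (ball (c j) (r j)) (frontier Ω) ≤ r j ∧
      r j ≤ C * setD (ball (c j) (r j)) (frontier Ω)) ∧
    (∀ i j : ℕ, i < j → r j ≤ C * r i) ∧
    (∀ t : ℝ, 0 < t →
      {j | t < r j ∧ r j ≤ 2 * t}.Finite ∧
      (Nat.card {j | t < r j ∧ r j ≤ 2 * t} : ℝ) ≤ C))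

/-- A `C`-good Harnack chain from `x` to `y`. -/
def GoodChain {d : ℕ} (Ω : Set (Euc d)) (C : ℝ) (x y : Euc d) : Prop :=
  GoodChainIn Ω Set.univ C x y


/-- The harmonic measure of the open set `Ω` satisfies the weak-`A∞` condition: for every
`ε₀ ∈ (0,1)` there is `δ₀ ∈ (0,1)` such that for every ball `B` centered on `∂Ω`, every
pole `p ∈ Ω \ 4B` and every Borel `E ⊆ B ∩ ∂Ω`, `ℋⁿ(E) ≤ δ₀ ℋⁿ(B ∩ ∂Ω)` implies
`ω^p(E) ≤ ε₀ ω^p(2B)`. -/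
def WeakAInfty (n : ℕ) (Ω : Set (Euc (n+1))) : Prop :=
  ∀ ε₀ ∈ Set.Ioo (0:ℝ) 1, ∃ δ₀ ∈ Set.Ioo (0:ℝ) 1,
    ∀ x₀ ∈ frontier Ω, ∀ r₀ : ℝ, 0 < r₀ →
      ∀ p ∈ Ω \ closedBall x₀ (4 * r₀),
        ∀ A : Set (Euc (n+1)), MeasurableSet A → A ⊆ ball x₀ r₀ ∩ frontier Ω →
          μH[n] A ≤ ENNReal.ofReal δ₀ * μH[n] (ball x₀ r₀ ∩ frontier Ω) →
          hMeasure Ω p A ≤ ε₀ * hMeasure Ω p (ball x₀ (2 * r₀))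

/-- `ω^p` satisfies the weak-`A∞` condition in the ball `B(x₀,r₀)`, with gauge `D`
(i.e. `δ₀ = D ε₀` is a witness for each `ε₀ ∈ (0,1)`). -/
def WeakAInftyBallWith (n : ℕ) (Ω : Set (Euc (n+1))) (p x₀ : Euc (n+1)) (r₀ : ℝ)
    (D : ℝ → ℝ) : Prop :=
  ∀ ε₀ ∈ Set.Ioo (0:ℝ) 1, D ε₀ ∈ Set.Ioo (0:ℝ) 1 ∧
    ∀ A : Set (Euc (n+1)), MeasurableSet A → A ⊆ ball x₀ r₀ ∩ frontier Ω →
      μH[n] A ≤ ENNReal.ofReal (D ε₀) * μH[n] (ball x₀ r₀ ∩ frontier Ω) →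
      hMeasure Ω p A ≤ ε₀ * hMeasure Ω p (ball x₀ (2 * r₀))

/-- The weak local John condition for `Ω ⊆ ℝ^{n+1}`: there are `λ, θ ∈ (0,1)` and `Λ ≥ 2`
such that every `x ∈ Ω` sees (through `λ`-carrot curves) a Borel subset `F` of
`B(x, Λ δ_Ω(x)) ∩ ∂Ω` of surface measure at least `θ ℋⁿ(B(x, Λ δ_Ω(x)) ∩ ∂Ω)`. -/
def WeakLocalJohn (n : ℕ) (Ω : Set (Euc (n+1))) : Prop :=
  ∃ lam ∈ Set.Ioo (0:ℝ) 1, ∃ θ ∈ Set.Ioo (0:ℝ) 1, ∃ Λ : ℝ, 2 ≤ Λ ∧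
    ∀ x ∈ Ω, ∃ F : Set (Euc (n+1)), MeasurableSet F ∧
      F ⊆ ball x (Λ * infDist x (frontier Ω)) ∩ frontier Ω ∧
      ENNReal.ofReal θ * μH[n] (ball x (Λ * infDist x (frontier Ω)) ∩ frontier Ω) ≤
        μH[n] F ∧
      ∀ y ∈ F, CarrotCurve Ω lam x y

/-- The corkscrew condition for `Ω`. -/
def CorkscrewCond {d : ℕ} (Ω : Set (Euc d)) : Prop :=
  ∃ c > (0:ℝ), ∀ x ∈ frontier Ω, ∀ ρ : ℝ, 0 < ρ → ENNReal.ofReal ρ ≤ EMetric.diam Ω →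
    ∃ (y : Euc d) (r : ℝ), c * ρ ≤ r ∧ ball y r ⊆ ball x ρ ∩ Ω

/-- `F ⊆ ℝ^{n+1}` is uniformly `n`-rectifiable, with AD-regularity constant `C₀` and
big-pieces-of-Lipschitz-images constants `θ`, `M`. -/
def UnifRectifiable (n : ℕ) (C₀ θ M : ℝ) (F : Set (Euc (n+1))) : Prop :=
  ADRegular n C₀ F ∧ 0 < θ ∧ 0 < M ∧
    ∀ x ∈ F, ∀ r : ℝ, 0 < r → ENNReal.ofReal r ≤ EMetric.diam F →
      ∃ g : Euc n → Euc (n+1), LipschitzOnWith (Real.toNNReal M) g (ball 0 r) ∧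
        ENNReal.ofReal (θ * r ^ n) ≤ μH[n] (F ∩ ball x r ∩ g '' ball 0 r)

/-- The set `WA(p,Λ)` of boundary points `x ∈ B(p, 10 δ_Ω(p)) ∩ ∂Ω` at which the harmonic
measure `ω^p` is comparable (with constant `Λ`) to the normalized surface measure
`μ(B(x,r))/μ(B(x,δ_Ω(p)))` at every scale `0 < r ≤ δ_Ω(p)`. -/
def WAset (n : ℕ) (Ω : Set (Euc (n+1))) (p : Euc (n+1)) (Λ : ℝ) : Set (Euc (n+1)) :=
  {x | x ∈ ball p (10 * infDist p (frontier Ω)) ∩ frontier Ω ∧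
    ∀ r : ℝ, 0 < r → r ≤ infDist p (frontier Ω) →
      Λ⁻¹ * ((μH[n] (frontier Ω ∩ ball x r)).toReal /
          (μH[n] (frontier Ω ∩ ball x (infDist p (frontier Ω)))).toReal) ≤
        hMeasure Ω p (ball x r) ∧
      hMeasure Ω p (ball x r) ≤
        Λ * ((μH[n] (frontier Ω ∩ ball x r)).toReal /
          (μH[n] (frontier Ω ∩ ball x (infDist p (frontier Ω)))).toReal)}


/-- A David–Semmes dyadic lattice associated to a measure `μ` supported on the set `F`,
with comparability constant `Cl`: for each generation `j ∈ ℤ` a partition of `F` into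
Borel "cubes" of side length `2^{-j}`, nested across generations, with
`diam Q ≤ ℓ(Q)`, `μ(Q) ≈ ℓ(Q)ⁿ`, centers deep inside the cubes, and small boundaries. -/
structure DSLattice (n : ℕ) (F : Set (Euc (n+1))) (μ : Measure (Euc (n+1))) (Cl : ℝ) where
  cube : ℤ → Set (Set (Euc (n+1)))
  center : Set (Euc (n+1)) → Euc (n+1)
  one_le_Cl : 1 ≤ Cl
  subset_F : ∀ j, ∀ Q ∈ cube j, Q ⊆ F
  nonempty : ∀ j, ∀ Q ∈ cube j, Q.Nonempty
  measurableSet : ∀ j, ∀ Q ∈ cube j, MeasurableSet Q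
  cover : ∀ j : ℤ, ENNReal.ofReal ((2:ℝ) ^ (-j)) ≤ EMetric.diam F →
    ∀ x ∈ F, ∃ Q ∈ cube j, x ∈ Q
  disj : ∀ j, ∀ Q ∈ cube j, ∀ Q' ∈ cube j, Q ≠ Q' → Disjoint Q Q'
  nested : ∀ j k : ℤ, k ≤ j → ∀ Q ∈ cube j, ∀ Q' ∈ cube k, (Q ∩ Q').Nonempty → Q ⊆ Q'
  diam_le : ∀ j, ∀ Q ∈ cube j, EMetric.diam Q ≤ ENNReal.ofReal ((2:ℝ) ^ (-j))
  measure_lb : ∀ j, ∀ Q ∈ cube j, ENNReal.ofReal (Cl⁻¹ * ((2:ℝ) ^ (-j)) ^ n) ≤ μ Q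
  measure_ub : ∀ j, ∀ Q ∈ cube j, μ Q ≤ ENNReal.ofReal (Cl * ((2:ℝ) ^ (-j)) ^ n)
  center_mem : ∀ j, ∀ Q ∈ cube j, center Q ∈ Q
  center_far : ∀ j, ∀ Q ∈ cube j, ∀ y ∈ F \ Q, Cl⁻¹ * (2:ℝ) ^ (-j) ≤ dist (center Q) y
  small_boundary : ∀ j, ∀ Q ∈ cube j, ∀ τ : ℝ, 0 < τ → τ < 1 →
    μ {x ∈ Q | infDist x (F \ Q) ≤ τ * (2:ℝ) ^ (-j)} +
        μ {x ∈ F \ Q | infDist x Q ≤ τ * (2:ℝ) ^ (-j)} ≤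
      ENNReal.ofReal (Cl * τ ^ (1 / Cl) * ((2:ℝ) ^ (-j)) ^ n)

/-- A cube of the lattice, recorded together with its generation. -/
abbrev Cube (n : ℕ) : Type := ℤ × Set (Euc (n+1))

/-- Membership of a (generation, cube) pair in the lattice. -/
def DSLattice.mem {n : ℕ} {F : Set (Euc (n+1))} {μ : Measure (Euc (n+1))} {Cl : ℝ}
    (L : DSLattice n F μ Cl) (q : Cube n) : Prop := q.2 ∈ L.cube q.1

/-- Side length `ℓ(Q) = 2^{-j}` of a cube of generation `j`. -/
def sideLen {n : ℕ} (q : Cube n) : ℝ := (2:ℝ) ^ (-q.1)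

/-- The ball `t·B_Q = B(z_Q, t · 4 ℓ(Q))` associated to the cube `q`. -/
def cubeBall {n : ℕ} {F : Set (Euc (n+1))} {μ : Measure (Euc (n+1))} {Cl : ℝ}
    (L : DSLattice n F μ Cl) (t : ℝ) (q : Cube n) : Set (Euc (n+1)) :=
  ball (L.center q.2) (t * (4 * sideLen q))

/-- The dilated cube `λQ = {x ∈ F : dist(x,Q) ≤ (λ-1) ℓ(Q)}`. -/
def dilCube {n : ℕ} (F : Set (Euc (n+1))) (lam : ℝ) (q : Cube n) : Set (Euc (n+1)) :=
  {x ∈ F | infDist x q.2 ≤ (lam - 1) * sideLen q}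

/-- The bilateral beta coefficient `bβ_F(B(x,r))`: infimum over affine `n`-planes `L`
meeting `B(x,r)` of `r⁻¹ (sup_{y ∈ F ∩ B} dist(y,L) + sup_{y ∈ L ∩ B} dist(y,F))`. -/
def bbeta (n : ℕ) (F : Set (Euc (n+1))) (x : Euc (n+1)) (r : ℝ) : ℝ :=
  sInf {t | ∃ L : AffineSubspace ℝ (Euc (n+1)),
    Module.finrank ℝ L.direction = n ∧ ((L : Set (Euc (n+1))) ∩ ball x r).Nonempty ∧
    t = r⁻¹ * ((⨆ y ∈ F ∩ ball x r, infDist y (L : Set (Euc (n+1)))) +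
      ⨆ y ∈ (L : Set (Euc (n+1))) ∩ ball x r, infDist y F)}

/-- `q` belongs to `D_μ(R)`: a lattice cube contained in `R` of generation at least that
of `R`. -/
def InD {n : ℕ} {F : Set (Euc (n+1))} {μ : Measure (Euc (n+1))} {Cl : ℝ}
    (L : DSLattice n F μ Cl) (R q : Cube n) : Prop :=
  L.mem q ∧ q.2 ⊆ R.2 ∧ R.1 ≤ q.1

section Corona
variable {n : ℕ} {F : Set (Euc (n+1))} {μ : Measure (Euc (n+1))} {Cl : ℝ}

/-- The harmonic-measure density `ω^p(λQ)/μ(λQ)` of the dilated cube `λQ`. -/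
def dens (Ω : Set (Euc (n+1))) (μ : Measure (Euc (n+1))) (p : Euc (n+1)) (lam : ℝ)
    (q : Cube n) : ℝ :=
  hMeasure Ω p (dilCube (frontier Ω) lam q) / (μ (dilCube (frontier Ω) lam q)).toReal

/-- Being a high density cube (before maximality): `ω^p(2Q)/μ(2Q) ≥ A ω^p(2R₀)/μ(2R₀)`. -/
def HDcond (Ω : Set (Euc (n+1))) (μ : Measure (Euc (n+1))) (L : DSLattice n F μ Cl)
    (p : Euc (n+1)) (R₀ : Cube n) (A : ℝ) (q : Cube n) : Prop :=
  L.mem q ∧ q.2 ⊆ R₀.2 ∧ A * dens Ω μ p 2 R₀ ≤ dens Ω μ p 2 q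

/-- Being a low density cube (before maximality): `ω^p(Q)/μ(Q) ≤ A⁻¹ ω^p(R₀)/μ(R₀)`. -/
def LDcond (Ω : Set (Euc (n+1))) (μ : Measure (Euc (n+1))) (L : DSLattice n F μ Cl)
    (p : Euc (n+1)) (R₀ : Cube n) (A : ℝ) (q : Cube n) : Prop :=
  L.mem q ∧ q.2 ⊆ R₀.2 ∧
    hMeasure Ω p q.2 / (μ q.2).toReal ≤ A⁻¹ * (hMeasure Ω p R₀.2 / (μ R₀.2).toReal)

/-- Maximal cubes of the lattice satisfying a given property. -/
def MaximalWith (L : DSLattice n F μ Cl) (P : Cube n → Prop) (q : Cube n) : Prop :=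
  P q ∧ ∀ q' : Cube n, L.mem q' → q'.1 < q.1 → q.2 ⊆ q'.2 → ¬ P q'

/-- The family `HD` of maximal high density cubes contained in `R₀`. -/
def HDfam (Ω : Set (Euc (n+1))) (μ : Measure (Euc (n+1))) (L : DSLattice n F μ Cl)
    (p : Euc (n+1)) (R₀ : Cube n) (A : ℝ) : Set (Cube n) :=
  {q | MaximalWith L (HDcond Ω μ L p R₀ A) q}

/-- The family `LD` of maximal low density cubes contained in `R₀`. -/
def LDfam (Ω : Set (Euc (n+1))) (μ : Measure (Euc (n+1))) (L : DSLattice n F μ Cl)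
    (p : Euc (n+1)) (R₀ : Cube n) (A : ℝ) : Set (Cube n) :=
  {q | MaximalWith L (LDcond Ω μ L p R₀ A) q}

/-- `B_H`, the union of the high density cubes. -/
def BHset (Ω : Set (Euc (n+1))) (μ : Measure (Euc (n+1))) (L : DSLattice n F μ Cl)
    (p : Euc (n+1)) (R₀ : Cube n) (A : ℝ) : Set (Euc (n+1)) :=
  ⋃ q ∈ HDfam Ω μ L p R₀ A, q.2

/-- `B_L`, the union of the low density cubes. -/
def BLset (Ω : Set (Euc (n+1))) (μ : Measure (Euc (n+1))) (L : DSLattice n F μ Cl)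
    (p : Euc (n+1)) (R₀ : Cube n) (A : ℝ) : Set (Euc (n+1)) :=
  ⋃ q ∈ LDfam Ω μ L p R₀ A, q.2

/-- The family `G` of cubes of `D_μ(R₀)` not contained in any high or low density cube. -/
def Gfam (Ω : Set (Euc (n+1))) (μ : Measure (Euc (n+1))) (L : DSLattice n F μ Cl)
    (p : Euc (n+1)) (R₀ : Cube n) (A : ℝ) : Set (Cube n) :=
  {q | InD L R₀ q ∧
    ∀ q' ∈ HDfam Ω μ L p R₀ A ∪ LDfam Ω μ L p R₀ A, ¬ q.2 ⊆ q'.2}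

/-- `bβ(Q) := bβ_{∂Ω}(100 B_Q)`. -/
def bbetaQ (n : ℕ) {F : Set (Euc (n+1))} {μ : Measure (Euc (n+1))} {Cl : ℝ}
    (L : DSLattice n F μ Cl) (G : Set (Euc (n+1))) (q : Cube n) : ℝ :=
  bbeta n G (L.center q.2) (100 * (4 * sideLen q))

/-- `q'` is the dyadic parent of `q`. -/
def IsParent (L : DSLattice n F μ Cl) (q' q : Cube n) : Prop :=
  L.mem q' ∧ q'.1 = q.1 - 1 ∧ q.2 ⊆ q'.2

/-- The stopping condition for the corona decomposition: `Q ∉ G` or `bβ(Q̂) > ε`. -/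
def StopBad (Ω : Set (Euc (n+1))) (μ : Measure (Euc (n+1))) (L : DSLattice n F μ Cl)
    (p : Euc (n+1)) (R₀ : Cube n) (A ε : ℝ) (q : Cube n) : Prop :=
  q ∉ Gfam Ω μ L p R₀ A ∨ ∃ q', IsParent L q' q ∧ ε < bbetaQ n L (frontier Ω) q'

/-- `Stop(R)`: the maximal cubes of `D_μ(R) \ {R}` satisfying the stopping condition. -/
def StopFam (Ω : Set (Euc (n+1))) (μ : Measure (Euc (n+1))) (L : DSLattice n F μ Cl)
    (p : Euc (n+1)) (R₀ : Cube n) (A ε : ℝ) (R : Cube n) : Set (Cube n) :=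
  {q | L.mem q ∧ q.2 ⊆ R.2 ∧ R.1 < q.1 ∧ StopBad Ω μ L p R₀ A ε q ∧
    ∀ q' : Cube n, L.mem q' → q'.2 ⊆ R.2 → R.1 < q'.1 → q'.1 < q.1 → q.2 ⊆ q'.2 →
      ¬ StopBad Ω μ L p R₀ A ε q'}

/-- `Tree(R)`: the cubes of `D_μ(R)` not contained in any cube from `Stop(R)`. -/
def TreeFam (Ω : Set (Euc (n+1))) (μ : Measure (Euc (n+1))) (L : DSLattice n F μ Cl)
    (p : Euc (n+1)) (R₀ : Cube n) (A ε : ℝ) (R : Cube n) : Set (Cube n) :=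
  {q | InD L R q ∧ ∀ s ∈ StopFam Ω μ L p R₀ A ε R, ¬ q.2 ⊆ s.2}

/-- The generations `Top_k` of the corona decomposition. -/
def TopFam (Ω : Set (Euc (n+1))) (μ : Measure (Euc (n+1))) (L : DSLattice n F μ Cl)
    (p : Euc (n+1)) (R₀ : Cube n) (A ε : ℝ) : ℕ → Set (Cube n)
  | 0 => {q | q ∈ Gfam Ω μ L p R₀ A ∧ q.1 = R₀.1 + 10}
  | (k+1) => {q | ∃ R ∈ TopFam Ω μ L p R₀ A ε k,
      q ∈ StopFam Ω μ L p R₀ A ε R ∧ q ∈ Gfam Ω μ L p R₀ A}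

/-- `Top := ⋃_k Top_k`. -/
def TopAll (Ω : Set (Euc (n+1))) (μ : Measure (Euc (n+1))) (L : DSLattice n F μ Cl)
    (p : Euc (n+1)) (R₀ : Cube n) (A ε : ℝ) : Set (Cube n) :=
  {q | ∃ k : ℕ, q ∈ TopFam Ω μ L p R₀ A ε k}

/-- `Tree^{(N)}(R)`: cubes of `Tree(R)` of side length larger than `2^{-N} ℓ(R₀)`. -/
def TreeN (Ω : Set (Euc (n+1))) (μ : Measure (Euc (n+1))) (L : DSLattice n F μ Cl)
    (p : Euc (n+1)) (R₀ : Cube n) (A ε : ℝ) (N : ℕ) (R : Cube n) : Set (Cube n) :=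
  {q | q ∈ TreeFam Ω μ L p R₀ A ε R ∧ q.1 < R₀.1 + N}

/-- `Top_b^{(N)}`: the cubes `R` of `Top` of side length larger than `2^{-N} ℓ(R₀)` with
`Tree(R) ≠ {R}`. -/
def TopbN (Ω : Set (Euc (n+1))) (μ : Measure (Euc (n+1))) (L : DSLattice n F μ Cl)
    (p : Euc (n+1)) (R₀ : Cube n) (A ε : ℝ) (N : ℕ) : Set (Cube n) :=
  {R | R ∈ TopAll Ω μ L p R₀ A ε ∧ R.1 < R₀.1 + N ∧
    ∃ q ∈ TreeFam Ω μ L p R₀ A ε R, q ≠ R}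

end Corona


section Part1

section MeanValue
variable {d : ℕ}

/-- Standard basis vector. -/
abbrev eb (i : Fin d) : Euc d := EuclideanSpace.single i (1:ℝ)

lemma eb_inner (y : Euc d) (i : Fin d) : inner ℝ y (eb i) = y i := by
  rw [EuclideanSpace.inner_single_right]; simp

lemma sum_eb (y : Euc d) : ∑ i, y i • eb i = y := by
  have := (EuclideanSpace.basisFun (Fin d) ℝ).sum_repr y
  simpa [eb] using this

lemma weighted_mean_le (f : Euc d → ℝ) (f' : Euc d → Euc d →L[ℝ] ℝ)
    (f'' : Fin d → Euc d → (Euc d →L[ℝ] ℝ)) (hf : ∀ y, HasFDerivAt f (f' y) y)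
    (hf'c : Continuous f') (hf'' : ∀ i y, HasFDerivAt (fun z => f' z (eb i)) (f'' i y) y)
    (hf''c : ∀ i, Continuous (f'' i)) (x : Euc d) (r : ℝ) (hr : 0 < r)
    (hL : ∀ y ∈ ball x r, ∑ i, f'' i y (eb i) ≤ 0)
    (χ : ℝ → ℝ) (hχ : Continuous χ) (hχ0 : ∀ s, 0 ≤ χ s) (hχ1 : ∀ s, 1 ≤ s → χ s = 0) :
    ∫ y : Euc d, f (x + r • y) * χ (‖y‖^2) ≤ f x * ∫ y : Euc d, χ (‖y‖^2) := by
  have hfc : Continuous f := continuous_iff_continuousAt.2 fun y => (hf y).continuousAt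
  -- supports
  have hcs : ∀ h : Euc d → ℝ, (∀ y, 1 < ‖y‖ → h y = 0) → HasCompactSupport h := by
    intro h hh
    refine HasCompactSupport.intro (isCompact_closedBall (0 : Euc d) 1) fun y hy => hh y ?_
    simpa using hy
  have hχn : ∀ y : Euc d, 1 ≤ ‖y‖ → χ (‖y‖^2) = 0 := fun y hy => hχ1 _ (by nlinarith)
  have hχc : Continuous fun y : Euc d => χ (‖y‖^2) := by fun_prop
  set Ψ : ℝ → ℝ := fun s => (∫ u in s..1, χ u) / 2 with hΨ
  have hΨd : ∀ s, HasDerivAt Ψ (-(χ s) / 2) s := fun s =>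
    (intervalIntegral.integral_hasDerivAt_left (hχ.intervalIntegrable _ _)
      hχ.stronglyMeasurable.stronglyMeasurableAtFilter hχ.continuousAt).div_const 2
  have hΨ1 : ∀ s, 1 ≤ s → Ψ s = 0 := by
    intro s hs
    have : ∫ u in s..1, χ u = ∫ u in s..1, (0:ℝ) := by
      apply intervalIntegral.integral_congr
      intro u hu
      rw [uIcc_of_ge hs] at hu
      exact hχ1 u hu.1
    simp [hΨ, this]
  have hΨ0 : ∀ s, 0 ≤ Ψ s := by
    intro s
    rcases le_total 1 s with hs | hs
    · rw [hΨ1 s hs]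
    · have := intervalIntegral.integral_nonneg (μ := volume) hs (fun u _ => hχ0 u)
      simp only [hΨ]; linarith
  set g : Euc d → ℝ := fun y => Ψ (‖y‖^2) with hg
  have hgd : ∀ y, HasFDerivAt g ((-(χ (‖y‖^2))) • innerSL ℝ y) y := by
    intro y
    have h1 : HasFDerivAt (fun y : Euc d => ‖y‖^2) (2 • innerSL ℝ y) y :=
      (hasStrictFDerivAt_norm_sq y).hasFDerivAt
    have h2 := (hΨd (‖y‖^2)).comp_hasFDerivAt y h1
    refine h2.congr_fderiv ?_
    ext v
    simp only [_root_.smul_apply, innerSL_apply_apply, smul_eq_mul, nsmul_eq_mul]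
    push_cast
    ring
  have hgc : Continuous g := continuous_iff_continuousAt.2 fun y => (hgd y).continuousAt
  have hgn : ∀ y : Euc d, 1 ≤ ‖y‖ → g y = 0 := fun y hy => hΨ1 _ (by nlinarith)
  -- integration by parts
  have ibp : ∀ t : ℝ, ∫ y : Euc d, f' (x + t • y) y * χ (‖y‖^2)
      = t * ∫ y : Euc d, (∑ i, f'' i (x + t • y) (eb i)) * g y := by
    intro t
    have hi : ∀ i, ∫ y : Euc d, f' (x + t • y) (eb i) * (y i * χ (‖y‖^2))
        = ∫ y : Euc d, (t * f'' i (x + t • y) (eb i)) * g y := by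
      intro i
      have hF : ∀ y, HasFDerivAt (fun y => f' (x + t • y) (eb i)) (t • f'' i (x + t • y)) y := by
        intro y
        have h1 : HasFDerivAt (fun y : Euc d => x + t • y) (t • ContinuousLinearMap.id ℝ (Euc d)) y := by
          simpa using ((hasFDerivAt_id y).const_smul t).const_add x
        have := (hf'' i (x + t • y)).comp y h1
        refine this.congr_fderiv ?_
        ext v; simp
      have key := integral_bilinear_hasFDerivAt_right_eq_neg_left_of_integrable
        (μ := (volume : Measure (Euc d))) (v := eb i)
        (B := ContinuousLinearMap.mul ℝ ℝ) (f := fun y => f' (x + t • y) (eb i))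
        (f' := fun y => t • f'' i (x + t • y)) (g := g)
        (g' := fun y => (-(χ (‖y‖^2))) • innerSL ℝ y) ?_ ?_ ?_ (fun y _ => hF y) (fun y _ => hgd y)
      · simp only [ContinuousLinearMap.mul_apply', _root_.smul_apply, smul_eq_mul,
          innerSL_apply_apply, eb_inner] at key
        rw [← neg_inj, ← key, ← integral_neg]
        congr 1; ext y; ring
      · simp only [ContinuousLinearMap.mul_apply', _root_.smul_apply, smul_eq_mul]
        refine Continuous.integrable_of_hasCompactSupport ?_ (hcs _ fun y hy => ?_)
        · have := hf''c i
          fun_prop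
        · rw [hgn y hy.le, mul_zero]
      · simp only [ContinuousLinearMap.mul_apply', _root_.smul_apply, smul_eq_mul,
          innerSL_apply_apply, eb_inner]
        refine Continuous.integrable_of_hasCompactSupport ?_ (hcs _ fun y hy => ?_)
        · fun_prop
        · rw [hχn y hy.le]; simp
      · simp only [ContinuousLinearMap.mul_apply']
        refine Continuous.integrable_of_hasCompactSupport ?_ (hcs _ fun y hy => ?_)
        · fun_prop
        · rw [hgn y hy.le, mul_zero]
    have e1 : ∀ y : Euc d, f' (x + t • y) y * χ (‖y‖^2)
        = ∑ i, f' (x + t • y) (eb i) * (y i * χ (‖y‖^2)) := by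
      intro y
      have h := congrArg (f' (x + t • y)) (sum_eb y)
      rw [map_sum] at h
      rw [← h, Finset.sum_mul]
      refine Finset.sum_congr rfl fun i _ => ?_
      rw [map_smul, smul_eq_mul]; ring
    simp_rw [e1]
    rw [integral_finsetSum, ← integral_const_mul]
    · simp_rw [hi]
      rw [← integral_finsetSum]
      · congr 1; ext y
        rw [Finset.sum_mul, Finset.mul_sum]
        refine Finset.sum_congr rfl fun i _ => ?_
        ring
      · intro i _
        refine Continuous.integrable_of_hasCompactSupport ?_ (hcs _ fun y hy => ?_)
        · have := hf''c i
          fun_prop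
        · rw [hgn y hy.le, mul_zero]
    · intro i _
      refine Continuous.integrable_of_hasCompactSupport ?_ (hcs _ fun y hy => ?_)
      · fun_prop
      · rw [hχn y hy.le]; simp
  set m : ℝ → ℝ := fun t => ∫ y : Euc d, f (x + t • y) * χ (‖y‖^2) with hm
  have hmd : ∀ t, HasDerivAt m (∫ y : Euc d, f' (x + t • y) y * χ (‖y‖^2)) t := by
    intro t
    obtain ⟨C, hC⟩ := (isCompact_closedBall x (|t| + 1)).exists_bound_of_continuousOn
      hf'c.continuousOn
    have hCc : Continuous fun y : Euc d => C * χ (‖y‖^2) := by fun_prop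
    refine (hasDerivAt_integral_of_dominated_loc_of_deriv_le (μ := (volume : Measure (Euc d)))
      (F := fun t y => f (x + t • y) * χ (‖y‖^2))
      (F' := fun t y => f' (x + t • y) y * χ (‖y‖^2))
      (bound := fun y => C * χ (‖y‖^2)) (s := ball t 1) (ball_mem_nhds t one_pos) ?_ ?_ ?_ ?_ ?_ ?_).2
    · refine Eventually.of_forall fun s => ?_
      have : Continuous fun y : Euc d => f (x + s • y) * χ (‖y‖^2) := by fun_prop
      exact this.aestronglyMeasurable
    · refine Continuous.integrable_of_hasCompactSupport (by fun_prop) (hcs _ fun y hy => ?_)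
      rw [hχn y hy.le]; simp
    · have : Continuous fun y : Euc d => f' (x + t • y) y * χ (‖y‖^2) := by fun_prop
      exact this.aestronglyMeasurable
    · refine Eventually.of_forall fun y s hs => ?_
      by_cases hy : 1 ≤ ‖y‖
      · simp [hχn y hy]
      · push Not at hy
        rw [norm_mul, Real.norm_of_nonneg (hχ0 _)]
        have hst : |s| ≤ |t| + 1 := by
          rw [mem_ball, Real.dist_eq] at hs
          have := abs_sub_abs_le_abs_sub s t
          linarith
        have h1 : x + s • y ∈ closedBall x (|t| + 1) := by
          simp [norm_smul]
          nlinarith [norm_nonneg y, abs_nonneg s]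
        have h2 := hC _ h1
        have h3 := (f' (x + s • y)).le_opNorm y
        have : ‖f' (x + s • y) y‖ ≤ C := by
          nlinarith [norm_nonneg y, norm_nonneg (f' (x + s • y))]
        exact mul_le_mul_of_nonneg_right this (hχ0 _)
    · refine Continuous.integrable_of_hasCompactSupport hCc (hcs _ fun y hy => ?_)
      rw [hχn y hy.le]; simp
    · refine Eventually.of_forall fun y s _ => ?_
      have h1 : HasDerivAt (fun s : ℝ => x + s • y) y s := by
        simpa using ((hasDerivAt_id s).smul_const y).const_add x
      exact ((hf (x + s • y)).comp_hasDerivAt s h1).mul_const _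
  have hanti : AntitoneOn m (Icc 0 r) := by
    refine antitoneOn_of_deriv_nonpos (convex_Icc 0 r)
      (fun t _ => (hmd t).continuousAt.continuousWithinAt)
      (fun t _ => (hmd t).differentiableAt.differentiableWithinAt) ?_
    intro t ht
    rw [interior_Icc] at ht
    rw [(hmd t).deriv, ibp t]
    refine mul_nonpos_of_nonneg_of_nonpos ht.1.le (integral_nonpos fun y => ?_)
    by_cases hy : 1 ≤ ‖y‖
    · simp [hgn y hy]
    · push Not at hy
      refine mul_nonpos_of_nonpos_of_nonneg (hL _ ?_) (hΨ0 _)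
      simp [norm_smul, abs_of_pos ht.1]
      nlinarith [ht.1, ht.2]
  have := hanti (left_mem_Icc.2 hr.le) (right_mem_Icc.2 hr.le) hr.le
  simpa [hm, integral_const_mul] using this

lemma setIntegral_ball_scale (h : Euc d → ℝ) (x : Euc d) (r : ℝ) (hr : 0 < r) :
    ∫ y in ball x r, h y = r ^ d * ∫ y in ball (0 : Euc d) 1, h (x + r • y) := by
  rw [← integral_indicator measurableSet_ball, ← integral_indicator measurableSet_ball]
  have h1 := Measure.integral_comp_smul (volume : Measure (Euc d))
    (fun y => (ball x r).indicator h (x + y)) r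
  rw [integral_add_left_eq_self (fun y => (ball x r).indicator h y) x] at h1
  have h2 : ∀ y : Euc d, (ball x r).indicator h (x + r • y)
      = (ball (0 : Euc d) 1).indicator (fun y => h (x + r • y)) y := by
    intro y
    have : x + r • y ∈ ball x r ↔ y ∈ ball (0 : Euc d) 1 := by
      simp [norm_smul, abs_of_pos hr]
      constructor
      · intro h; nlinarith
      · intro h; nlinarith
    by_cases hy : y ∈ ball (0 : Euc d) 1
    · rw [indicator_of_mem hy, indicator_of_mem (this.2 hy)]
    · rw [indicator_of_notMem hy, indicator_of_notMem (fun h => hy (this.1 h))]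
  simp_rw [h2] at h1
  rw [h1]
  have : (0:ℝ) < r ^ d := by positivity
  simp [abs_of_pos hr]
  field_simp

lemma mean_le (f : Euc d → ℝ) (f' : Euc d → Euc d →L[ℝ] ℝ)
    (f'' : Fin d → Euc d → (Euc d →L[ℝ] ℝ)) (hf : ∀ y, HasFDerivAt f (f' y) y)
    (hf'c : Continuous f') (hf'' : ∀ i y, HasFDerivAt (fun z => f' z (eb i)) (f'' i y) y)
    (hf''c : ∀ i, Continuous (f'' i)) (x : Euc d) (r : ℝ) (hr : 0 < r)
    (hL : ∀ y ∈ ball x r, ∑ i, f'' i y (eb i) ≤ 0) :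
    ⨍ y in ball x r, f y ≤ f x := by
  have hfc : Continuous f := continuous_iff_continuousAt.2 fun y => (hf y).continuousAt
  set χ : ℕ → ℝ → ℝ := fun k s => min 1 (k * max 0 (1 - s)) with hχdef
  have hχ0 : ∀ k s, 0 ≤ χ k s := fun k s => by simp only [hχdef]; positivity
  have hχ1 : ∀ k s, 1 ≤ s → χ k s = 0 := fun k s hs => by
    have : max 0 (1 - s) = 0 := max_eq_left (by linarith)
    simp [hχdef, this]
  have hχle : ∀ k s, χ k s ≤ 1 := fun k s => min_le_left _ _
  have hχlim : ∀ s, s < 1 → Tendsto (fun k => χ k s) atTop (𝓝 1) := by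
    intro s hs
    refine tendsto_const_nhds.congr' ?_
    obtain ⟨N, hN⟩ := exists_nat_ge (1 / (1 - s))
    filter_upwards [eventually_ge_atTop N] with k hk
    have h0 : 0 < 1 - s := by linarith
    have : (1:ℝ) ≤ k * (1 - s) := by
      rw [div_le_iff₀ h0] at hN
      have : (N:ℝ) ≤ k := by exact_mod_cast hk
      nlinarith
    simp only [hχdef, max_eq_right h0.le]
    rw [min_eq_left this]
  have hlim : ∀ h : Euc d → ℝ, Continuous h →
      Tendsto (fun k => ∫ y : Euc d, h y * χ k (‖y‖^2)) atTop
        (𝓝 (∫ y in ball (0 : Euc d) 1, h y)) := by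
    intro h hh
    obtain ⟨C, hC⟩ := (isCompact_closedBall (0 : Euc d) 1).exists_bound_of_continuousOn
      hh.continuousOn
    have hC0 : 0 ≤ C := (norm_nonneg _).trans (hC 0 (by simp))
    rw [← integral_indicator measurableSet_ball]
    refine tendsto_integral_of_dominated_convergence
      ((closedBall (0 : Euc d) 1).indicator fun _ => C) ?_ ?_ ?_ ?_
    · intro k
      have : Continuous fun y : Euc d => h y * χ k (‖y‖^2) := by
        simp only [hχdef]; fun_prop
      exact this.aestronglyMeasurable
    · rw [integrable_indicator_iff measurableSet_closedBall]
      exact integrableOn_const (measure_closedBall_lt_top.ne)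
    · intro k
      refine Eventually.of_forall fun y => ?_
      by_cases hy : y ∈ closedBall (0 : Euc d) 1
      · rw [indicator_of_mem hy, norm_mul, Real.norm_of_nonneg (hχ0 _ _)]
        have := hC y hy
        nlinarith [hχ0 k (‖y‖^2), hχle k (‖y‖^2), norm_nonneg (h y)]
      · rw [indicator_of_notMem hy, hχ1, mul_zero, norm_zero]
        simp at hy
        nlinarith
    · refine Eventually.of_forall fun y => ?_
      by_cases hy : y ∈ ball (0 : Euc d) 1
      · rw [indicator_of_mem hy]
        simp at hy
        simpa using (hχlim (‖y‖^2) (by nlinarith [norm_nonneg y])).const_mul (h y)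
      · rw [indicator_of_notMem hy]
        simp at hy
        refine tendsto_const_nhds.congr fun k => ?_
        rw [hχ1 k _ (by nlinarith), mul_zero]
  have h1 := hlim (fun y => f (x + r • y)) (by fun_prop)
  have h2 := (hlim (fun y => 1) continuous_const).const_mul (f x)
  have h3 := le_of_tendsto_of_tendsto' h1 h2 fun k => by
    have := weighted_mean_le f f' f'' hf hf'c hf'' hf''c x r hr hL (χ k)
      (by simp only [hχdef]; fun_prop) (hχ0 k) (hχ1 k)
    simpa using this
  have e1 := setIntegral_ball_scale f x r hr
  have e2 := setIntegral_ball_scale (fun _ => (1:ℝ)) x r hr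
  have hv : 0 < ∫ y in ball x r, (1:ℝ) := by
    rw [setIntegral_const]
    simp only [smul_eq_mul, mul_one, measureReal_def]
    exact ENNReal.toReal_pos (measure_ball_pos _ _ hr).ne' measure_ball_lt_top.ne
  rw [setAverage_eq]
  have hv2 : ∫ y in ball x r, (1:ℝ) = volume.real (ball x r) := by
    rw [setIntegral_const]; simp
  rw [smul_eq_mul, inv_mul_le_iff₀ (by rw [← hv2]; exact hv), ← hv2, e1, e2]
  have : (0:ℝ) < r ^ d := by positivity
  nlinarith

end MeanValue

end Part1

section Part2

section Kernel
variable {n : ℕ}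

/-- The fundamental solution. -/
def Ek (n : ℕ) (w : Euc (n+1)) : ℝ := ‖w‖ ^ ((1 : ℤ) - n)

/-- The regularized fundamental solution. -/
def Ke (n : ℕ) (ε : ℝ) (w : Euc (n+1)) : ℝ := (‖w‖^2 + ε^2) ^ ((1 - (n:ℝ))/2)

lemma Ek_nonneg (w : Euc (n+1)) : 0 ≤ Ek n w := by unfold Ek; positivity

lemma Ek_pos {w : Euc (n+1)} (hw : w ≠ 0) : 0 < Ek n w := by
  have := norm_pos_iff.2 hw
  unfold Ek; positivity

lemma Ek_zero (hn : 2 ≤ n) : Ek n 0 = 0 := by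
  unfold Ek
  rw [norm_zero, zero_zpow]
  omega

lemma Ek_neg (w : Euc (n+1)) : Ek n (-w) = Ek n w := by unfold Ek; rw [norm_neg]

lemma Ek_sub_comm (x y : Euc (n+1)) : Ek n (x - y) = Ek n (y - x) := by
  rw [← Ek_neg, neg_sub]

/-- reciprocal-power form -/
lemma Ek_eq (hn : 2 ≤ n) (w : Euc (n+1)) : Ek n w = (‖w‖ ^ (n-1))⁻¹ := by
  unfold Ek
  have : (1:ℤ) - n = -((n-1 : ℕ) : ℤ) := by omega
  rw [this, zpow_neg, zpow_natCast]

lemma Ek_le_of_le (hn : 2 ≤ n) {w : Euc (n+1)} {r : ℝ} (hr : 0 < r) (h : r ≤ ‖w‖) :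
    Ek n w ≤ (r ^ (n-1))⁻¹ := by
  rw [Ek_eq hn]
  gcongr

lemma le_Ek_of_le (hn : 2 ≤ n) {w : Euc (n+1)} {r : ℝ} (hw : w ≠ 0) (h : ‖w‖ ≤ r) :
    (r ^ (n-1))⁻¹ ≤ Ek n w := by
  rw [Ek_eq hn]
  have := norm_pos_iff.2 hw
  gcongr

lemma Ke_nonneg (ε : ℝ) (w : Euc (n+1)) : 0 ≤ Ke n ε w := by unfold Ke; positivity

lemma Ke_zero_eq {w : Euc (n+1)} (hw : w ≠ 0) : Ke n 0 w = Ek n w := by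
  have := norm_pos_iff.2 hw
  unfold Ke Ek
  rw [zero_pow two_ne_zero, add_zero, ← Real.rpow_natCast, ← Real.rpow_mul this.le,
    ← Real.rpow_intCast]
  congr 1
  push_cast; ring

lemma Ke_le_Ek (hn : 2 ≤ n) (ε : ℝ) {w : Euc (n+1)} (hw : w ≠ 0) : Ke n ε w ≤ Ek n w := by
  rw [← Ke_zero_eq hw]
  have := norm_pos_iff.2 hw
  unfold Ke
  apply Real.rpow_le_rpow_of_nonpos
  · positivity
  · nlinarith [sq_nonneg ε]
  · have : (2:ℝ) ≤ n := by exact_mod_cast hn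
    linarith

lemma Ke_anti (hn : 2 ≤ n) {ε ε' : ℝ} (h0 : 0 < ε') (h : ε' ≤ ε) (w : Euc (n+1)) :
    Ke n ε w ≤ Ke n ε' w := by
  unfold Ke
  apply Real.rpow_le_rpow_of_nonpos
  · positivity
  · nlinarith [sq_nonneg ε]
  · have : (2:ℝ) ≤ n := by exact_mod_cast hn
    linarith

lemma Ke_le_bound (hn : 2 ≤ n) {ε : ℝ} (hε : 0 < ε) (w : Euc (n+1)) :
    Ke n ε w ≤ (ε^2) ^ ((1 - (n:ℝ))/2) := by
  unfold Ke
  apply Real.rpow_le_rpow_of_nonpos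
  · positivity
  · nlinarith [sq_nonneg ‖w‖]
  · have : (2:ℝ) ≤ n := by exact_mod_cast hn
    linarith

lemma Ke_continuous {ε : ℝ} (hε : 0 < ε) : Continuous (Ke n ε) := by
  unfold Ke
  refine Continuous.rpow_const (by fun_prop) fun w => Or.inl ?_
  positivity

lemma Ek_measurable : Measurable (Ek n) := by
  unfold Ek; fun_prop

lemma Ek_continuousAt {w : Euc (n+1)} (hw : w ≠ 0) : ContinuousAt (Ek n) w := by
  unfold Ek
  exact ContinuousAt.zpow₀ continuous_norm.continuousAt _ (Or.inl (norm_ne_zero_iff.2 hw))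

/-- the sequence of regularization parameters -/
def es (k : ℕ) : ℝ := 1 / ((k:ℝ) + 1)

lemma es_pos (k : ℕ) : 0 < es k := by unfold es; positivity

lemma es_tendsto : Tendsto es atTop (𝓝 0) := tendsto_one_div_add_atTop_nhds_zero_nat

lemma Ke_tendsto {w : Euc (n+1)} (hw : w ≠ 0) :
    Tendsto (fun k => Ke n (es k) w) atTop (𝓝 (Ek n w)) := by
  rw [← Ke_zero_eq hw]
  have h0 := norm_pos_iff.2 hw
  have : ContinuousAt (fun ε : ℝ => Ke n ε w) 0 := by
    unfold Ke
    refine ContinuousAt.rpow_const (by fun_prop) (Or.inl ?_)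
    positivity
  exact this.tendsto.comp es_tendsto

/-- mean value inequality for combinations of the regularized kernel and the square -/
lemma Ke_comb_mean {ε : ℝ} (hε : 0 < ε) (α β : ℝ) (x : Euc (n+1)) (r : ℝ) (hr : 0 < r)
    (hL : ∀ y ∈ ball x r, α * ((1 - (n:ℝ)) * (n+1) * ε^2 * (‖y‖^2 + ε^2) ^ ((1 - (n:ℝ))/2 - 2))
      + 2 * β * (n+1) ≤ 0) :
    ⨍ y in ball x r, (α * Ke n ε y + β * ‖y‖^2) ≤ α * Ke n ε x + β * ‖x‖^2 := by
  set a : ℝ := (1 - (n:ℝ))/2 with ha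
  have hs : ∀ y : Euc (n+1), 0 < ‖y‖^2 + ε^2 := fun y => by positivity
  have hsd : ∀ y : Euc (n+1), HasFDerivAt (fun y : Euc (n+1) => ‖y‖^2 + ε^2) (2 • innerSL ℝ y) y :=
    fun y => (hasStrictFDerivAt_norm_sq y).hasFDerivAt.add_const _
  have hpd : ∀ (b : ℝ) (y : Euc (n+1)), HasFDerivAt (fun y : Euc (n+1) => (‖y‖^2 + ε^2) ^ b)
      ((b * (‖y‖^2 + ε^2) ^ (b - 1)) • (2 • innerSL ℝ y)) y := fun b y =>
    (hsd y).rpow_const (Or.inl (hs y).ne')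
  have hpc : ∀ b : ℝ, Continuous fun y : Euc (n+1) => (‖y‖^2 + ε^2) ^ b := fun b =>
    Continuous.rpow_const (by fun_prop) fun w => Or.inl (hs w).ne'
  refine mean_le (fun y => α * Ke n ε y + β * ‖y‖^2)
    (fun y => (2 * (α * a * (‖y‖^2 + ε^2) ^ (a - 1) + β)) • innerSL ℝ y)
    (fun i y => (2 * (α * a * (‖y‖^2 + ε^2) ^ (a - 1) + β)) • innerSL ℝ (eb i)
      + (4 * α * a * (a-1) * (‖y‖^2 + ε^2) ^ (a - 2) * y i) • innerSL ℝ y) ?_ ?_ ?_ ?_ x r hr ?_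
  · intro y
    have h1 : HasFDerivAt (fun y : Euc (n+1) => ‖y‖^2) (2 • innerSL ℝ y) y :=
      (hasStrictFDerivAt_norm_sq y).hasFDerivAt
    refine (((hpd a y).const_mul α).add (h1.const_mul β)).congr_fderiv ?_
    ext v
    simp
    ring
  · have := hpc (a-1)
    fun_prop
  · intro i y
    have h1 : HasFDerivAt (fun y : Euc (n+1) => y i) (innerSL ℝ (eb i)) y := by
      have : (fun y : Euc (n+1) => y i) = fun y => innerSL ℝ (eb i) y := by
        ext y; rw [innerSL_apply_apply, real_inner_comm, eb_inner]
      rw [this]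
      exact (innerSL ℝ (eb i)).hasFDerivAt
    have h2 := ((((hpd (a-1) y).const_mul (α * a)).add_const β).const_mul 2).mul h1
    have h3 : (fun z : Euc (n+1) => ((2 * (α * a * (‖z‖^2 + ε^2) ^ (a - 1) + β)) • innerSL ℝ z) (eb i))
      = fun z => 2 * (α * a * (‖z‖^2 + ε^2) ^ (a - 1) + β) * z i := by
      ext z
      rw [_root_.smul_apply, innerSL_apply_apply, eb_inner, smul_eq_mul]
    rw [h3]
    refine h2.congr_fderiv ?_
    ext v
    have : a - 1 - 1 = a - 2 := by ring
    simp [this]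
    ring
  · intro i
    have := hpc (a-1)
    have := hpc (a-2)
    fun_prop
  · intro y hy
    have h := hL y hy
    have e : ∑ i, ((2 * (α * a * (‖y‖^2 + ε^2) ^ (a - 1) + β)) • innerSL ℝ (eb i)
      + (4 * α * a * (a-1) * (‖y‖^2 + ε^2) ^ (a - 2) * y i) • innerSL ℝ y) (eb i)
      = (2 * (α * a * (‖y‖^2 + ε^2) ^ (a - 1) + β)) * (n+1)
        + 4 * α * a * (a-1) * (‖y‖^2 + ε^2) ^ (a - 2) * ‖y‖^2 := by
      have e1 : ∀ i : Fin (n+1), ((2 * (α * a * (‖y‖^2 + ε^2) ^ (a - 1) + β)) • innerSL ℝ (eb i)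
      + (4 * α * a * (a-1) * (‖y‖^2 + ε^2) ^ (a - 2) * y i) • innerSL ℝ y) (eb i)
       = (2 * (α * a * (‖y‖^2 + ε^2) ^ (a - 1) + β)) +
        4 * α * a * (a-1) * (‖y‖^2 + ε^2) ^ (a - 2) * (y i)^2 := by
        intro i
        rw [_root_.add_apply, _root_.smul_apply, _root_.smul_apply, innerSL_apply_apply,
          innerSL_apply_apply, eb_inner, eb_inner, smul_eq_mul, smul_eq_mul]
        simp [eb]
        ring
      rw [Finset.sum_congr rfl fun i _ => e1 i, Finset.sum_add_distrib, Finset.sum_const,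
        ← Finset.mul_sum, ← EuclideanSpace.real_norm_sq_eq]
      simp
      ring
    rw [e]
    have hp : (‖y‖^2 + ε^2) ^ (a - 1) = (‖y‖^2 + ε^2) ^ (a - 2) * (‖y‖^2 + ε^2) := by
      rw [← Real.rpow_add_one (hs y).ne']; congr 1; ring
    rw [hp]
    refine le_trans (le_of_eq ?_) h
    rw [ha]; ring

end Kernel

end Part2

section Part3

section KernelMean
variable {n : ℕ}

lemma vol_ball_pos {d : ℕ} (x : Euc d) {r : ℝ} (hr : 0 < r) : 0 < volume.real (ball x r) := by
  rw [measureReal_def]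
  exact ENNReal.toReal_pos (measure_ball_pos _ _ hr).ne' measure_ball_lt_top.ne

lemma vol_ball {d : ℕ} (x : Euc d) {r : ℝ} (hr : 0 < r) :
    volume.real (ball x r) = r ^ d * volume.real (ball (0 : Euc d) 1) := by
  have e2 := setIntegral_ball_scale (fun _ => (1:ℝ)) x r hr
  rw [setIntegral_const, setIntegral_const] at e2
  simpa using e2

lemma avg_eq {d : ℕ} (h : Euc d → ℝ) (x : Euc d) (r : ℝ) :
    ⨍ y in ball x r, h y = (volume.real (ball x r))⁻¹ * ∫ y in ball x r, h y := by
  rw [setAverage_eq, smul_eq_mul]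

lemma avg_const {d : ℕ} (c : ℝ) (x : Euc d) {r : ℝ} (hr : 0 < r) :
    ⨍ _y in ball x r, c = c :=
  setAverage_const (measure_ball_pos _ _ hr).ne' measure_ball_lt_top.ne c

lemma avg_mono {d : ℕ} {h h' : Euc d → ℝ} (x : Euc d) {r : ℝ} (hr : 0 < r)
    (hi : IntegrableOn h (ball x r)) (hi' : IntegrableOn h' (ball x r))
    (hh : ∀ y ∈ ball x r, h y ≤ h' y) :
    ⨍ y in ball x r, h y ≤ ⨍ y in ball x r, h' y := by
  rw [avg_eq, avg_eq]
  have := vol_ball_pos x hr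
  exact mul_le_mul_of_nonneg_left (setIntegral_mono_on hi hi' measurableSet_ball hh) (by positivity)

lemma avg_sub {d : ℕ} (h : Euc d → ℝ) (x z : Euc d) {r : ℝ} (hr : 0 < r) :
    ⨍ y in ball x r, h (y - z) = ⨍ y in ball (x - z) r, h y := by
  rw [avg_eq, avg_eq, vol_ball x hr, vol_ball (x - z) hr, setIntegral_ball_scale _ x r hr,
    setIntegral_ball_scale _ (x - z) r hr]
  congr 4
  ext y
  congr 1
  abel

lemma cont_integrableOn_ball {d : ℕ} {h : Euc d → ℝ} (hh : Continuous h) (x : Euc d) (r : ℝ) :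
    IntegrableOn h (ball x r) :=
  (hh.locallyIntegrable.integrableOn_isCompact (isCompact_closedBall x r)).mono_set
    ball_subset_closedBall

lemma Ke_super (hn : 2 ≤ n) {ε : ℝ} (hε : 0 < ε) (z x : Euc (n+1)) (r : ℝ) (hr : 0 < r) :
    ⨍ y in ball x r, Ke n ε (y - z) ≤ Ke n ε (x - z) := by
  rw [avg_sub _ _ _ hr]
  have := Ke_comb_mean (n := n) hε 1 0 (x - z) r hr (fun y _ => by
    have h1 : (0:ℝ) ≤ (n+1) * ε^2 * (‖y‖^2 + ε^2) ^ ((1 - (n:ℝ))/2 - 2) := by positivity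
    have h2 : (2:ℝ) ≤ n := by exact_mod_cast hn
    nlinarith)
  simpa using this

lemma Ke_sub (hn : 2 ≤ n) {ε : ℝ} (hε : 0 < ε) (x : Euc (n+1)) (r : ℝ) (hr : 0 < r)
    (hx : r < ‖x‖) :
    Ke n ε x ≤ (⨍ y in ball x r, Ke n ε y) +
      (n * ((‖x‖ - r)^2) ^ ((1 - (n:ℝ))/2 - 2) * (‖x‖ + r)^2) * ε^2 := by
  have h2 : (2:ℝ) ≤ n := by exact_mod_cast hn
  set P := ((‖x‖ - r)^2) ^ ((1 - (n:ℝ))/2 - 2) with hP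
  have hρ : 0 < ‖x‖ - r := by linarith
  have hP0 : 0 < P := by positivity
  have key := Ke_comb_mean (n := n) hε (-1) (-(n * P * ε^2)) x r hr (fun y hy => by
    have h1 : (‖y‖^2 + ε^2) ^ ((1 - (n:ℝ))/2 - 2) ≤ P := by
      apply Real.rpow_le_rpow_of_nonpos
      · positivity
      · have : ‖x‖ - r ≤ ‖y‖ := by
          rw [mem_ball, dist_eq_norm] at hy
          have := norm_sub_norm_le x y
          rw [norm_sub_rev] at this
          linarith
        nlinarith [sq_nonneg ε]
      · linarith
    have h3 : (0:ℝ) ≤ (n+1) * ε^2 := by positivity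
    have h4 : ((n:ℝ) - 1) * (‖y‖^2 + ε^2) ^ ((1 - (n:ℝ))/2 - 2) ≤ 2 * n * P := by nlinarith
    nlinarith [mul_le_mul_of_nonneg_left h4 h3])
  have hi1 : IntegrableOn (Ke n ε) (ball x r) := cont_integrableOn_ball (Ke_continuous hε) x r
  have hi2 : IntegrableOn (fun y : Euc (n+1) => ‖y‖^2) (ball x r) :=
    cont_integrableOn_ball (by fun_prop) x r
  have e : ⨍ y in ball x r, (-1 * Ke n ε y + -(n * P * ε^2) * ‖y‖^2)
      = - (⨍ y in ball x r, Ke n ε y) - (n * P * ε^2) * ⨍ y in ball x r, ‖y‖^2 := by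
    simp only [avg_eq]
    rw [integral_add (hi1.const_mul _) (hi2.const_mul _), integral_const_mul, integral_const_mul]
    ring
  rw [e] at key
  have h5 : ⨍ y in ball x r, ‖y‖^2 ≤ (‖x‖ + r)^2 := by
    rw [← avg_const ((‖x‖ + r)^2) x hr]
    refine avg_mono x hr hi2 (integrableOn_const measure_ball_lt_top.ne) fun y hy => ?_
    rw [mem_ball, dist_eq_norm] at hy
    have : ‖y‖ ≤ ‖x‖ + r := by
      have := norm_sub_norm_le y x
      linarith
    gcongr
  have h6 : 0 ≤ n * P * ε^2 := by positivity
  have h7 : 0 ≤ n * P * ε^2 * ‖x‖^2 := by positivity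
  nlinarith

lemma Ek_ball_int (hn : 2 ≤ n) {R : ℝ} (hR : 0 < R) :
    IntegrableOn (Ek n) (ball 0 R) ∧
      ⨍ y in ball (0 : Euc (n+1)) R, Ek n y = ((n:ℝ)+1)/2 * (R ^ (n-1))⁻¹ := by
  set f : ℝ → ℝ := (Iio R).indicator fun t => t ^ ((1:ℤ) - n) with hf
  have hfe : (fun y : Euc (n+1) => f ‖y‖) = (ball (0 : Euc (n+1)) R).indicator (Ek n) := by
    ext y
    by_cases hy : y ∈ ball (0 : Euc (n+1)) R
    · rw [indicator_of_mem hy, hf, indicator_of_mem (by simpa using hy)]; rfl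
    · rw [indicator_of_notMem hy, hf, indicator_of_notMem (by simpa using hy)]
  have hfin : Module.finrank ℝ (Euc (n+1)) = n + 1 := by simp
  have hg : EqOn (fun y : ℝ => y ^ (n + 1 - 1) • f y) ((Iio R).indicator fun y => y) (Ioi 0) := by
    intro y hy
    have hy : 0 < y := hy
    simp only [hf, smul_eq_mul]
    by_cases h : y ∈ Iio R
    · rw [indicator_of_mem h, indicator_of_mem h, Nat.add_sub_cancel, ← zpow_natCast,
        ← zpow_add₀ hy.ne']
      simp
    · rw [indicator_of_notMem h, indicator_of_notMem h, mul_zero]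
  have hset : Iio R ∩ Ioi 0 = Ioo 0 R := by
    ext t; simp [and_comm]
  constructor
  · rw [← integrable_indicator_iff measurableSet_ball, ← hfe]
    rw [integrable_fun_norm_addHaar (μ := volume) (E := Euc (n+1)) (f := f), hfin]
    rw [integrableOn_congr_fun hg measurableSet_Ioi]
    rw [integrableOn_indicator_iff measurableSet_Iio, hset]
    exact (continuous_id.locallyIntegrable.integrableOn_isCompact isCompact_Icc).mono_set
      Ioo_subset_Icc_self
  · rw [avg_eq, ← integral_indicator measurableSet_ball, ← hfe,
      integral_fun_norm_addHaar (μ := volume) (E := Euc (n+1)) f, hfin,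
      setIntegral_congr_fun measurableSet_Ioi hg, setIntegral_indicator measurableSet_Iio,
      inter_comm, hset, ← integral_Ioc_eq_integral_Ioo, ← intervalIntegral.integral_of_le hR.le,
      integral_id, vol_ball _ hR]
    have hv := vol_ball_pos (0 : Euc (n+1)) one_pos
    have : R ^ (n+1) = R ^ (n-1) * R^2 := by rw [← pow_add]; congr 1; omega
    simp only [nsmul_eq_mul, smul_eq_mul, this]
    push_cast
    field_simp
    ring

lemma Ek_integrableOn (hn : 2 ≤ n) (z x : Euc (n+1)) (r : ℝ) :
    IntegrableOn (fun y => Ek n (y - z)) (ball x r) := by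
  have h1 := (Ek_ball_int hn (R := |r| + dist x z + 1) (by positivity)).1
  rw [← integrable_indicator_iff measurableSet_ball] at h1
  have h2 := h1.comp_sub_right z
  have h3 : IntegrableOn (fun y => Ek n (y - z)) (ball z (|r| + dist x z + 1)) := by
    rw [← integrable_indicator_iff measurableSet_ball]
    refine h2.congr (Eventually.of_forall fun y => ?_)
    symm
    show (ball z (|r| + dist x z + 1)).indicator (fun y => Ek n (y - z)) y
      = (ball 0 (|r| + dist x z + 1)).indicator (Ek n) (y - z)
    have : y ∈ ball z (|r| + dist x z + 1) ↔ y - z ∈ ball 0 (|r| + dist x z + 1) := by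
      simp [dist_eq_norm]
    by_cases hy : y ∈ ball z (|r| + dist x z + 1)
    · rw [indicator_of_mem hy, indicator_of_mem (this.1 hy)]
    · rw [indicator_of_notMem hy, indicator_of_notMem (fun h => hy (this.2 h))]
  refine h3.mono_set (ball_subset_ball' ?_)
  linarith [le_abs_self r]

lemma Ke_avg_tendsto (hn : 2 ≤ n) (x : Euc (n+1)) (r : ℝ) :
    Tendsto (fun k => ⨍ y in ball x r, Ke n (es k) y) atTop (𝓝 (⨍ y in ball x r, Ek n y)) := by
  simp only [avg_eq]
  have hi := Ek_integrableOn hn 0 x r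
  simp only [sub_zero] at hi
  have hne : ∀ᵐ y ∂(volume.restrict (ball x r)), y ≠ (0 : Euc (n+1)) :=
    ae_restrict_of_ae (Measure.ae_ne volume 0)
  refine Tendsto.const_mul _ (tendsto_integral_of_dominated_convergence (Ek n) ?_ hi ?_ ?_)
  · intro k; exact (Ke_continuous (es_pos k)).aestronglyMeasurable
  · intro k
    filter_upwards [hne] with y hy
    rw [Real.norm_of_nonneg (Ke_nonneg _ _)]
    exact Ke_le_Ek hn _ hy
  · filter_upwards [hne] with y hy using Ke_tendsto hy

/-- K1 -/
lemma Ek_super (hn : 2 ≤ n) (z x : Euc (n+1)) (hxz : x ≠ z) (r : ℝ) (hr : 0 < r) :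
    ⨍ y in ball x r, Ek n (y - z) ≤ Ek n (x - z) := by
  rw [avg_sub _ _ _ hr]
  refine le_of_tendsto_of_tendsto' (Ke_avg_tendsto hn (x - z) r)
    (Ke_tendsto (sub_ne_zero.2 hxz)) fun k => ?_
  have := Ke_super hn (es_pos k) z x r hr
  rwa [avg_sub _ _ _ hr] at this

/-- K2 -/
lemma Ek_harm (hn : 2 ≤ n) (z x : Euc (n+1)) (r : ℝ) (hr : 0 < r) (hxz : r < dist x z) :
    ⨍ y in ball x r, Ek n (y - z) = Ek n (x - z) := by
  have hne : x ≠ z := by rintro rfl; simp at hxz; linarith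
  refine le_antisymm (Ek_super hn z x hne r hr) ?_
  rw [avg_sub _ _ _ hr]
  have h1 : Tendsto (fun k => (⨍ y in ball (x - z) r, Ke n (es k) y) +
      (n * ((‖x - z‖ - r)^2) ^ ((1 - (n:ℝ))/2 - 2) * (‖x - z‖ + r)^2) * (es k)^2) atTop
      (𝓝 ((⨍ y in ball (x - z) r, Ek n y) + _ * 0^2)) :=
    (Ke_avg_tendsto hn (x - z) r).add ((es_tendsto.pow 2).const_mul _)
  have h2 := le_of_tendsto_of_tendsto' (Ke_tendsto (sub_ne_zero.2 hne)) h1 fun k =>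
    Ke_sub hn (es_pos k) (x - z) r hr (by rwa [← dist_eq_norm])
  simpa using h2

end KernelMean

end Part3

section Part4

section Perron
variable {d : ℕ}

/-- superharmonic (continuous) functions -/
def SH (Ω : Set (Euc d)) (u : Euc d → ℝ) : Prop :=
  ContinuousOn u Ω ∧ ∀ x ∈ Ω, ∀ r : ℝ, 0 < r → closedBall x r ⊆ Ω →
    ⨍ y in ball x r, u y ≤ u x

lemma SH_iff {Ω : Set (Euc d)} {u : Euc d → ℝ} :
    SubharmonicOn (fun y => -u y) Ω ↔ SH Ω u := by
  have e : ∀ (x : Euc d) (r : ℝ), ⨍ y in ball x r, -u y = - ⨍ y in ball x r, u y := by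
    intro x r; rw [avg_eq, avg_eq, integral_neg]; ring
  constructor
  · rintro ⟨h1, h2⟩
    refine ⟨h1.neg.congr fun x _ => (neg_neg (u x)).symm, fun x hx r hr hB => ?_⟩
    have := h2 x hx r hr hB
    rw [e] at this; linarith
  · rintro ⟨h1, h2⟩
    refine ⟨h1.neg, fun x hx r hr hB => ?_⟩
    have := h2 x hx r hr hB
    rw [e]; linarith

lemma contOn_integrable {Ω : Set (Euc d)} {u : Euc d → ℝ} (hu : ContinuousOn u Ω) {x : Euc d}
    {r : ℝ} (hB : closedBall x r ⊆ Ω) : IntegrableOn u (ball x r) :=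
  ((hu.mono hB).integrableOn_compact (isCompact_closedBall x r)).mono_set ball_subset_closedBall

lemma SH.const (Ω : Set (Euc d)) (c : ℝ) : SH Ω fun _ => c :=
  ⟨continuousOn_const, fun x _ r hr _ => (avg_const c x hr).le⟩

lemma SH.add {Ω : Set (Euc d)} {u w : Euc d → ℝ} (hu : SH Ω u) (hw : SH Ω w) :
    SH Ω fun x => u x + w x := by
  refine ⟨hu.1.add hw.1, fun x hx r hr hB => ?_⟩
  have h1 := hu.2 x hx r hr hB
  have h2 := hw.2 x hx r hr hB
  rw [avg_eq] at *
  rw [integral_add (contOn_integrable hu.1 hB) (contOn_integrable hw.1 hB)]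
  linarith

lemma SH.mul {Ω : Set (Euc d)} {u : Euc d → ℝ} (hu : SH Ω u) {c : ℝ} (hc : 0 ≤ c) :
    SH Ω fun x => c * u x := by
  refine ⟨continuousOn_const.mul hu.1, fun x hx r hr hB => ?_⟩
  have h1 := hu.2 x hx r hr hB
  rw [avg_eq] at *
  rw [integral_const_mul]
  nlinarith

lemma SH.min {Ω : Set (Euc d)} {u w : Euc d → ℝ} (hu : SH Ω u) (hw : SH Ω w) :
    SH Ω fun x => min (u x) (w x) := by
  have hc : ContinuousOn (fun x => Min.min (u x) (w x)) Ω := ContinuousOn.inf hu.1 hw.1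
  refine ⟨hc, fun x hx r hr hB => ?_⟩
  refine le_min ?_ ?_
  · exact (avg_mono x hr (contOn_integrable hc hB) (contOn_integrable hu.1 hB)
      fun y _ => min_le_left _ _).trans (hu.2 x hx r hr hB)
  · exact (avg_mono x hr (contOn_integrable hc hB) (contOn_integrable hw.1 hB)
      fun y _ => min_le_right _ _).trans (hw.2 x hx r hr hB)

/-- bounded superharmonic functions with boundary values eventually above `f` -/
def upB (Ω : Set (Euc d)) (f : Euc d → ℝ) (u : Euc d → ℝ) : Prop :=
  SH Ω u ∧ (∃ M, ∀ x ∈ Ω, |u x| ≤ M) ∧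
    ∀ ξ ∈ frontier Ω, ∀ ε > 0, ∀ᶠ x in nhdsWithin ξ Ω, f ξ - ε < u x

lemma upB.mem {Ω : Set (Euc d)} {f u : Euc d → ℝ} (h : upB Ω f u) : u ∈ upperFamily Ω f := by
  obtain ⟨h1, ⟨M, hM⟩, h3⟩ := h
  refine ⟨SH_iff.2 h1, ⟨-M, ?_⟩, fun ξ hξ => ?_⟩
  · rintro _ ⟨x, hx, rfl⟩
    exact (abs_le.1 (hM x hx)).1
  · have : (nhdsWithin ξ Ω).NeBot := mem_closure_iff_nhdsWithin_neBot.1 (frontier_subset_closure hξ)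
    refine le_of_forall_pos_sub_le fun ε hε => ?_
    refine le_liminf_of_le ?_ ((h3 ξ hξ ε hε).mono fun x hx => hx.le)
    refine IsBoundedUnder.isCoboundedUnder_ge ⟨M, ?_⟩
    rw [eventually_map]
    filter_upwards [self_mem_nhdsWithin] with x hx using (abs_le.1 (hM x hx)).2

lemma upperFamily.upB {Ω : Set (Euc d)} {f u : Euc d → ℝ} (h : u ∈ upperFamily Ω f) {M : ℝ}
    (hM : ∀ ξ ∈ frontier Ω, f ξ ≤ M) : upB Ω f fun x => min (u x) M := by
  obtain ⟨h1, ⟨m, hm⟩, h3⟩ := h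
  refine ⟨(SH_iff.1 h1).min (SH.const Ω M), ⟨|m| + |M|, fun x hx => ?_⟩, fun ξ hξ ε hε => ?_⟩
  · have := hm ⟨x, hx, rfl⟩
    rw [abs_le]
    constructor
    · rw [le_min_iff]
      constructor
      · linarith [neg_abs_le m, abs_nonneg M]
      · linarith [neg_abs_le M, abs_nonneg m]
    · exact (min_le_right _ _).trans (by linarith [le_abs_self M, abs_nonneg m])
  · have h4 : ∀ᶠ x in nhdsWithin ξ Ω, f ξ - ε < u x := by
      have h5 := h3 ξ hξ
      rw [liminf_eq] at h5
      set S := {a | ∀ᶠ x in nhdsWithin ξ Ω, a ≤ u x} with hS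
      have : ∃ a ∈ S, f ξ - ε < a := by
        by_cases hb : BddAbove S
        · refine exists_lt_of_lt_csSup ⟨m, ?_⟩ (by linarith)
          show ∀ᶠ x in nhdsWithin ξ Ω, m ≤ u x
          filter_upwards [self_mem_nhdsWithin] with x hx using hm ⟨x, hx, rfl⟩
        · rw [not_bddAbove_iff] at hb
          exact hb _
      obtain ⟨a, ha, hlt⟩ := this
      filter_upwards [(ha : ∀ᶠ x in nhdsWithin ξ Ω, a ≤ u x)] with x hx
      linarith
    filter_upwards [h4] with x hx
    exact lt_min hx (by linarith [hM ξ hξ])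

/-- the nondegeneracy property at the pole -/
def PosAt (Ω : Set (Euc d)) (p : Euc d) : Prop :=
  ∀ u, upB Ω (fun _ => 0) u → 0 ≤ u p

lemma upB.comb {Ω : Set (Euc d)} {f g u w : Euc d → ℝ} (hu : upB Ω f u) (hw : upB Ω g w) :
    upB Ω (fun x => f x + g x) fun x => u x + w x := by
  obtain ⟨h1, ⟨M, hM⟩, h3⟩ := hu
  obtain ⟨h1', ⟨M', hM'⟩, h3'⟩ := hw
  refine ⟨h1.add h1', ⟨M + M', fun x hx => ?_⟩, fun ξ hξ ε hε => ?_⟩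
  · exact (abs_add_le _ _).trans (add_le_add (hM x hx) (hM' x hx))
  · filter_upwards [h3 ξ hξ (ε/2) (by positivity), h3' ξ hξ (ε/2) (by positivity)] with x a b
    linarith

lemma upB.scale {Ω : Set (Euc d)} {f u : Euc d → ℝ} (hu : upB Ω f u) {c : ℝ} (hc : 0 ≤ c) :
    upB Ω (fun x => c * f x) fun x => c * u x := by
  obtain ⟨h1, ⟨M, hM⟩, h3⟩ := hu
  refine ⟨h1.mul hc, ⟨c * M, fun x hx => ?_⟩, fun ξ hξ ε hε => ?_⟩
  · rw [abs_mul, abs_of_nonneg hc]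
    exact mul_le_mul_of_nonneg_left (hM x hx) hc
  · filter_upwards [h3 ξ hξ (ε/(c+1)) (by positivity)] with x a
    have h4 : c * (ε / (c+1)) < ε := by
      rw [mul_div_assoc', div_lt_iff₀ (by positivity)]
      nlinarith
    nlinarith

lemma upB.mono {Ω : Set (Euc d)} {f g u : Euc d → ℝ} (hu : upB Ω f u)
    (h : ∀ ξ ∈ frontier Ω, g ξ ≤ f ξ) : upB Ω g u :=
  ⟨hu.1, hu.2.1, fun ξ hξ ε hε => (hu.2.2 ξ hξ ε hε).mono fun x hx => by linarith [h ξ hξ]⟩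

lemma upB.const (Ω : Set (Euc d)) (c : ℝ) : upB Ω (fun _ => c) fun _ => c :=
  ⟨SH.const Ω c, ⟨|c|, fun _ _ => le_rfl⟩, fun _ _ ε hε => Eventually.of_forall fun _ => by linarith⟩

lemma posAt_of_hMeasure {Ω : Set (Euc d)} {p : Euc d} {S : Set (Euc d)} {c : ℝ} (hc : 0 < c)
    (h : c ≤ hMeasure Ω p S) : PosAt Ω p := by
  intro u hu
  by_contra hneg
  push Not at hneg
  have hbdd : BddBelow ((fun u => u p) '' upperFamily Ω (S.indicator fun _ => (1:ℝ))) := by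
    by_contra hb
    have : hMeasure Ω p S = 0 := Real.sInf_of_not_bddBelow hb
    linarith
  have hk : ∀ k : ℕ, c ≤ k * u p + 1 := by
    intro k
    refine h.trans (csInf_le hbdd ⟨fun x => k * u x + 1, ?_, rfl⟩)
    refine upB.mem (((hu.scale (Nat.cast_nonneg k)).comb (upB.const Ω 1)).mono fun ξ _ => ?_)
    simp only [mul_zero, zero_add]
    exact indicator_le_self' (fun _ _ => zero_le_one) ξ
  obtain ⟨k, hk'⟩ := exists_nat_gt (1 / (-u p))
  have := hk k
  rw [div_lt_iff₀ (by linarith)] at hk'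
  linarith

variable {Ω : Set (Euc d)} {p : Euc d}

lemma perron_bdd (hp : PosAt Ω p) {f : Euc d → ℝ} {M : ℝ}
    (hM : ∀ ξ ∈ frontier Ω, |f ξ| ≤ M) : ∀ u ∈ upperFamily Ω f, -M ≤ u p := by
  intro u hu
  have h1 := upperFamily.upB hu (M := M) fun ξ hξ => (abs_le.1 (hM ξ hξ)).2
  have h2 := hp _ ((h1.comb (upB.const Ω M)).mono fun ξ hξ => by
    have := (abs_le.1 (hM ξ hξ)).1; linarith)
  have h3 : min (u p) M ≤ u p := min_le_left _ _
  linarith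

lemma perron_le (hp : PosAt Ω p) {f u : Euc d → ℝ} {M : ℝ}
    (hM : ∀ ξ ∈ frontier Ω, |f ξ| ≤ M) (hu : upB Ω f u) : perron Ω f p ≤ u p := by
  refine csInf_le ⟨-M, ?_⟩ ⟨u, hu.mem, rfl⟩
  rintro _ ⟨w, hw, rfl⟩
  exact perron_bdd hp hM w hw

lemma exists_upB {f : Euc d → ℝ} {M : ℝ}
    (hM : ∀ ξ ∈ frontier Ω, |f ξ| ≤ M) {η : ℝ} (hη : 0 < η) :
    ∃ u, upB Ω f u ∧ u p < perron Ω f p + η := by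
  have hne : ((fun u => u p) '' upperFamily Ω f).Nonempty :=
    ⟨_, _, ((upB.const Ω M).mono fun ξ hξ => (abs_le.1 (hM ξ hξ)).2).mem, rfl⟩
  obtain ⟨_, ⟨u, hu, rfl⟩, hlt⟩ := exists_lt_of_csInf_lt hne (lt_add_of_pos_right _ hη)
  refine ⟨_, upperFamily.upB hu (M := M) fun ξ hξ => (abs_le.1 (hM ξ hξ)).2, ?_⟩
  exact (min_le_left _ _).trans_lt hlt

lemma perron_mono (hp : PosAt Ω p) {f g : Euc d → ℝ} {M : ℝ}
    (hM : ∀ ξ ∈ frontier Ω, |f ξ| ≤ M) (hM' : ∀ ξ ∈ frontier Ω, |g ξ| ≤ M)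
    (h : ∀ ξ ∈ frontier Ω, f ξ ≤ g ξ) : perron Ω f p ≤ perron Ω g p := by
  refine le_of_forall_pos_lt_add fun η hη => ?_
  obtain ⟨u, hu, hlt⟩ := exists_upB (p := p) hM' hη
  exact (perron_le hp hM (hu.mono h)).trans_lt hlt

lemma perron_add (hp : PosAt Ω p) {f g : Euc d → ℝ} {M M' : ℝ}
    (hM : ∀ ξ ∈ frontier Ω, |f ξ| ≤ M) (hM' : ∀ ξ ∈ frontier Ω, |g ξ| ≤ M') :
    perron Ω (fun x => f x + g x) p ≤ perron Ω f p + perron Ω g p := by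
  refine le_of_forall_pos_lt_add fun η hη => ?_
  obtain ⟨u, hu, hlt⟩ := exists_upB (p := p) hM (half_pos hη)
  obtain ⟨w, hw, hlt'⟩ := exists_upB (p := p) hM' (half_pos hη)
  have := perron_le hp (M := M + M') (fun ξ hξ => (abs_add_le _ _).trans
    (add_le_add (hM ξ hξ) (hM' ξ hξ))) (hu.comb hw)
  linarith

lemma perron_smul_le (hp : PosAt Ω p) {f : Euc d → ℝ} {M c : ℝ}
    (hM : ∀ ξ ∈ frontier Ω, |f ξ| ≤ M) (hc : 0 < c) :
    perron Ω (fun x => c * f x) p ≤ c * perron Ω f p := by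
  refine le_of_forall_pos_lt_add fun η hη => ?_
  obtain ⟨u, hu, hlt⟩ := exists_upB (p := p) hM (div_pos hη hc)
  have := perron_le hp (M := c * M) (fun ξ hξ => by
    rw [abs_mul, abs_of_pos hc]; exact mul_le_mul_of_nonneg_left (hM ξ hξ) hc.le) (hu.scale hc.le)
  have h2 : c * (perron Ω f p + η / c) = c * perron Ω f p + η := by field_simp
  nlinarith

lemma perron_smul (hp : PosAt Ω p) {f : Euc d → ℝ} {M c : ℝ}
    (hM : ∀ ξ ∈ frontier Ω, |f ξ| ≤ M) (hc : 0 < c) :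
    perron Ω (fun x => c * f x) p = c * perron Ω f p := by
  refine le_antisymm (perron_smul_le hp hM hc) ?_
  have h1 := perron_smul_le hp (f := fun x => c * f x) (M := c * M) (c := c⁻¹) (fun ξ hξ => by
    rw [abs_mul, abs_of_pos hc]; exact mul_le_mul_of_nonneg_left (hM ξ hξ) hc.le) (by positivity)
  have : (fun x => c⁻¹ * (c * f x)) = f := by ext x; field_simp
  rw [this] at h1
  rw [inv_mul_eq_div, le_div_iff₀ hc] at h1
  linarith

lemma perron_le_const (hp : PosAt Ω p) {f : Euc d → ℝ} {M c : ℝ}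
    (hM : ∀ ξ ∈ frontier Ω, |f ξ| ≤ M) (h : ∀ ξ ∈ frontier Ω, f ξ ≤ c) : perron Ω f p ≤ c :=
  perron_le hp hM ((upB.const Ω c).mono h)

end Perron

end Part4

section Part5

section Balayage
open scoped CompactlySupported
variable {d : ℕ}

/-- bump function equal to one on the ball of radius `s` and zero off the ball of radius `2s` -/
def bump (x : Euc d) (s : ℝ) (y : Euc d) : ℝ := max 0 (min 1 (2 - dist y x / s))

lemma bump_cont (x : Euc d) (s : ℝ) : Continuous (bump x s) := by unfold bump; fun_prop

lemma bump_nonneg (x : Euc d) (s : ℝ) (y : Euc d) : 0 ≤ bump x s y := le_max_left _ _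

lemma bump_le_one (x : Euc d) (s : ℝ) (y : Euc d) : bump x s y ≤ 1 :=
  max_le zero_le_one (min_le_left _ _)

lemma bump_one {x : Euc d} {s : ℝ} (hs : 0 < s) {y : Euc d} (hy : dist y x ≤ s) :
    bump x s y = 1 := by
  have : 1 ≤ 2 - dist y x / s := by
    have := (div_le_one hs).2 hy
    linarith
  unfold bump
  rw [min_eq_left this]; simp

lemma bump_zero {x : Euc d} {s : ℝ} (hs : 0 < s) {y : Euc d} (hy : 2 * s ≤ dist y x) :
    bump x s y = 0 := by
  have : 2 - dist y x / s ≤ 0 := by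
    have := (le_div_iff₀ hs).2 hy
    linarith
  unfold bump
  rw [max_eq_left]
  exact (min_le_right _ _).trans this

lemma bump_abs (x : Euc d) (s : ℝ) (y : Euc d) : |bump x s y| ≤ 1 := by
  rw [abs_of_nonneg (bump_nonneg x s y)]; exact bump_le_one x s y

lemma bump_cs (x : Euc d) {s : ℝ} (hs : 0 < s) : HasCompactSupport (bump x s) := by
  refine HasCompactSupport.intro (isCompact_closedBall x (2*s)) fun y hy => bump_zero hs ?_
  rw [mem_closedBall] at hy
  linarith

lemma cs_bound {f : Euc d → ℝ} (hf : Continuous f) (hs : HasCompactSupport f) :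
    ∃ M, ∀ x, |f x| ≤ M := hs.exists_bound_of_continuous hf

lemma exists_balayage {Ω : Set (Euc d)} {p : Euc d} (hp : PosAt Ω p) (x0 : Euc d) {s0 : ℝ}
    (hs0 : 0 < s0) :
    ∃ ν : Measure (Euc d), ν univ ≤ 1 ∧ ν (frontier Ω)ᶜ = 0 ∧
      (∀ f : Euc d → ℝ, Continuous f → HasCompactSupport f → ∫ y, f y ∂ν ≤ perron Ω f p) ∧
      perron Ω (bump x0 s0) p ≤ ∫ y, bump x0 s0 y ∂ν := by
  set N : C_c(Euc d, ℝ) → ℝ := fun f => perron Ω f p with hN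
  have hbd : ∀ f : C_c(Euc d, ℝ), ∃ M, ∀ ξ ∈ frontier Ω, |f ξ| ≤ M := fun f => by
    obtain ⟨M, hM⟩ := cs_bound f.continuous f.hasCompactSupport
    exact ⟨M, fun ξ _ => hM ξ⟩
  have N_hom : ∀ c : ℝ, 0 < c → ∀ f, N (c • f) = c * N f := by
    intro c hc f
    obtain ⟨M, hM⟩ := hbd f
    exact perron_smul hp hM hc
  have N_add : ∀ f g, N (f + g) ≤ N f + N g := by
    intro f g
    obtain ⟨M, hM⟩ := hbd f
    obtain ⟨M', hM'⟩ := hbd g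
    exact perron_add hp hM hM'
  have N_0 : N 0 = 0 := by
    have := N_hom 2 two_pos 0
    rw [smul_zero] at this
    linarith
  let f0 : C_c(Euc d, ℝ) := ⟨⟨bump x0 s0, bump_cont x0 s0⟩, bump_cs x0 hs0⟩
  have hf0 : f0 ≠ 0 := by
    intro h
    have h1 : f0 x0 = 0 := by rw [h]; rfl
    have h2 : f0 x0 = 1 := bump_one hs0 (by simpa using hs0.le)
    linarith
  obtain ⟨g, hg1, hg2⟩ := exists_extension_of_le_sublinear
    (LinearPMap.mkSpanSingleton (K := ℝ) (σ := RingHom.id ℝ) f0 (N f0) hf0) N N_hom N_add (by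
      rintro ⟨v, hv⟩
      obtain ⟨c, rfl⟩ := Submodule.mem_span_singleton.1 hv
      rw [LinearPMap.mkSpanSingleton'_apply]
      simp only [RingHom.id_apply, smul_eq_mul]
      rcases lt_trichotomy c 0 with h | h | h
      · have h1 := N_add ((-c) • f0) (c • f0)
        have h2 : (-c) • f0 + c • f0 = 0 := by
          ext y
          show -c * f0 y + c * f0 y = 0
          ring
        rw [h2, N_0, N_hom (-c) (by linarith)] at h1
        linarith
      · rw [h, zero_mul, zero_smul, N_0]
      · rw [N_hom c h])
  have hgf0 : g f0 = N f0 := by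
    have := hg1 ⟨f0, Submodule.mem_span_singleton_self f0⟩
    rw [this]
    exact LinearPMap.mkSpanSingleton_apply ℝ ℝ hf0 _
  have gpos : ∀ f, 0 ≤ f → 0 ≤ g f := by
    intro f hf
    have h1 := hg2 (-f)
    rw [map_neg] at h1
    obtain ⟨M, hM⟩ := hbd (-f)
    have h2 : N (-f) ≤ 0 := perron_le_const hp hM fun ξ _ => by
      have : 0 ≤ f ξ := hf ξ
      simpa using this
    linarith
  let Λ : C_c(Euc d, ℝ) →ₚ[ℝ] ℝ := PositiveLinearMap.mk₀ g gpos
  have hΛ : ∀ f, Λ f = g f := fun f => rfl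
  have hb : ∀ (x : Euc d) (s t : ℝ), 0 < s →
      (∀ ξ ∈ frontier Ω, bump x s ξ ≤ t) →
      RealRMK.rieszMeasure Λ (closedBall x s) ≤ ENNReal.ofReal t := by
    intro x s t hs ht
    let f : C_c(Euc d, ℝ) := ⟨⟨bump x s, bump_cont x s⟩, bump_cs x hs⟩
    have h1 := RealRMK.rieszMeasure_le_of_eq_one Λ (f := f) (fun y => bump_nonneg x s y)
      (isCompact_closedBall x s) (fun y hy => bump_one hs hy)
    refine h1.trans (ENNReal.ofReal_le_ofReal ?_)
    rw [hΛ]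
    refine (hg2 f).trans ?_
    exact perron_le_const hp (M := 1) (fun ξ _ => bump_abs x s ξ) ht
  refine ⟨RealRMK.rieszMeasure Λ, ?_, ?_, ?_, ?_⟩
  · have h1 : (univ : Set (Euc d)) = ⋃ k : ℕ, closedBall (0 : Euc d) (k+1) := by
      symm
      rw [eq_univ_iff_forall]
      intro x
      obtain ⟨k, hk⟩ := exists_nat_ge ‖x‖
      refine mem_iUnion.2 ⟨k, ?_⟩
      simp; linarith
    rw [h1, Monotone.measure_iUnion]
    · refine iSup_le fun k => ?_
      have := hb (0 : Euc d) (k+1) 1 (by positivity) fun ξ _ => bump_le_one _ _ _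
      simpa using this
    · intro i j hij
      have : (i:ℝ) ≤ j := by exact_mod_cast hij
      exact closedBall_subset_closedBall (by linarith)
  · refine measure_null_of_locally_null _ fun x hx => ?_
    have ho : IsOpen (frontier Ω)ᶜ := isClosed_frontier.isOpen_compl
    obtain ⟨ε, hε, hB⟩ := Metric.isOpen_iff.1 ho x hx
    refine ⟨closedBall x (ε/2), mem_nhdsWithin_of_mem_nhds (closedBall_mem_nhds x (by positivity)), ?_⟩
    have := hb x (ε/2) 0 (by positivity) fun ξ hξ => by
      refine (bump_zero (by positivity) ?_).le
      by_contra h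
      push Not at h
      exact hB (show ξ ∈ ball x ε by rw [mem_ball]; linarith) hξ
    simpa using this
  · intro f hf hfs
    let f' : C_c(Euc d, ℝ) := ⟨⟨f, hf⟩, hfs⟩
    have := RealRMK.integral_rieszMeasure Λ f'
    have h2 := hg2 f'
    rw [← hΛ, ← this] at h2
    exact h2
  · have := RealRMK.integral_rieszMeasure Λ f0
    rw [hΛ, hgf0] at this
    exact this.ge

variable {Ω : Set (Euc d)} {p : Euc d} {ν : Measure (Euc d)}

lemma bump_lim [IsFiniteMeasure ν] {h : Euc d → ℝ} (hc : Continuous h) {M : ℝ}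
    (hM : ∀ x, |h x| ≤ M) :
    Tendsto (fun k : ℕ => ∫ y, h y * bump 0 (k+1) y ∂ν) atTop (𝓝 (∫ y, h y ∂ν)) := by
  refine tendsto_integral_of_dominated_convergence (fun _ => M) ?_ (integrable_const M) ?_ ?_
  · intro k; exact (hc.mul (bump_cont _ _)).aestronglyMeasurable
  · intro k
    refine Eventually.of_forall fun y => ?_
    rw [Real.norm_eq_abs, abs_mul]
    have h1 := hM y
    have h2 := bump_abs (0 : Euc d) (k+1) y
    nlinarith [abs_nonneg (h y), abs_nonneg (bump (0 : Euc d) (k+1) y)]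
  · refine Eventually.of_forall fun y => ?_
    refine tendsto_const_nhds.congr' ?_
    obtain ⟨K, hK⟩ := exists_nat_ge ‖y‖
    filter_upwards [eventually_ge_atTop K] with k hk
    have : (K:ℝ) ≤ k := by exact_mod_cast hk
    rw [bump_one (by positivity) (by rw [dist_zero_right]; linarith), mul_one]

lemma T1 [IsFiniteMeasure ν] (hp : PosAt Ω p)
    (hν : ∀ f : Euc d → ℝ, Continuous f → HasCompactSupport f → ∫ y, f y ∂ν ≤ perron Ω f p)
    {h : Euc d → ℝ} (hc : Continuous h) {M : ℝ} (hM : ∀ x, |h x| ≤ M) (h0 : ∀ x, 0 ≤ h x)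
    (hs : SH Ω h) : ∫ y, h y ∂ν ≤ h p := by
  refine le_of_tendsto' (bump_lim hc hM) fun k => ?_
  have hk : (0:ℝ) < k + 1 := by positivity
  refine (hν (fun y => h y * bump 0 (k+1) y) (hc.mul (bump_cont _ _)) ((bump_cs 0 hk).mul_left)).trans ?_
  refine perron_le hp (M := M) (fun ξ _ => ?_) ⟨hs, ⟨M, fun x _ => hM x⟩, fun ξ _ ε hε => ?_⟩
  · rw [abs_mul]
    have h1 := hM ξ
    have h2 := bump_abs (0 : Euc d) (k+1) ξ
    nlinarith [abs_nonneg (h ξ), abs_nonneg (bump (0 : Euc d) (k+1) ξ)]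
  · have h1 : ∀ᶠ x in 𝓝 ξ, h ξ - ε < h x :=
      hc.continuousAt.eventually (lt_mem_nhds (by linarith))
    filter_upwards [mem_nhdsWithin_of_mem_nhds h1] with x hx
    have h2 := bump_le_one (0 : Euc d) (k+1) ξ
    have := h0 ξ
    have hx : h ξ - ε < h x := hx
    nlinarith

lemma T2 [IsFiniteMeasure ν] (hp : PosAt Ω p)
    (hν : ∀ f : Euc d → ℝ, Continuous f → HasCompactSupport f → ∫ y, f y ∂ν ≤ perron Ω f p)
    {h : Euc d → ℝ} (hc : Continuous h) {M : ℝ} (hM : ∀ x, |h x| ≤ M) (h0 : ∀ x, 0 ≤ h x)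
    (hs : SH Ω h) (hs' : SH Ω fun x => - h x)
    (hinf : ∀ ε > 0, ∃ R : ℝ, ∀ x, R ≤ ‖x‖ → h x ≤ ε) : ∫ y, h y ∂ν = h p := by
  refine le_antisymm (T1 hp hν hc hM h0 hs) ?_
  refine le_of_forall_pos_sub_le fun ε hε => ?_
  obtain ⟨R, hR⟩ := hinf ε hε
  refine ge_of_tendsto (bump_lim hc hM) ?_
  obtain ⟨K, hK⟩ := exists_nat_ge R
  filter_upwards [eventually_ge_atTop K] with k hk
  have hk' : (K:ℝ) ≤ k := by exact_mod_cast hk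
  have hk0 : (0:ℝ) < k + 1 := by positivity
  have key : ∫ y, -(h y * bump 0 (k+1) y) ∂ν ≤ -h p + ε := by
    refine (hν (fun y => -(h y * bump 0 (k+1) y)) (hc.mul (bump_cont _ _)).neg ((bump_cs 0 hk0).mul_left.neg)).trans ?_
    refine perron_le hp (M := M) (u := fun x => - h x + ε) (fun ξ _ => ?_)
      ⟨hs'.add (SH.const Ω ε), ⟨M + ε, fun x _ => ?_⟩, fun ξ _ η hη => ?_⟩
    · rw [abs_neg, abs_mul]
      have h1 := hM ξ
      have h2 := bump_abs (0 : Euc d) (k+1) ξ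
      nlinarith [abs_nonneg (h ξ), abs_nonneg (bump (0 : Euc d) (k+1) ξ)]
    · refine (abs_add_le _ _).trans (add_le_add ?_ (abs_of_pos hε).le)
      rw [abs_neg]; exact hM x
    · have h1 : ∀ᶠ x in 𝓝 ξ, h x < h ξ + η :=
        hc.continuousAt.eventually (gt_mem_nhds (by linarith))
      filter_upwards [mem_nhdsWithin_of_mem_nhds h1] with x hx
      have hx : h x < h ξ + η := hx
      by_cases hξ : R ≤ ‖ξ‖
      · have h2 := hR ξ hξ
        have h3 := mul_nonneg (h0 ξ) (bump_nonneg (0 : Euc d) (k+1) ξ)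
        linarith
      · push Not at hξ
        rw [bump_one hk0 (by rw [dist_zero_right]; linarith)]
        linarith
  rw [integral_neg] at key
  linarith

end Balayage

end Part5

section Part6

section ADR
variable {n : ℕ}

lemma adr_total {C₀ : ℝ} (hn : 2 ≤ n) {F : Set (Euc (n+1))} (hF : ADRegular n C₀ F)
    {D : ℝ} (hD : 0 ≤ D) (hdiam : Metric.ediam F = ENNReal.ofReal D) :
    μH[n] F ≤ ENNReal.ofReal (5 ^ (n+1) * C₀ * D ^ n) := by
  have hn0 : (0:ℝ) < n := by
    have : 0 < n := by omega
    exact_mod_cast this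
  have : NullSingletonClass (μH[n] : Measure (Euc (n+1))) := Measure.nullSingletonClass_hausdorff _ hn0
  rcases hD.eq_or_lt with h0 | hDpos
  · rw [← h0, ENNReal.ofReal_zero] at hdiam
    have : F.Subsingleton := Metric.ediam_eq_zero_iff.1 hdiam
    rw [this.measure_zero]; exact zero_le
  rcases F.eq_empty_or_nonempty with rfl | ⟨x0, hx0⟩
  · simp
  have hdist : ∀ x ∈ F, ∀ y ∈ F, dist x y ≤ D := by
    intro x hx y hy
    have h1 := Metric.edist_le_ediam_of_mem hx hy
    have h2 : edist x y ≤ ENNReal.ofReal D := hdiam ▸ h1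
    rw [edist_dist] at h2
    exact (ENNReal.ofReal_le_ofReal_iff hD).1 h2
  let P : ℕ → Prop := fun k => ∃ s : Finset (Euc (n+1)), (∀ c ∈ s, c ∈ F) ∧
    (∀ c ∈ s, ∀ e ∈ s, c ≠ e → D ≤ dist c e) ∧ s.card = k
  have hcard : ∀ s : Finset (Euc (n+1)), (∀ c ∈ s, c ∈ F) →
    (∀ c ∈ s, ∀ e ∈ s, c ≠ e → D ≤ dist c e) → s.card ≤ 5 ^ (n+1) := by
    intro s hs1 hs2
    have hinj : Function.Injective fun c : Euc (n+1) => D⁻¹ • (c - x0) := by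
      intro a b hab
      have := smul_right_injective (Euc (n+1)) (inv_ne_zero hDpos.ne') hab
      simpa using this
    have := Besicovitch.card_le_of_separated (s.map ⟨_, hinj⟩) ?_ ?_
    · simpa using this
    · intro c hc
      rw [Finset.mem_map] at hc
      obtain ⟨c, hc, rfl⟩ := hc
      simp only [Function.Embedding.coeFn_mk, norm_smul, norm_inv, Real.norm_of_nonneg hD]
      rw [← dist_eq_norm, inv_mul_le_iff₀ hDpos]
      linarith [hdist c (hs1 c hc) x0 hx0]
    · intro c hc e he hne
      rw [Finset.mem_map] at hc he
      obtain ⟨c, hc, rfl⟩ := hc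
      obtain ⟨e, he, rfl⟩ := he
      have hce : c ≠ e := fun h => hne (by rw [h])
      simp only [Function.Embedding.coeFn_mk]
      rw [← smul_sub, norm_smul, norm_inv, Real.norm_of_nonneg hD, sub_sub_sub_cancel_right,
        ← dist_eq_norm, le_inv_mul_iff₀ hDpos]
      linarith [hs2 c hc e he hce]
  classical
  have hP0 : P 0 := ⟨∅, by simp, by simp, rfl⟩
  obtain ⟨s, hs1, hs2, hs3⟩ : P (Nat.findGreatest P (5^(n+1))) :=
    Nat.findGreatest_spec (Nat.zero_le _) hP0
  have hcov : F ⊆ ⋃ c ∈ s, F ∩ ball c D := by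
    intro y hy
    by_contra hcon
    simp only [mem_iUnion, mem_inter_iff, hy, true_and, mem_ball, not_exists, not_lt] at hcon
    have hys : y ∉ s := fun h => by
      have := hcon y h
      rw [dist_self] at this
      linarith
    have h1 : ∀ c ∈ insert y s, c ∈ F := by
      intro c hc
      rcases Finset.mem_insert.1 hc with rfl | h
      · exact hy
      · exact hs1 c h
    have h2 : ∀ c ∈ insert y s, ∀ e ∈ insert y s, c ≠ e → D ≤ dist c e := by
      intro c hc e he hne
      rcases Finset.mem_insert.1 hc with rfl | h <;> rcases Finset.mem_insert.1 he with rfl | h'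
      · exact absurd rfl hne
      · exact hcon e h'
      · rw [dist_comm]; exact hcon c h
      · exact hs2 c h e h' hne
    have h3 : (insert y s).card = s.card + 1 := Finset.card_insert_of_notMem hys
    have h4 := Nat.le_findGreatest (P := P) (hcard _ h1 h2) ⟨_, h1, h2, rfl⟩
    omega
  calc μH[n] F ≤ μH[n] (⋃ c ∈ s, F ∩ ball c D) := measure_mono hcov
    _ ≤ ∑ c ∈ s, μH[n] (F ∩ ball c D) := measure_biUnion_finset_le _ _
    _ ≤ ∑ c ∈ s, ENNReal.ofReal (C₀ * D ^ n) :=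
      Finset.sum_le_sum fun c hc => (hF c (hs1 c hc) D hDpos hdiam.ge).2
    _ = s.card * ENNReal.ofReal (C₀ * D ^ n) := by rw [Finset.sum_const, nsmul_eq_mul]
    _ ≤ (5 ^ (n+1) : ℕ) * ENNReal.ofReal (C₀ * D ^ n) := by
      gcongr
      exact hcard s hs1 hs2
    _ = ENNReal.ofReal (5 ^ (n+1) * C₀ * D ^ n) := by
      rw [← ENNReal.ofReal_natCast, ← ENNReal.ofReal_mul (by positivity)]
      push_cast
      ring_nf

lemma adr_ub {C₀ : ℝ} (hn : 2 ≤ n) (hC : 1 ≤ C₀) {F : Set (Euc (n+1))} (hF : ADRegular n C₀ F)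
    (x : Euc (n+1)) {s : ℝ} (hs : 0 < s) :
    μH[n] (closedBall x s ∩ F) ≤ ENNReal.ofReal (5 ^ (n+1) * 3 ^ n * C₀ * s ^ n) := by
  rcases (closedBall x s ∩ F).eq_empty_or_nonempty with h | ⟨y, hy, hyF⟩
  · rw [h]; simp
  by_cases hle : ENNReal.ofReal (3 * s) ≤ Metric.ediam F
  · have h1 := (hF y hyF (3*s) (by positivity) hle).2
    have h2 : closedBall x s ∩ F ⊆ F ∩ ball y (3*s) := by
      rintro z ⟨hz, hzF⟩
      refine ⟨hzF, ?_⟩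
      rw [mem_closedBall] at *
      rw [mem_ball]
      have := dist_triangle_right z y x
      linarith
    refine (measure_mono h2).trans (h1.trans (ENNReal.ofReal_le_ofReal ?_))
    rw [mul_pow]
    have h5 : (1:ℝ) ≤ 5 ^ (n+1) := one_le_pow₀ (by norm_num)
    have : 0 ≤ C₀ * (3 ^ n * s ^ n) := by positivity
    nlinarith
  · push Not at hle
    have hne : Metric.ediam F ≠ ⊤ := (hle.trans ENNReal.ofReal_lt_top).ne
    have hd : Metric.ediam F = ENNReal.ofReal (Metric.ediam F).toReal :=
      (ENNReal.ofReal_toReal hne).symm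
    refine (measure_mono inter_subset_right).trans
      ((adr_total hn hF ENNReal.toReal_nonneg hd).trans (ENNReal.ofReal_le_ofReal ?_))
    have h3 : (Metric.ediam F).toReal ≤ 3 * s := by
      rw [hd] at hle
      exact ((ENNReal.ofReal_lt_ofReal_iff (by positivity)).1 hle).le
    calc 5 ^ (n+1) * C₀ * (Metric.ediam F).toReal ^ n ≤ 5 ^ (n+1) * C₀ * (3*s)^n := by gcongr
      _ = _ := by rw [mul_pow]; ring

/-- the potential of a measure -/
def pot (m : Measure (Euc (n+1))) (x : Euc (n+1)) : ℝ := ∫ y, Ek n (x - y) ∂m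

lemma pot_nonneg (m : Measure (Euc (n+1))) (x : Euc (n+1)) : 0 ≤ pot m x :=
  integral_nonneg fun _ => Ek_nonneg _

lemma Ek_meas_sub (x : Euc (n+1)) : Measurable fun y => Ek n (x - y) :=
  Ek_measurable.comp (measurable_const.sub measurable_id)

/-- near estimate -/
lemma near_lint (hn : 2 ≤ n) {μ : Measure (Euc (n+1))} {C1 : ℝ} (hC1 : 0 ≤ C1)
    (hub : ∀ x s, 0 < s → μ (closedBall x s) ≤ ENNReal.ofReal (C1 * s^n))
    (ξ : Euc (n+1)) {R : ℝ} (hR : 0 < R) :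
    ∫⁻ y in closedBall ξ R, ENNReal.ofReal (Ek n (ξ - y)) ∂μ
      ≤ ENNReal.ofReal (C1 * 2 ^ n * R) := by
  set An : ℕ → Set (Euc (n+1)) := fun k => closedBall ξ (R * (1/2)^k) \ closedBall ξ (R * (1/2)^(k+1))
    with hAn
  have hcov : closedBall ξ R ⊆ {ξ} ∪ ⋃ k, An k := by
    intro y hy
    by_cases hyx : y = ξ
    · left; exact hyx
    right
    have hd : 0 < dist y ξ := dist_pos.2 hyx
    have hex : ∃ k : ℕ, R * (1/2)^k < dist y ξ := by
      obtain ⟨k, hk⟩ := exists_pow_lt_of_lt_one (div_pos hd hR) (by norm_num : (1/2:ℝ) < 1)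
      refine ⟨k, ?_⟩
      rw [lt_div_iff₀ hR] at hk
      linarith
    classical
    have hk := Nat.find_spec hex
    have hk0 : Nat.find hex ≠ 0 := by
      intro h
      rw [h] at hk
      rw [mem_closedBall] at hy
      simp at hk
      linarith
    obtain ⟨j, hj⟩ := Nat.exists_eq_succ_of_ne_zero hk0
    refine mem_iUnion.2 ⟨j, ?_, ?_⟩
    · have := Nat.find_min hex (m := j) (by omega)
      rw [mem_closedBall]
      linarith
    · rw [hj] at hk
      rw [mem_closedBall]
      push Not
      exact hk
  have hAnm : ∀ k, MeasurableSet (An k) := fun k =>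
    measurableSet_closedBall.diff measurableSet_closedBall
  have h1 : ∀ k, ∫⁻ y in An k, ENNReal.ofReal (Ek n (ξ - y)) ∂μ
      ≤ ENNReal.ofReal (C1 * 2 ^ (n-1) * R) * ENNReal.ofReal (1/2) ^ k := by
    intro k
    have ht : 0 < R * (1/2)^(k+1) := by positivity
    calc ∫⁻ y in An k, ENNReal.ofReal (Ek n (ξ - y)) ∂μ
        ≤ ∫⁻ _y in An k, ENNReal.ofReal (((R * (1/2)^(k+1)) ^ (n-1))⁻¹) ∂μ := by
          refine setLIntegral_mono measurable_const fun y hy => ENNReal.ofReal_le_ofReal ?_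
          refine Ek_le_of_le hn ht ?_
          have := hy.2
          rw [mem_closedBall, dist_comm, dist_eq_norm] at this
          linarith
      _ = ENNReal.ofReal (((R * (1/2)^(k+1)) ^ (n-1))⁻¹) * μ (An k) := by
          rw [setLIntegral_const]
      _ ≤ ENNReal.ofReal (((R * (1/2)^(k+1)) ^ (n-1))⁻¹) *
            ENNReal.ofReal (C1 * (R * (1/2)^k)^n) := by
          gcongr
          exact (measure_mono sdiff_subset).trans (hub _ _ (by positivity))
      _ = ENNReal.ofReal (C1 * 2 ^ (n-1) * R) * ENNReal.ofReal (1/2) ^ k := by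
          rw [← ENNReal.ofReal_pow (by norm_num), ← ENNReal.ofReal_mul (by positivity),
            ← ENNReal.ofReal_mul (by positivity)]
          congr 1
          obtain ⟨m, rfl⟩ : ∃ m, n = m + 1 := ⟨n - 1, by omega⟩
          have e : R * (1/2:ℝ)^(k+1) = (R * (1/2)^k) * (1/2) := by ring
          rw [e, Nat.add_sub_cancel, mul_pow _ (1/2:ℝ) m]
          have h0 : R * (1/2:ℝ)^k ≠ 0 := by positivity
          have e2 : (1/2:ℝ)^m = (2^m)⁻¹ := by rw [one_div, inv_pow]
          rw [e2]
          have e3 : C1 * 2 ^ m * R * (1/2:ℝ)^k = C1 * 2^m * (R * (1/2)^k) := by ring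
          rw [e3]
          generalize R * (1/2:ℝ)^k = T at *
          field_simp
          ring
  calc ∫⁻ y in closedBall ξ R, ENNReal.ofReal (Ek n (ξ - y)) ∂μ
      ≤ ∫⁻ y in {ξ} ∪ ⋃ k, An k, ENNReal.ofReal (Ek n (ξ - y)) ∂μ := lintegral_mono_set hcov
    _ ≤ ∫⁻ y in {ξ}, ENNReal.ofReal (Ek n (ξ - y)) ∂μ
        + ∫⁻ y in ⋃ k, An k, ENNReal.ofReal (Ek n (ξ - y)) ∂μ := lintegral_union_le _ _ _
    _ ≤ 0 + ∑' k, ∫⁻ y in An k, ENNReal.ofReal (Ek n (ξ - y)) ∂μ := by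
        gcongr
        · rw [lintegral_singleton]; simp [Ek_zero hn]
        · exact lintegral_iUnion_le _ _
    _ ≤ 0 + ∑' k, ENNReal.ofReal (C1 * 2 ^ (n-1) * R) * ENNReal.ofReal (1/2) ^ k := by
        gcongr with k
        exact h1 k
    _ = ENNReal.ofReal (C1 * 2 ^ n * R) := by
        rw [zero_add, ENNReal.tsum_mul_left, ENNReal.tsum_geometric]
        have : (1 - ENNReal.ofReal (1/2))⁻¹ = ENNReal.ofReal 2 := by
          rw [← ENNReal.ofReal_one, ← ENNReal.ofReal_sub _ (by norm_num),
            ← ENNReal.ofReal_inv_of_pos (by norm_num)]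
          norm_num
        rw [this, ← ENNReal.ofReal_mul (by positivity)]
        congr 1
        obtain ⟨m, rfl⟩ : ∃ m, n = m + 1 := ⟨n - 1, by omega⟩
        rw [Nat.add_sub_cancel]; ring

end ADR

end Part6

section Part7

section Pot
variable {n : ℕ} {m : Measure (Euc (n+1))}

lemma pot_away {Ω : Set (Euc (n+1))} (hn : 2 ≤ n) [IsFiniteMeasure m] (hm : ∀ᵐ y ∂m, y ∉ Ω)
    {x : Euc (n+1)} {δ : ℝ} (hδ : 0 < δ) (hb : ball x δ ⊆ Ω) :
    ∀ᵐ y ∂m, Ek n (x - y) ≤ (δ ^ (n-1))⁻¹ := by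
  filter_upwards [hm] with y hy
  refine Ek_le_of_le hn hδ ?_
  by_contra hc
  exact hy (hb (by rw [mem_ball, dist_comm, dist_eq_norm]; push Not at hc; exact hc))

lemma pot_int_away {Ω : Set (Euc (n+1))} (hn : 2 ≤ n) [IsFiniteMeasure m] (hΩ : IsOpen Ω)
    (hm : ∀ᵐ y ∂m, y ∉ Ω) {x : Euc (n+1)} (hx : x ∈ Ω) : Integrable (fun y => Ek n (x - y)) m := by
  obtain ⟨δ, hδ, hb⟩ := Metric.isOpen_iff.1 hΩ x hx
  refine Integrable.of_bound (Ek_meas_sub x).aestronglyMeasurable ((δ ^ (n-1))⁻¹) ?_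
  filter_upwards [pot_away hn hm hδ hb] with y hy
  rwa [Real.norm_of_nonneg (Ek_nonneg _)]

lemma pot_contOn {Ω : Set (Euc (n+1))} (hn : 2 ≤ n) [IsFiniteMeasure m] (hΩ : IsOpen Ω)
    (hm : ∀ᵐ y ∂m, y ∉ Ω) : ContinuousOn (pot m) Ω := by
  intro x hx
  refine ContinuousAt.continuousWithinAt ?_
  obtain ⟨δ, hδ, hb⟩ := Metric.isOpen_iff.1 hΩ x hx
  refine continuousAt_of_dominated (bound := fun _ => ((δ/2) ^ (n-1))⁻¹) ?_ ?_ (integrable_const _) ?_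
  · exact Eventually.of_forall fun z => (Ek_meas_sub z).aestronglyMeasurable
  · filter_upwards [ball_mem_nhds x (half_pos hδ)] with z hz
    have hb' : ball z (δ/2) ⊆ Ω := by
      refine Subset.trans ?_ hb
      intro w hw
      rw [mem_ball] at *
      have := dist_triangle w z x
      linarith
    filter_upwards [pot_away hn hm (half_pos hδ) hb'] with y hy
    rwa [Real.norm_of_nonneg (Ek_nonneg _)]
  · filter_upwards [hm] with y hy
    have : x - y ≠ 0 := by
      intro h
      rw [sub_eq_zero] at h
      exact hy (h ▸ hx)
    exact (Ek_continuousAt this).comp (f := fun z => z - y) (by fun_prop)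

lemma pot_mean {Ω : Set (Euc (n+1))} (hn : 2 ≤ n) [IsFiniteMeasure m]
    (hm : ∀ᵐ y ∂m, y ∉ Ω) (hΩ : IsOpen Ω) {x : Euc (n+1)} {r : ℝ} (hr : 0 < r)
    (hB : closedBall x r ⊆ Ω) : ⨍ y in ball x r, pot m y = pot m x := by
  obtain ⟨δ, hδ, hth⟩ := (isCompact_closedBall x r).exists_cthickening_subset_open hΩ hB
  have hb : ∀ w ∈ ball x r, ball w δ ⊆ Ω := by
    intro w hw
    refine Subset.trans ?_ hth
    intro v hv
    exact mem_cthickening_of_dist_le v w δ _ (ball_subset_closedBall hw) (mem_ball.1 hv).le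
  have hfin : IsFiniteMeasure (volume.restrict (ball x r)) :=
    ⟨by rw [Measure.restrict_apply_univ]; exact measure_ball_lt_top⟩
  have hInt : Integrable (Function.uncurry fun w y => Ek n (w - y))
      ((volume.restrict (ball x r)).prod m) := by
    refine Integrable.of_bound ?_ ((δ ^ (n-1))⁻¹) ?_
    · exact (Ek_measurable.comp (measurable_fst.sub measurable_snd)).aestronglyMeasurable
    · have h1 : ∀ᵐ q ∂((volume.restrict (ball x r)).prod m), q.2 ∉ Ω :=
        Measure.quasiMeasurePreserving_snd.ae hm
      have h2 : ∀ᵐ q ∂((volume.restrict (ball x r)).prod m), q.1 ∈ ball x r :=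
        Measure.quasiMeasurePreserving_fst.ae (ae_restrict_mem measurableSet_ball)
      filter_upwards [h1, h2] with q hq1 hq2
      show ‖Ek n (q.1 - q.2)‖ ≤ _
      rw [Real.norm_of_nonneg (Ek_nonneg _)]
      refine Ek_le_of_le hn hδ ?_
      by_contra hc
      exact hq1 (hb _ hq2 (by rw [mem_ball, dist_comm, dist_eq_norm]; push Not at hc; exact hc))
  rw [avg_eq]
  unfold pot
  rw [integral_integral_swap hInt, ← integral_const_mul]
  refine integral_congr_ae ?_
  filter_upwards [hm] with y hy
  rw [← avg_eq]
  refine Ek_harm hn y x r hr ?_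
  by_contra hc
  push Not at hc
  exact hy (hB (by rw [mem_closedBall, dist_comm]; exact hc))

lemma pot_SH {Ω : Set (Euc (n+1))} (hn : 2 ≤ n) [IsFiniteMeasure m]
    (hm : ∀ᵐ y ∂m, y ∉ Ω) (hΩ : IsOpen Ω) : SH Ω (pot m) :=
  ⟨pot_contOn hn hΩ hm, fun _x _ _r hr hB => (pot_mean hn hm hΩ hr hB).le⟩

lemma pot_SH' {Ω : Set (Euc (n+1))} (hn : 2 ≤ n) [IsFiniteMeasure m]
    (hm : ∀ᵐ y ∂m, y ∉ Ω) (hΩ : IsOpen Ω) : SH Ω fun x => - pot m x := by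
  refine ⟨(pot_contOn hn hΩ hm).neg, fun x _ r hr hB => ?_⟩
  have := pot_mean hn hm hΩ hr hB
  rw [avg_eq] at *
  rw [integral_neg, mul_neg, this]

/-- potentials of `n`-dimensional measures -/
lemma pot_lint (hn : 2 ≤ n) {C1 : ℝ} (hC1 : 0 ≤ C1)
    (hub : ∀ x s, 0 < s → m (closedBall x s) ≤ ENNReal.ofReal (C1 * s^n))
    {r : ℝ} (hr : 0 < r) (hm : m univ ≤ ENNReal.ofReal (C1 * r^n)) (x : Euc (n+1)) :
    ∫⁻ y, ENNReal.ofReal (Ek n (x - y)) ∂m ≤ ENNReal.ofReal (C1 * (2^n+1) * r) := by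
  have h1 := near_lint hn hC1 hub x hr
  have h2 : ∫⁻ y in (closedBall x r)ᶜ, ENNReal.ofReal (Ek n (x - y)) ∂m ≤ ENNReal.ofReal (C1 * r) := by
    calc ∫⁻ y in (closedBall x r)ᶜ, ENNReal.ofReal (Ek n (x - y)) ∂m
        ≤ ∫⁻ _y in (closedBall x r)ᶜ, ENNReal.ofReal ((r^(n-1))⁻¹) ∂m := by
          refine setLIntegral_mono measurable_const fun y hy => ENNReal.ofReal_le_ofReal ?_
          refine Ek_le_of_le hn hr ?_
          rw [mem_compl_iff, mem_closedBall, dist_comm, dist_eq_norm] at hy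
          linarith
      _ ≤ ENNReal.ofReal ((r^(n-1))⁻¹) * ENNReal.ofReal (C1 * r^n) := by
          rw [setLIntegral_const]
          gcongr
          exact (measure_mono (subset_univ _)).trans hm
      _ = ENNReal.ofReal (C1 * r) := by
          rw [← ENNReal.ofReal_mul (by positivity)]
          congr 1
          obtain ⟨k, rfl⟩ : ∃ k, n = k + 1 := ⟨n - 1, by omega⟩
          rw [Nat.add_sub_cancel]
          field_simp
          ring
  rw [← lintegral_add_compl _ (measurableSet_closedBall (x := x) (ε := r))]
  refine (add_le_add h1 h2).trans ?_
  rw [← ENNReal.ofReal_add (by positivity) (by positivity)]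
  refine ENNReal.ofReal_le_ofReal (le_of_eq ?_)
  ring

lemma pot_int (hn : 2 ≤ n) {C1 : ℝ} (hC1 : 0 ≤ C1)
    (hub : ∀ x s, 0 < s → m (closedBall x s) ≤ ENNReal.ofReal (C1 * s^n))
    {r : ℝ} (hr : 0 < r) (hm : m univ ≤ ENNReal.ofReal (C1 * r^n)) (x : Euc (n+1)) :
    Integrable (fun y => Ek n (x - y)) m := by
  refine ⟨(Ek_meas_sub x).aestronglyMeasurable, ?_⟩
  rw [hasFiniteIntegral_iff_ofReal (Eventually.of_forall fun y => Ek_nonneg _)]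
  exact (pot_lint hn hC1 hub hr hm x).trans_lt ENNReal.ofReal_lt_top

lemma pot_le (hn : 2 ≤ n) {C1 : ℝ} (hC1 : 0 ≤ C1)
    (hub : ∀ x s, 0 < s → m (closedBall x s) ≤ ENNReal.ofReal (C1 * s^n))
    {r : ℝ} (hr : 0 < r) (hm : m univ ≤ ENNReal.ofReal (C1 * r^n)) (x : Euc (n+1)) :
    pot m x ≤ C1 * (2^n+1) * r := by
  unfold pot
  rw [integral_eq_lintegral_of_nonneg_ae (Eventually.of_forall fun y => Ek_nonneg _)
    (Ek_meas_sub x).aestronglyMeasurable]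
  exact ENNReal.toReal_le_of_le_ofReal (by positivity) (pot_lint hn hC1 hub hr hm x)

/-- truncated kernel -/
def Et (n : ℕ) (ρ : ℝ) (w : Euc (n+1)) : ℝ := ((max ‖w‖ ρ) ^ (n-1))⁻¹

lemma Et_cont {ρ : ℝ} (hρ : 0 < ρ) : Continuous (Et n ρ) := by
  unfold Et
  refine Continuous.inv₀ (by fun_prop) fun w => ?_
  have : 0 < max ‖w‖ ρ := lt_max_of_lt_right hρ
  positivity

lemma Et_bd {ρ : ℝ} (hρ : 0 < ρ) (w : Euc (n+1)) : 0 ≤ Et n ρ w ∧ Et n ρ w ≤ (ρ^(n-1))⁻¹ := by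
  have : 0 < max ‖w‖ ρ := lt_max_of_lt_right hρ
  unfold Et
  constructor
  · positivity
  · gcongr
    exact le_max_right _ _

lemma pot_cont (hn : 2 ≤ n) {C1 : ℝ} (hC1 : 0 ≤ C1)
    (hub : ∀ x s, 0 < s → m (closedBall x s) ≤ ENNReal.ofReal (C1 * s^n))
    {r : ℝ} (hr : 0 < r) (hm : m univ ≤ ENNReal.ofReal (C1 * r^n)) : Continuous (pot m) := by
  have : IsFiniteMeasure m := ⟨hm.trans_lt ENNReal.ofReal_lt_top⟩
  have hEi : ∀ ρ > 0, ∀ x : Euc (n+1), Integrable (fun y => Et n ρ (x - y)) m := by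
    intro ρ hρ x
    refine Integrable.of_bound ((Et_cont hρ).comp (by fun_prop)).aestronglyMeasurable
      ((ρ^(n-1))⁻¹) (Eventually.of_forall fun y => ?_)
    rw [Real.norm_of_nonneg (Et_bd hρ _).1]; exact (Et_bd hρ _).2
  have hcont : ∀ ρ > 0, Continuous fun x => ∫ y, Et n ρ (x - y) ∂m := by
    intro ρ hρ
    refine continuous_of_dominated (bound := fun _ => (ρ^(n-1))⁻¹) ?_ ?_ (integrable_const _) ?_
    · intro x; exact (hEi ρ hρ x).1
    · intro x
      refine Eventually.of_forall fun y => ?_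
      rw [Real.norm_of_nonneg (Et_bd hρ _).1]; exact (Et_bd hρ _).2
    · exact Eventually.of_forall fun y => (Et_cont hρ).comp (by fun_prop)
  have hclose : ∀ ρ > 0, ∀ x, |pot m x - ∫ y, Et n ρ (x - y) ∂m| ≤ C1 * (2^n+1) * ρ := by
    intro ρ hρ x
    unfold pot
    rw [← integral_sub (pot_int hn hC1 hub hr hm x) (hEi ρ hρ x)]
    have hIE := (pot_int hn hC1 hub hr hm x)
    calc |∫ y, (Ek n (x - y) - Et n ρ (x - y)) ∂m|
        ≤ ∫ y, (closedBall x ρ).indicator (fun y => Ek n (x - y) + (ρ^(n-1))⁻¹) y ∂m := by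
          rw [← Real.norm_eq_abs]
          refine norm_integral_le_of_norm_le ?_ (Eventually.of_forall fun y => ?_)
          · exact (hIE.add (integrable_const _)).indicator measurableSet_closedBall
          · by_cases hy : y ∈ closedBall x ρ
            · rw [indicator_of_mem hy, Real.norm_eq_abs, abs_le]
              have h1 := Ek_nonneg (n := n) (x - y)
              have h2 := Et_bd hρ (x - y)
              have h3 : 0 < (ρ^(n-1))⁻¹ := by positivity
              constructor <;> linarith
            · rw [indicator_of_notMem hy]
              rw [mem_closedBall, dist_comm, dist_eq_norm] at hy
              push Not at hy
              rw [Ek_eq hn, Et, max_eq_left hy.le]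
              simp
      _ = (∫ y in closedBall x ρ, Ek n (x - y) ∂m) + m.real (closedBall x ρ) * (ρ^(n-1))⁻¹ := by
          rw [integral_indicator measurableSet_closedBall,
            integral_add hIE.integrableOn (integrable_const _), integral_const]
          simp
      _ ≤ C1 * 2^n * ρ + C1 * ρ^n * (ρ^(n-1))⁻¹ := by
          gcongr
          · rw [integral_eq_lintegral_of_nonneg_ae (Eventually.of_forall fun y => Ek_nonneg _)
              (Ek_meas_sub x).aestronglyMeasurable]
            exact ENNReal.toReal_le_of_le_ofReal (by positivity) (near_lint hn hC1 hub x hρ)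
          · exact ENNReal.toReal_le_of_le_ofReal (by positivity) (hub x ρ hρ)
      _ = _ := by
          obtain ⟨k, rfl⟩ : ∃ k, n = k + 1 := ⟨n - 1, by omega⟩
          rw [Nat.add_sub_cancel]
          field_simp
          ring
  have hunif : TendstoUniformly (fun (k : ℕ) x => ∫ y, Et n (es k) (x - y) ∂m) (pot m) atTop := by
    rw [Metric.tendstoUniformly_iff]
    intro ε hε
    have h1 : Tendsto (fun k => C1 * (2^n+1) * es k) atTop (𝓝 (C1 * (2^n+1) * 0)) :=
      es_tendsto.const_mul _
    rw [mul_zero] at h1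
    filter_upwards [h1.eventually (gt_mem_nhds hε)] with k hk x
    rw [Real.dist_eq]
    exact (hclose _ (es_pos k) x).trans_lt hk
  exact hunif.continuous (Frequently.of_forall fun k => hcont _ (es_pos k))

lemma pot_inf (hn : 2 ≤ n) [IsFiniteMeasure m] {x0 : Euc (n+1)} {r : ℝ}
    (hsupp : ∀ᵐ y ∂m, y ∈ closedBall x0 r) :
    ∀ ε > 0, ∃ R : ℝ, ∀ x, R ≤ ‖x‖ → pot m x ≤ ε := by
  intro ε hε
  set T := max 1 (m.real univ / ε) with hT
  have hT1 : 1 ≤ T := le_max_left _ _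
  have hTp : 0 < T := by linarith
  refine ⟨‖x0‖ + r + T, fun x hx => ?_⟩
  have hbd : ∀ᵐ y ∂m, Ek n (x - y) ≤ T⁻¹ := by
    filter_upwards [hsupp] with y hy
    have h1 : T ≤ ‖x - y‖ := by
      rw [mem_closedBall, dist_eq_norm] at hy
      have h2 : ‖x‖ ≤ ‖x - y‖ + ‖y - x0‖ + ‖x0‖ := by
        calc ‖x‖ = ‖(x - y) + (y - x0) + x0‖ := by congr 1; abel
          _ ≤ _ := norm_add₃_le
      linarith
    refine (Ek_le_of_le hn hTp h1).trans ?_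
    gcongr
    exact le_self_pow₀ hT1 (by omega)
  have : pot m x ≤ ∫ _y, T⁻¹ ∂m := by
    refine integral_mono_of_nonneg (Eventually.of_forall fun y => Ek_nonneg _) (integrable_const _) hbd
  refine this.trans ?_
  rw [integral_const, smul_eq_mul, ← div_eq_mul_inv, div_le_iff₀ hTp]
  have : m.real univ / ε ≤ T := le_max_right _ _
  rw [div_le_iff₀ hε] at this
  linarith

end Pot

end Part7

section Part8

/-- The data of the balayage construction. -/
structure Setup (n : ℕ) (Ω : Set (Euc (n+1))) (p : Euc (n+1)) (ν μ : Measure (Euc (n+1)))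
    (C1 : ℝ) : Prop where
  hn : 2 ≤ n
  hΩ : IsOpen Ω
  hfr : frontier Ω = Ωᶜ
  hpΩ : p ∈ Ω
  hp : PosAt Ω p
  fin : ν univ ≤ 1
  supp : ∀ᵐ y ∂ν, y ∉ Ω
  hν : ∀ f : Euc (n+1) → ℝ, Continuous f → HasCompactSupport f → ∫ y, f y ∂ν ≤ perron Ω f p
  hC1 : 0 < C1
  μsupp : ∀ᵐ y ∂μ, y ∉ Ω
  hub : ∀ x s, 0 < s → μ (closedBall x s) ≤ ENNReal.ofReal (C1 * s^n)
  hlb : ∃ D > 0, ∀ x ∉ Ω, ∀ s, 0 < s → s ≤ D → ENNReal.ofReal (C1⁻¹ * s^n) ≤ μ (ball x s)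

namespace Setup
variable {n : ℕ} {Ω : Set (Euc (n+1))} {p : Euc (n+1)} {ν μ : Measure (Euc (n+1))} {C1 : ℝ}

lemma finν (S : Setup n Ω p ν μ C1) : IsFiniteMeasure ν := ⟨S.fin.trans_lt ENNReal.one_lt_top⟩

lemma Ke_T1 (S : Setup n Ω p ν μ C1) {ε : ℝ} (hε : 0 < ε) (x : Euc (n+1)) :
    ∫ y, Ke n ε (y - x) ∂ν ≤ Ke n ε (p - x) := by
  have := S.finν
  refine T1 S.hp S.hν (h := fun y => Ke n ε (y - x)) ((Ke_continuous hε).comp (by fun_prop))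
    (M := (ε^2) ^ ((1 - (n:ℝ))/2)) (fun y => ?_) (fun y => Ke_nonneg _ _) ⟨?_, ?_⟩
  · rw [abs_of_nonneg (Ke_nonneg _ _)]; exact Ke_le_bound S.hn hε _
  · exact ((Ke_continuous hε).comp (by fun_prop)).continuousOn
  · intro z _ r hr _
    exact Ke_super S.hn hε x z r hr

lemma Ke_int (S : Setup n Ω p ν μ C1) {ε : ℝ} (hε : 0 < ε) (x : Euc (n+1)) :
    Integrable (fun y => Ke n ε (y - x)) ν := by
  have := S.finν
  refine Integrable.of_bound ((Ke_continuous hε).comp (by fun_prop)).aestronglyMeasurable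
    ((ε^2) ^ ((1 - (n:ℝ))/2)) (Eventually.of_forall fun y => ?_)
  rw [Real.norm_of_nonneg (Ke_nonneg _ _)]; exact Ke_le_bound S.hn hε _

lemma Ke_es_zero (hn : 2 ≤ n) (k : ℕ) : (k:ℝ) + 1 ≤ Ke n (es k) 0 := by
  have hk : (0:ℝ) < (k:ℝ) + 1 := by positivity
  have hn' : (2:ℝ) ≤ n := by exact_mod_cast hn
  unfold Ke es
  rw [norm_zero]
  have : ((0:ℝ)^2 + (1/((k:ℝ)+1))^2) = ((k:ℝ)+1)^(-2:ℝ) := by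
    rw [Real.rpow_neg hk.le, Real.rpow_two]
    field_simp
    ring
  rw [this, ← Real.rpow_mul hk.le]
  calc (k:ℝ)+1 = ((k:ℝ)+1)^(1:ℝ) := (Real.rpow_one _).symm
    _ ≤ _ := Real.rpow_le_rpow_of_exponent_le (by linarith [Nat.cast_nonneg (α := ℝ) k]) (by linarith)

lemma no_atom (S : Setup n Ω p ν μ C1) (x : Euc (n+1)) : ν {x} = 0 := by
  by_cases hx : x ∈ Ω
  · exact measure_mono_null (fun y hy => by
      rw [mem_singleton_iff] at hy; subst hy; simpa using hx) (ae_iff.1 S.supp)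
  have hpx : p - x ≠ 0 := by
    intro h; rw [sub_eq_zero] at h; exact hx (h ▸ S.hpΩ)
  have := S.finν
  by_contra hne
  have hpos : 0 < ν.real {x} := ENNReal.toReal_pos hne (measure_ne_top _ _)
  have key : ∀ k : ℕ, ν.real {x} * ((k:ℝ)+1) ≤ Ek n (p - x) := by
    intro k
    calc ν.real {x} * ((k:ℝ)+1) ≤ ν.real {x} * Ke n (es k) 0 := by
          gcongr; exact Ke_es_zero S.hn k
      _ = ∫ y in {x}, Ke n (es k) (y - x) ∂ν := by
          rw [integral_singleton]; simp
      _ ≤ ∫ y, Ke n (es k) (y - x) ∂ν :=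
          setIntegral_le_integral (S.Ke_int (es_pos k) x)
            (Eventually.of_forall fun y => Ke_nonneg _ _)
      _ ≤ Ke n (es k) (p - x) := S.Ke_T1 (es_pos k) x
      _ ≤ _ := Ke_le_Ek S.hn _ hpx
  obtain ⟨k, hk⟩ := exists_nat_gt (Ek n (p - x) / ν.real {x})
  rw [div_lt_iff₀ hpos] at hk
  have := key k
  nlinarith

lemma ae_ne (S : Setup n Ω p ν μ C1) (x : Euc (n+1)) : ∀ᵐ y ∂ν, y ≠ x := by
  rw [ae_iff]; simpa using S.no_atom x

lemma lint_le (S : Setup n Ω p ν μ C1) {x : Euc (n+1)} (hx : x ≠ p) :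
    ∫⁻ y, ENNReal.ofReal (Ek n (x - y)) ∂ν ≤ ENNReal.ofReal (Ek n (x - p)) := by
  have hpx : p - x ≠ 0 := by
    intro h; rw [sub_eq_zero] at h; exact hx h.symm
  have hlim : Tendsto (fun k => ∫⁻ y, ENNReal.ofReal (Ke n (es k) (y - x)) ∂ν) atTop
      (𝓝 (∫⁻ y, ENNReal.ofReal (Ek n (x - y)) ∂ν)) := by
    refine lintegral_tendsto_of_tendsto_of_monotone ?_ ?_ ?_
    · intro k
      exact ((Ke_continuous (es_pos k)).comp (by fun_prop : Continuous fun y => y - x)).measurable.ennreal_ofReal.aemeasurable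
    · refine Eventually.of_forall fun y => ?_
      intro a b hab
      refine ENNReal.ofReal_le_ofReal (Ke_anti S.hn (es_pos b) ?_ _)
      unfold es
      gcongr
    · filter_upwards [S.ae_ne x] with y hy
      rw [Ek_sub_comm]
      exact (ENNReal.continuous_ofReal.tendsto _).comp (Ke_tendsto (sub_ne_zero.2 hy))
  refine le_of_tendsto' hlim fun k => ?_
  rw [← ofReal_integral_eq_lintegral_ofReal (S.Ke_int (es_pos k) x)
    (Eventually.of_forall fun y => Ke_nonneg _ _)]
  refine ENNReal.ofReal_le_ofReal ((S.Ke_T1 (es_pos k) x).trans ?_)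
  rw [Ek_sub_comm]
  exact Ke_le_Ek S.hn _ hpx

lemma Uint (S : Setup n Ω p ν μ C1) {x : Euc (n+1)} (hx : x ≠ p) :
    Integrable (fun y => Ek n (x - y)) ν := by
  refine ⟨(Ek_meas_sub x).aestronglyMeasurable, ?_⟩
  rw [hasFiniteIntegral_iff_ofReal (Eventually.of_forall fun y => Ek_nonneg _)]
  exact (S.lint_le hx).trans_lt ENNReal.ofReal_lt_top

lemma U_le (S : Setup n Ω p ν μ C1) {x : Euc (n+1)} (hx : x ≠ p) : pot ν x ≤ Ek n (x - p) := by
  unfold pot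
  rw [integral_eq_lintegral_of_nonneg_ae (Eventually.of_forall fun y => Ek_nonneg _)
    (Ek_meas_sub x).aestronglyMeasurable]
  exact ENNReal.toReal_le_of_le_ofReal (Ek_nonneg _) (S.lint_le hx)

lemma hub' (S : Setup n Ω p ν μ C1) (B : Set (Euc (n+1))) (x : Euc (n+1)) (s : ℝ) (hs : 0 < s) :
    μ.restrict B (closedBall x s) ≤ ENNReal.ofReal (C1 * s^n) :=
  (Measure.restrict_apply_le _ _).trans (S.hub x s hs)

lemma huniv (S : Setup n Ω p ν μ C1) {B : Set (Euc (n+1))} {x0 : Euc (n+1)} {r : ℝ} (hr : 0 < r)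
    (hB : B ⊆ closedBall x0 r) : μ.restrict B univ ≤ ENNReal.ofReal (C1 * r^n) := by
  rw [Measure.restrict_apply_univ]
  exact (measure_mono hB).trans (S.hub _ _ hr)

/-- harmonicity test against boundary potentials -/
lemma pot_T2 (S : Setup n Ω p ν μ C1) {B : Set (Euc (n+1))} (hBm : MeasurableSet B)
    {x0 : Euc (n+1)} {r : ℝ} (hr : 0 < r)
    (hB : B ⊆ closedBall x0 r) :
    ∫ y, pot (μ.restrict B) y ∂ν = pot (μ.restrict B) p ∧ Integrable (pot (μ.restrict B)) ν := by
  have := S.finν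
  have hfin : IsFiniteMeasure (μ.restrict B) := ⟨(S.huniv hr hB).trans_lt ENNReal.ofReal_lt_top⟩
  have hc := pot_cont S.hn S.hC1.le (S.hub' B) hr (S.huniv hr hB)
  have hbd : ∀ x, |pot (μ.restrict B) x| ≤ C1 * (2^n+1) * r := by
    intro x
    rw [abs_of_nonneg (pot_nonneg _ _)]
    exact pot_le S.hn S.hC1.le (S.hub' B) hr (S.huniv hr hB) x
  have hs : ∀ᵐ y ∂μ.restrict B, y ∉ Ω := ae_restrict_of_ae S.μsupp
  refine ⟨T2 S.hp S.hν hc hbd (pot_nonneg _) (pot_SH S.hn hs S.hΩ) (pot_SH' S.hn hs S.hΩ)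
    (pot_inf S.hn (x0 := x0) (r := r) ?_), ?_⟩
  · filter_upwards [ae_restrict_mem hBm] with y hy using hB hy
  · exact Integrable.of_bound hc.aestronglyMeasurable _ (Eventually.of_forall fun x => hbd x)

end Setup

end Part8

section Part9

namespace Setup
variable {n : ℕ} {Ω : Set (Euc (n+1))} {p : Euc (n+1)} {ν μ : Measure (Euc (n+1))} {C1 : ℝ}

lemma pot_dom (S : Setup n Ω p ν μ C1) {B : Set (Euc (n+1))} (hBm : MeasurableSet B)
    {x0 : Euc (n+1)} {r : ℝ} (hr : 0 < r)
    (hB : B ⊆ closedBall x0 r) {y : Euc (n+1)} (hy : y ≠ x0) :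
    pot (μ.restrict B) y ≤ C1 * (2^n+1) * 2^(n-1) * r^n * Ek n (y - x0) := by
  have hfin : IsFiniteMeasure (μ.restrict B) := ⟨(S.huniv hr hB).trans_lt ENNReal.ofReal_lt_top⟩
  have hE : 0 < Ek n (y - x0) := Ek_pos (sub_ne_zero.2 hy)
  have hC := S.hC1
  have hd : 0 < ‖y - x0‖ := norm_pos_iff.2 (sub_ne_zero.2 hy)
  by_cases hcase : 2 * r ≤ ‖y - x0‖
  · have hmass : (μ.restrict B).real univ ≤ C1 * r^n :=
      ENNReal.toReal_le_of_le_ofReal (by positivity) (S.huniv hr hB)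
    have h1 : pot (μ.restrict B) y ≤ ∫ _w, ((‖y - x0‖/2)^(n-1))⁻¹ ∂(μ.restrict B) := by
      refine integral_mono_of_nonneg (Eventually.of_forall fun y => Ek_nonneg _) (integrable_const _) ?_
      filter_upwards [ae_restrict_mem hBm] with w hw
      refine Ek_le_of_le S.hn (by positivity) ?_
      have h2 := hB hw
      rw [mem_closedBall, dist_eq_norm] at h2
      have h3 : ‖y - x0‖ ≤ ‖y - w‖ + ‖w - x0‖ := norm_sub_le_norm_sub_add_norm_sub _ _ _
      linarith
    refine h1.trans ?_
    rw [integral_const, smul_eq_mul, div_pow, inv_div, div_eq_mul_inv, ← Ek_eq S.hn]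
    calc (μ.restrict B).real univ * (2^(n-1) * Ek n (y - x0))
        ≤ C1 * r^n * (2^(n-1) * Ek n (y - x0)) := by gcongr
      _ = C1 * 1 * 2^(n-1) * r^n * Ek n (y - x0) := by ring
      _ ≤ _ := by
        gcongr
        have : (0:ℝ) < 2^n := by positivity
        linarith
  · push Not at hcase
    refine (pot_le S.hn S.hC1.le (S.hub' B) hr (S.huniv hr hB) y).trans ?_
    have h1 := le_Ek_of_le S.hn (sub_ne_zero.2 hy) hcase.le
    calc C1 * (2^n+1) * r = C1 * (2^n+1) * 2^(n-1) * r^n * ((2*r)^(n-1))⁻¹ := by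
          obtain ⟨k, rfl⟩ : ∃ k, n = k + 1 := ⟨n - 1, by have := S.hn; omega⟩
          rw [Nat.add_sub_cancel, mul_pow]
          field_simp
          ring
      _ ≤ _ := by gcongr

lemma U_ge (S : Setup n Ω p ν μ C1) {x0 : Euc (n+1)} (hx0 : x0 ∉ Ω) : Ek n (x0 - p) ≤ pot ν x0 := by
  have := S.finν
  have hx0p : x0 ≠ p := fun h => hx0 (h ▸ S.hpΩ)
  obtain ⟨D, hD, hlb⟩ := S.hlb
  have hC := S.hC1
  set r : ℕ → ℝ := fun k => D * es k with hr
  have hrpos : ∀ k, 0 < r k := fun k => mul_pos hD (es_pos k)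
  have hrle : ∀ k, r k ≤ D := fun k => by
    have : es k ≤ 1 := by
      unfold es
      rw [div_le_one (by positivity)]
      linarith [Nat.cast_nonneg (α := ℝ) k]
    have := mul_le_mul_of_nonneg_left this hD.le
    simpa [hr] using this
  have hr0 : Tendsto r atTop (𝓝 0) := by
    have := es_tendsto.const_mul D
    rwa [mul_zero] at this
  set a : ℕ → ℝ := fun k => μ.real (closedBall x0 (r k)) with ha
  have hfinB : ∀ k, μ (closedBall x0 (r k)) ≠ ⊤ := fun k =>
    ((S.hub _ _ (hrpos k)).trans_lt ENNReal.ofReal_lt_top).ne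
  have halow : ∀ k, C1⁻¹ * (r k)^n ≤ a k := by
    intro k
    have h1 := hlb x0 hx0 (r k) (hrpos k) (hrle k)
    have h2 := h1.trans (measure_mono (ball_subset_closedBall))
    exact (ENNReal.ofReal_le_iff_le_toReal (hfinB k)).1 h2
  have hapos : ∀ k, 0 < a k := fun k => by
    have := hrpos k
    exact lt_of_lt_of_le (by positivity) (halow k)
  -- normalized potentials
  have hlimpt : ∀ y, y ≠ x0 → Tendsto (fun k => (a k)⁻¹ * pot (μ.restrict (closedBall x0 (r k))) y)
      atTop (𝓝 (Ek n (y - x0))) := by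
    intro y hy
    rw [Metric.tendsto_atTop]
    intro η hη
    have hcont : ContinuousAt (fun w => Ek n (y - w)) x0 :=
      (Ek_continuousAt (sub_ne_zero.2 hy)).comp (f := fun w => y - w) (by fun_prop)
    obtain ⟨δ, hδ, hδ'⟩ := Metric.continuousAt_iff.1 hcont (η/2) (half_pos hη)
    obtain ⟨N, hN⟩ := (Metric.tendsto_atTop.1 hr0) δ hδ
    refine ⟨N, fun k hk => ?_⟩
    have hrk : r k < δ := by
      have := hN k hk
      rw [Real.dist_eq, sub_zero, abs_of_pos (hrpos k)] at this
      exact this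
    have hfin : IsFiniteMeasure (μ.restrict (closedBall x0 (r k))) :=
      ⟨by rw [Measure.restrict_apply_univ]; exact (hfinB k).lt_top⟩
    have hInt := pot_int S.hn S.hC1.le (S.hub' (closedBall x0 (r k))) (hrpos k)
      (S.huniv (hrpos k) (le_refl (closedBall x0 (r k)))) y
    have e1 : (a k)⁻¹ * pot (μ.restrict (closedBall x0 (r k))) y - Ek n (y - x0)
        = (a k)⁻¹ * ∫ w in closedBall x0 (r k), (Ek n (y - w) - Ek n (y - x0)) ∂μ := by
      rw [integral_sub hInt (integrable_const _), integral_const, smul_eq_mul]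
      have : (μ.restrict (closedBall x0 (r k))).real univ = a k := by simp [ha]
      rw [this]
      have := (hapos k).ne'
      unfold pot
      field_simp
    rw [Real.dist_eq, e1, abs_mul, abs_of_pos (inv_pos.2 (hapos k))]
    have h2 : ‖∫ w in closedBall x0 (r k), (Ek n (y - w) - Ek n (y - x0)) ∂μ‖ ≤ η/2 * a k := by
      refine norm_setIntegral_le_of_norm_le_const (hfinB k).lt_top fun w hw => ?_
      have := hδ' (x := w) (lt_of_le_of_lt (mem_closedBall.1 hw) hrk)
      rw [Real.dist_eq] at this
      exact this.le
    rw [Real.norm_eq_abs] at h2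
    calc (a k)⁻¹ * |∫ w in closedBall x0 (r k), (Ek n (y - w) - Ek n (y - x0)) ∂μ|
        ≤ (a k)⁻¹ * (η/2 * a k) := by
          have := (hapos k)
          gcongr
      _ = η/2 := by
          have := (hapos k).ne'
          field_simp
      _ < η := half_lt_self hη
  have hlim1 : Tendsto (fun k => ∫ y, (a k)⁻¹ * pot (μ.restrict (closedBall x0 (r k))) y ∂ν) atTop
      (𝓝 (∫ y, Ek n (x0 - y) ∂ν)) := by
    refine tendsto_integral_of_dominated_convergence
      (fun y => C1 * (C1 * (2^n+1) * 2^(n-1)) * Ek n (x0 - y)) ?_ ((S.Uint hx0p).const_mul _) ?_ ?_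
    · intro k
      exact ((S.pot_T2 measurableSet_closedBall (hrpos k) le_rfl).2.const_mul _).1
    · intro k
      filter_upwards [S.ae_ne x0] with y hy
      have hrk := hrpos k
      have hak := hapos k
      rw [Real.norm_of_nonneg (mul_nonneg (inv_nonneg.2 (hapos k).le) (pot_nonneg _ _))]
      have h1 := S.pot_dom measurableSet_closedBall (hrpos k) (le_refl (closedBall x0 (r k))) hy
      have hE := Ek_nonneg (n := n) (y - x0)
      rw [Ek_sub_comm x0 y]
      calc (a k)⁻¹ * pot (μ.restrict (closedBall x0 (r k))) y
          ≤ (C1⁻¹ * (r k)^n)⁻¹ * (C1 * (2^n+1) * 2^(n-1) * (r k)^n * Ek n (y - x0)) := by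
            gcongr
            · exact pot_nonneg _ _
            · exact halow k
        _ = _ := by field_simp
    · filter_upwards [S.ae_ne x0] with y hy
      rw [Ek_sub_comm x0 y]
      exact hlimpt y hy
  have hlim2 := hlimpt p hx0p.symm
  have heq : ∀ k, ∫ y, (a k)⁻¹ * pot (μ.restrict (closedBall x0 (r k))) y ∂ν
      = (a k)⁻¹ * pot (μ.restrict (closedBall x0 (r k))) p := by
    intro k
    rw [integral_const_mul, (S.pot_T2 measurableSet_closedBall (hrpos k) le_rfl).1]
  simp_rw [heq] at hlim1
  rw [Ek_sub_comm]
  exact (tendsto_nhds_unique hlim2 hlim1).le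

lemma perron_le_U (S : Setup n Ω p ν μ C1) {x : Euc (n+1)} (hx : x ∈ Ω) :
    perron Ω (fun ξ => Ek n (ξ - p)) x ≤ pot ν x := by
  have := S.finν
  obtain ⟨δ, hδ, hb⟩ := Metric.isOpen_iff.1 S.hΩ p S.hpΩ
  set M := (δ^(n-1))⁻¹ with hM
  have hEM : ∀ ξ ∉ Ω, Ek n (ξ - p) ≤ M := by
    intro ξ hξ
    refine Ek_le_of_le S.hn hδ ?_
    by_contra hc
    exact hξ (hb (by rw [mem_ball, dist_eq_norm]; push Not at hc; exact hc))
  have hM0 : 0 ≤ M := by positivity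
  have hup : upB Ω (fun ξ => Ek n (ξ - p)) fun x => min (pot ν x) M := by
    refine ⟨(pot_SH S.hn S.supp S.hΩ).min (SH.const Ω M), ⟨M, fun z _ => ?_⟩, ?_⟩
    · rw [abs_of_nonneg (le_min (pot_nonneg _ _) hM0)]; exact min_le_right _ _
    · intro ξ hξ ε hε
      rw [S.hfr] at hξ
      have hξp : ξ ≠ p := fun h => hξ (h ▸ S.hpΩ)
      set Uk : ℕ → Euc (n+1) → ℝ := fun k x => ∫ y, Ke n (es k) (x - y) ∂ν with hUk
      have hKint : ∀ k x, Integrable (fun y => Ke n (es k) (x - y)) ν := by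
        intro k x
        refine Integrable.of_bound ((Ke_continuous (es_pos k)).comp (by fun_prop)).aestronglyMeasurable
          (((es k)^2) ^ ((1 - (n:ℝ))/2)) (Eventually.of_forall fun y => ?_)
        rw [Real.norm_of_nonneg (Ke_nonneg _ _)]; exact Ke_le_bound S.hn (es_pos k) _
      have hcont : ∀ k, Continuous (Uk k) := by
        intro k
        refine continuous_of_dominated (bound := fun _ => ((es k)^2) ^ ((1 - (n:ℝ))/2)) ?_ ?_ (integrable_const _) ?_
        · intro z; exact (hKint k z).1
        · intro z
          refine Eventually.of_forall fun y => ?_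
          rw [Real.norm_of_nonneg (Ke_nonneg _ _)]; exact Ke_le_bound S.hn (es_pos k) _
        · exact Eventually.of_forall fun y => (Ke_continuous (es_pos k)).comp (by fun_prop)
      have hle : ∀ k, ∀ z ∈ Ω, Uk k z ≤ pot ν z := by
        intro k z hz
        refine integral_mono_ae (hKint k z) (pot_int_away S.hn S.hΩ S.supp hz) ?_
        filter_upwards [S.ae_ne z] with y hy
        exact Ke_le_Ek S.hn _ (sub_ne_zero.2 hy.symm)
      have hlim : Tendsto (fun k => Uk k ξ) atTop (𝓝 (pot ν ξ)) := by
        refine tendsto_integral_of_dominated_convergence (fun y => Ek n (ξ - y))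
          (fun k => (hKint k ξ).1) (S.Uint hξp) ?_ ?_
        · intro k
          filter_upwards [S.ae_ne ξ] with y hy
          rw [Real.norm_of_nonneg (Ke_nonneg _ _)]
          exact Ke_le_Ek S.hn _ (sub_ne_zero.2 hy.symm)
        · filter_upwards [S.ae_ne ξ] with y hy
          exact Ke_tendsto (sub_ne_zero.2 hy.symm)
      have hge := S.U_ge hξ
      obtain ⟨k, hk⟩ := (hlim.eventually (lt_mem_nhds
        (show Ek n (ξ - p) - ε < pot ν ξ by linarith))).exists
      have hev : ∀ᶠ z in 𝓝 ξ, Ek n (ξ - p) - ε < Uk k z :=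
        (hcont k).continuousAt.eventually (lt_mem_nhds hk)
      filter_upwards [mem_nhdsWithin_of_mem_nhds hev, self_mem_nhdsWithin] with z hz hzΩ
      refine lt_min (lt_of_lt_of_le hz (hle k z hzΩ)) ?_
      have := hEM ξ hξ
      linarith
  unfold perron
  by_cases hbdd : BddBelow ((fun u : Euc (n+1) → ℝ => u x) '' upperFamily Ω fun ξ => Ek n (ξ - p))
  · exact (csInf_le hbdd ⟨_, hup.mem, rfl⟩).trans (min_le_left _ _)
  · rw [Real.sInf_of_not_bddBelow hbdd]
    exact pot_nonneg _ _

/-- the lower bound of the Green function -/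
lemma green_ge (S : Setup n Ω p ν μ C1) {x : Euc (n+1)} (hx : x ∈ Ω) :
    Ek n (x - p) - pot ν x ≤ greenFn n Ω p x := by
  have := S.perron_le_U hx
  unfold greenFn
  unfold Ek at *
  linarith

end Setup

end Part9

section Part10

section Taylor
variable {n : ℕ}

lemma pow_taylor (m : ℕ) : ∃ K : ℝ, 0 ≤ K ∧ ∀ t : ℝ, 0 ≤ t → t ≤ 6 →
    |t^m - 1 - m * (t - 1)| ≤ K * (t-1)^2 := by
  induction m with
  | zero => exact ⟨0, le_rfl, fun t _ _ => by simp⟩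
  | succ m ih =>
    obtain ⟨K, hK, h⟩ := ih
    refine ⟨6 * K + m, by positivity, fun t h0 h6 => ?_⟩
    have e : t^(m+1) - 1 - ((m+1:ℕ):ℝ) * (t-1) = t * (t^m - 1 - m*(t-1)) + m * (t-1)^2 := by
      push_cast; ring
    rw [e]
    refine (abs_add_le _ _).trans ?_
    rw [abs_mul, abs_of_nonneg h0, abs_of_nonneg (by positivity : 0 ≤ (m:ℝ) * (t-1)^2)]
    have h1 := h t h0 h6
    have h2 : t * |t^m - 1 - m*(t-1)| ≤ 6 * (K * (t-1)^2) := by gcongr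
    linarith

lemma Ek_taylor (hn : 2 ≤ n) : ∃ K : ℝ, 0 ≤ K ∧ ∀ w v : Euc (n+1), w ≠ 0 → 6 * ‖v‖ ≤ 5 * ‖w‖ →
    |Ek n (w + v) - Ek n w + ((n-1:ℕ):ℝ) * Ek n w / ‖w‖^2 * inner ℝ w v|
      ≤ K * Ek n w * (‖v‖/‖w‖)^2 := by
  obtain ⟨K, hK, h⟩ := pow_taylor (n-1)
  set m := n - 1 with hm
  refine ⟨36 * K + 6 * m + m, by positivity, fun w v hw hv => ?_⟩
  have hW : 0 < ‖w‖ := norm_pos_iff.2 hw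
  have hWV : ‖w‖ - ‖v‖ ≤ ‖w + v‖ := by
    have := norm_sub_norm_le w (-v); rw [norm_neg, sub_neg_eq_add] at this; exact this
  have hWV' : ‖w + v‖ ≤ ‖w‖ + ‖v‖ := norm_add_le _ _
  have hS : 0 < ‖w + v‖ := by linarith
  set ρ := ‖w + v‖ / ‖w‖ with hρ
  have hρ0 : 0 < ρ := by positivity
  have hρ6 : 1/6 ≤ ρ := by
    rw [hρ, le_div_iff₀ hW]; linarith
  set t := ρ⁻¹ with ht
  have ht0 : 0 < t := by positivity
  have ht6 : t ≤ 6 := by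
    rw [ht]; rw [inv_le_comm₀ hρ0 (by norm_num)]; linarith
  have htρ : t * ρ = 1 := inv_mul_cancel₀ hρ0.ne'
  set e := ‖v‖/‖w‖ with he
  have he0 : 0 ≤ e := by positivity
  have hρe : (1-ρ)^2 ≤ e^2 := by
    have h1 : ρ - 1 ≤ e := by
      rw [hρ, he, sub_le_iff_le_add, div_le_iff₀ hW, add_mul, div_mul_cancel₀ _ hW.ne']; linarith
    have h2 : -e ≤ ρ - 1 := by
      rw [hρ, he, le_sub_iff_add_le, le_div_iff₀ hW, add_mul, neg_mul, div_mul_cancel₀ _ hW.ne']; linarith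
    have := abs_le.2 ⟨h2, h1⟩
    nlinarith [sq_abs (ρ-1), abs_nonneg (ρ-1)]
  have hin : inner ℝ w v / ‖w‖^2 = (ρ^2 - 1 - e^2)/2 := by
    have := norm_add_sq_real w v
    rw [hρ, he, div_pow, div_pow, this]
    field_simp
    ring
  have hE : Ek n (w+v) = Ek n w * t^m := by
    rw [Ek_eq hn, Ek_eq hn, ht, hρ, inv_pow, div_pow, ← hm]
    field_simp
  have hEw : 0 < Ek n w := Ek_pos hw
  have h1 := h t ht0.le ht6
  have h2 : (t-1)^2 = t^2 * (1-ρ)^2 := by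
    have : t - 1 = t * (1 - ρ) := by rw [mul_sub, htρ]; ring
    rw [this]; ring
  have h3 : (t-1)^2 ≤ 36 * e^2 := by
    rw [h2]
    have : t^2 ≤ 36 := by nlinarith
    have := sq_nonneg (1-ρ)
    nlinarith
  have e1 : Ek n (w+v) - Ek n w + (m:ℝ) * Ek n w / ‖w‖^2 * inner ℝ w v
      = Ek n w * ((t^m - 1 - m * (t-1)) + (m * (1-ρ)^2 * t + m * (1-ρ)^2/2 - m * e^2/2)) := by
    have : (m:ℝ) * Ek n w / ‖w‖^2 * inner ℝ w v = m * Ek n w * (inner ℝ w v / ‖w‖^2) := by ring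
    rw [this, hin, hE]
    have h4 : (t - 1) = (1-ρ) + (1-ρ)^2 * t := by
      have : (1-ρ)^2 * t = t - 2 * (t*ρ) + (t * ρ)*ρ := by ring
      rw [this, htρ]; ring
    have h5 : (m:ℝ) * (t-1) = m * ((1-ρ) + (1-ρ)^2 * t) := by rw [h4]
    have h6 : (t^m - 1 - m * (t-1)) = t^m - 1 - m * ((1-ρ) + (1-ρ)^2 * t) := by rw [h5]
    rw [h6]
    ring
  rw [e1, abs_mul, abs_of_pos hEw]
  have h7 : |(m * (1-ρ)^2 * t + m * (1-ρ)^2/2 - m * e^2/2 : ℝ)| ≤ (6 * m + m) * e^2 := by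
    have hm0 : (0:ℝ) ≤ m := by positivity
    have hs := sq_nonneg (1-ρ)
    have a1 : m * (1-ρ)^2 * t ≤ m * e^2 * 6 := by gcongr
    have a2 : 0 ≤ m * (1-ρ)^2 * t := by positivity
    have a3 : m * (1-ρ)^2 ≤ m * e^2 := by gcongr
    have a4 : 0 ≤ m * (1-ρ)^2 := by positivity
    have a5 : 0 ≤ m * e^2 := by positivity
    rw [abs_le]; constructor <;> linarith
  have h8 : |t^m - 1 - m * (t-1) + (m * (1-ρ)^2 * t + m * (1-ρ)^2/2 - m * e^2/2)|
      ≤ (36 * K + 6 * m + m) * e^2 := by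
    refine (abs_add_le _ _).trans ?_
    have : K * (t-1)^2 ≤ K * (36 * e^2) := by gcongr
    linarith
  calc Ek n w * _ ≤ Ek n w * ((36 * K + 6 * m + m) * e^2) := by gcongr
    _ = _ := by ring

lemma H_far (hn : 2 ≤ n) : ∃ K : ℝ, 0 ≤ K ∧ ∀ (σ : Measure (Euc (n+1))) [IsProbabilityMeasure σ]
    (z x y : Euc (n+1)) (ℓ : ℝ), 0 < ℓ → (∀ᵐ u ∂σ, u ∈ closedBall z ℓ) → dist x z ≤ 8 * ℓ →
    12 * ℓ ≤ ‖z - y‖ → Integrable (fun u => Ek n (y - u)) σ →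
    |Ek n (x - y) + Ek n ((2:ℝ) • (∫ u, u ∂σ) - x - y) - 2 * pot σ y|
      ≤ K * ℓ^2 * (‖z - y‖^(n+1))⁻¹ := by
  obtain ⟨K, hK, hT⟩ := Ek_taylor hn
  refine ⟨400 * K, by positivity, ?_⟩
  intro σ _ z x y ℓ hℓ hσ hx hy hInt
  set w := z - y with hw
  have hW : 0 < ‖w‖ := by linarith
  have hw0 : w ≠ 0 := norm_pos_iff.1 hW
  set b := ∫ u, u ∂σ with hb
  have hui : Integrable (fun u : Euc (n+1) => u) σ := by
    refine Integrable.of_bound measurable_id.aestronglyMeasurable (‖z‖ + ℓ) ?_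
    filter_upwards [hσ] with u hu
    rw [mem_closedBall, dist_eq_norm] at hu
    have := norm_le_norm_add_norm_sub' u z
    linarith
  have hbz : ‖b - z‖ ≤ ℓ := by
    have : b - z = ∫ u, (u - z) ∂σ := by
      rw [integral_sub hui (integrable_const _), integral_const]; simp [hb]
    rw [this]
    have := norm_integral_le_of_norm_le_const (μ := σ) (f := fun u => u - z) (C := ℓ) (by
      filter_upwards [hσ] with u hu
      rwa [mem_closedBall, dist_eq_norm] at hu)
    simpa using this
  set c := ((n-1:ℕ):ℝ) * Ek n w / ‖w‖^2 with hc
  have hEw : 0 < Ek n w := Ek_pos hw0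
  set B := K * Ek n w * (10 * ℓ/‖w‖)^2 with hB
  have key : ∀ v : Euc (n+1), ‖v‖ ≤ 10 * ℓ → |Ek n (w + v) - Ek n w + c * inner ℝ w v| ≤ B := by
    intro v hv
    refine (hT w v hw0 (by linarith)).trans ?_
    rw [hB]; gcongr
  set x1 := (2:ℝ) • b - x with hx1
  have hxv : ‖x - z‖ ≤ 8 * ℓ := by rwa [← dist_eq_norm]
  have hx1v : ‖x1 - z‖ ≤ 10 * ℓ := by
    have : x1 - z = (2:ℝ) • (b - z) - (x - z) := by rw [hx1, smul_sub]; rw [two_smul ℝ z]; abel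
    rw [this]
    refine (norm_sub_le _ _).trans ?_
    rw [norm_smul]; norm_num; linarith
  have k1 := key (x - z) (by linarith)
  have k2 := key (x1 - z) hx1v
  have ex : w + (x - z) = x - y := by rw [hw]; abel
  have ex1 : w + (x1 - z) = x1 - y := by rw [hw]; abel
  rw [ex] at k1; rw [ex1] at k2
  have k3 : |pot σ y - Ek n w + c * inner ℝ w (b - z)| ≤ B := by
    have e0 : ∫ u, inner ℝ w (u - z) ∂σ = inner ℝ w (b - z) := by
      have hsub : Integrable (fun u => u - z) σ := hui.sub (integrable_const z)
      rw [integral_inner hsub,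
        integral_sub hui (integrable_const _), integral_const]
      simp [hb]
    have hii : Integrable (fun u => inner ℝ w (u - z)) σ :=
      (hui.sub (integrable_const z)).const_inner w
    have e1 : pot σ y - Ek n w + c * inner ℝ w (b - z)
        = ∫ u, (Ek n (y - u) - Ek n w + c * inner ℝ w (u - z)) ∂σ := by
      have hsub : Integrable (fun u => Ek n (y - u) - Ek n w) σ := hInt.sub (integrable_const _)
      rw [integral_add hsub (hii.const_mul c),
        integral_sub hInt (integrable_const _), integral_const_mul, e0, integral_const]
      simp [pot]
    rw [e1, ← Real.norm_eq_abs]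
    have := norm_integral_le_of_norm_le_const (μ := σ)
      (f := fun u => Ek n (y - u) - Ek n w + c * inner ℝ w (u - z)) (C := B) (by
      filter_upwards [hσ] with u hu
      rw [mem_closedBall, dist_eq_norm] at hu
      have := key (u - z) (by linarith)
      rw [Real.norm_eq_abs, Ek_sub_comm]
      have eu : w + (u - z) = u - y := by rw [hw]; abel
      rwa [eu] at this)
    simpa using this
  have hlin : inner ℝ w (x - z) + inner ℝ w (x1 - z) = 2 * inner ℝ w (b - z) := by
    rw [← inner_add_right]
    have : x - z + (x1 - z) = (2:ℝ) • (b - z) := by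
      rw [hx1, smul_sub]; rw [two_smul ℝ z]; abel
    rw [this, inner_smul_right]
  have hfin : |Ek n (x - y) + Ek n (x1 - y) - 2 * pot σ y| ≤ 4 * B := by
    have hl2 : c * inner ℝ w (x - z) + c * inner ℝ w (x1 - z) = 2 * (c * inner ℝ w (b - z)) := by
      rw [← mul_add, hlin]; ring
    rw [abs_le] at *
    constructor <;> linarith [k1.1, k1.2, k2.1, k2.2, k3.1, k3.2]
  refine hfin.trans (le_of_eq ?_)
  rw [hB, Ek_eq hn]
  obtain ⟨k, rfl⟩ : ∃ k, n = k + 1 := ⟨n - 1, by omega⟩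
  rw [Nat.add_sub_cancel]
  field_simp
  ring

/-- far tail -/
lemma far_lint {ν : Measure (Euc (n+1))} {T : ℝ} (hT : 0 ≤ T) (z : Euc (n+1)) {R : ℝ} (hR : 0 < R)
    (hub : ∀ s, R ≤ s → ν (closedBall z s) ≤ ENNReal.ofReal (T * s^n)) :
    ∫⁻ y in (ball z R)ᶜ, ENNReal.ofReal ((‖z - y‖^(n+1))⁻¹) ∂ν
      ≤ ENNReal.ofReal (T * 2 ^ (n+1) * R⁻¹) := by
  set An : ℕ → Set (Euc (n+1)) := fun k => closedBall z (R * 2^(k+1)) \ ball z (R * 2^k)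
    with hAn
  have hcov : (ball z R)ᶜ ⊆ ⋃ k, An k := by
    intro y hy
    rw [mem_compl_iff, mem_ball] at hy
    push Not at hy
    obtain ⟨k, hk1, hk2⟩ := exists_nat_pow_near (x := dist y z / R) (y := 2)
      ((one_le_div hR).2 hy) (by norm_num)
    rw [le_div_iff₀ hR] at hk1
    rw [div_lt_iff₀ hR] at hk2
    refine mem_iUnion.2 ⟨k, ?_, ?_⟩
    · rw [mem_closedBall]; linarith
    · rw [mem_ball]; push Not; linarith
  have h1 : ∀ k, ∫⁻ y in An k, ENNReal.ofReal ((‖z - y‖^(n+1))⁻¹) ∂ν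
      ≤ ENNReal.ofReal (T * 2 ^ n * R⁻¹) * ENNReal.ofReal (1/2) ^ k := by
    intro k
    calc ∫⁻ y in An k, ENNReal.ofReal ((‖z - y‖^(n+1))⁻¹) ∂ν
        ≤ ∫⁻ _y in An k, ENNReal.ofReal (((R * 2^k) ^ (n+1))⁻¹) ∂ν := by
          refine setLIntegral_mono measurable_const fun y hy => ENNReal.ofReal_le_ofReal ?_
          have := hy.2
          rw [mem_ball, dist_comm, dist_eq_norm] at this
          push Not at this
          gcongr
      _ ≤ ENNReal.ofReal (((R * 2^k) ^ (n+1))⁻¹) * ENNReal.ofReal (T * (R * 2^(k+1))^n) := by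
          rw [setLIntegral_const]
          gcongr
          refine (measure_mono sdiff_subset).trans (hub _ ?_)
          have : (1:ℝ) ≤ 2^(k+1) := one_le_pow₀ (by norm_num)
          nlinarith
      _ = ENNReal.ofReal (T * 2 ^ n * R⁻¹) * ENNReal.ofReal (1/2) ^ k := by
          rw [← ENNReal.ofReal_pow (by norm_num), ← ENNReal.ofReal_mul (by positivity),
            ← ENNReal.ofReal_mul (by positivity)]
          congr 1
          have e : R * (2:ℝ)^(k+1) = (R * 2^k) * 2 := by ring
          have e3 : T * 2^n * R⁻¹ * (1/2:ℝ)^k = T * 2^n * (R * 2^k)⁻¹ := by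
            rw [one_div, inv_pow, mul_inv]; ring
          rw [e, e3, mul_pow _ (2:ℝ) n]
          have h0 : R * (2:ℝ)^k ≠ 0 := by positivity
          generalize R * (2:ℝ)^k = X at *
          field_simp
          ring
  calc ∫⁻ y in (ball z R)ᶜ, ENNReal.ofReal ((‖z - y‖^(n+1))⁻¹) ∂ν
      ≤ ∫⁻ y in ⋃ k, An k, ENNReal.ofReal ((‖z - y‖^(n+1))⁻¹) ∂ν := lintegral_mono_set hcov
    _ ≤ ∑' k, ∫⁻ y in An k, ENNReal.ofReal ((‖z - y‖^(n+1))⁻¹) ∂ν := lintegral_iUnion_le _ _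
    _ ≤ ∑' k, ENNReal.ofReal (T * 2 ^ n * R⁻¹) * ENNReal.ofReal (1/2) ^ k := by
        gcongr with k
        exact h1 k
    _ = ENNReal.ofReal (T * 2 ^ (n+1) * R⁻¹) := by
        rw [ENNReal.tsum_mul_left, ENNReal.tsum_geometric]
        have : (1 - ENNReal.ofReal (1/2))⁻¹ = ENNReal.ofReal 2 := by
          rw [← ENNReal.ofReal_one, ← ENNReal.ofReal_sub _ (by norm_num),
            ← ENNReal.ofReal_inv_of_pos (by norm_num)]
          norm_num
        rw [this, ← ENNReal.ofReal_mul (by positivity)]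
        congr 1
        ring

end Taylor

end Part10

section Part11

namespace Setup
variable {n : ℕ} {Ω : Set (Euc (n+1))} {p : Euc (n+1)} {ν μ : Measure (Euc (n+1))} {C1 : ℝ}

lemma prod_int (S : Setup n Ω p ν μ C1) {z : Euc (n+1)} {R : ℝ} (hR : 0 < R) (hz : z ≠ p) :
    Integrable (Function.uncurry fun x y => Ek n (x - y)) ((volume.restrict (ball z R)).prod ν) := by
  have := S.finν
  have hfin : IsFiniteMeasure (volume.restrict (ball z R)) :=
    ⟨by rw [Measure.restrict_apply_univ]; exact measure_ball_lt_top⟩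
  have hm : AEStronglyMeasurable (Function.uncurry fun x y => Ek n (x - y))
      ((volume.restrict (ball z R)).prod ν) :=
    (Ek_measurable.comp (measurable_fst.sub measurable_snd)).aestronglyMeasurable
  rw [integrable_prod_iff' hm]
  refine ⟨Eventually.of_forall fun y => Ek_integrableOn S.hn y z R, ?_⟩
  have hmeas : AEStronglyMeasurable (fun y => ∫ x, ‖Function.uncurry (fun x y => Ek n (x - y)) (x, y)‖
      ∂(volume.restrict (ball z R))) ν := by
    have h1 := hm.norm.prod_swap.integral_prod_right'
    exact h1
  refine Integrable.mono' ((S.Uint hz).const_mul (volume.real (ball z R))) hmeas ?_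
  filter_upwards [S.ae_ne z] with y hy
  have h1 := Ek_super S.hn y z hy.symm R hR
  rw [avg_eq, inv_mul_le_iff₀ (vol_ball_pos z hR)] at h1
  rw [Real.norm_of_nonneg (integral_nonneg fun _ => norm_nonneg _)]
  refine le_trans (le_of_eq ?_) h1
  refine integral_congr_ae (Eventually.of_forall fun x => ?_)
  exact Real.norm_of_nonneg (Ek_nonneg _)

lemma potν_int (S : Setup n Ω p ν μ C1) {z : Euc (n+1)} {R : ℝ} (hR : 0 < R) (hz : z ≠ p) :
    IntegrableOn (pot ν) (ball z R) := by
  have := S.finν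
  exact (S.prod_int hR hz).integral_prod_left

lemma avg_pot (S : Setup n Ω p ν μ C1) {z : Euc (n+1)} {R : ℝ} (hR : 0 < R) (hz : z ≠ p) :
    ⨍ x in ball z R, pot ν x = ∫ y, (⨍ x in ball z R, Ek n (x - y)) ∂ν ∧
      Integrable (fun y => ⨍ x in ball z R, Ek n (x - y)) ν := by
  have := S.finν
  constructor
  · rw [avg_eq]
    unfold pot
    rw [integral_integral_swap (S.prod_int hR hz), ← integral_const_mul]
    simp_rw [avg_eq]
  · simp_rw [avg_eq]
    exact (S.prod_int hR hz).integral_prod_right.const_mul _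

lemma num_ineq (k : ℕ) : ((k:ℝ) + 2 + 1) / 2 * (25/16) ≤ 3/4 * 4^(k+1) := by
  have h : ∀ k : ℕ, ((k:ℝ) + 3) ≤ 3 * 4^k := by
    intro k
    induction k with
    | zero => norm_num
    | succ k ih =>
      push_cast
      rw [pow_succ]
      have : (1:ℝ) ≤ 4^k := one_le_pow₀ (by norm_num)
      linarith
  have := h k
  rw [pow_succ]
  linarith

/-- the averaged kernel is strictly below the kernel near the centre -/
lemma phi_lb (hn : 2 ≤ n) {z y : Euc (n+1)} {ℓ : ℝ} (hℓ : 0 < ℓ) (hyz : y ≠ z)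
    (hd : dist y z ≤ 2 * ℓ) :
    1/4 * ((2*ℓ)^(n-1))⁻¹ ≤ Ek n (z - y) - ⨍ x in ball z (8*ℓ), Ek n (x - y) := by
  have h1 : ((2*ℓ)^(n-1))⁻¹ ≤ Ek n (z - y) :=
    le_Ek_of_le hn (sub_ne_zero.2 hyz.symm) (by rw [← dist_eq_norm, dist_comm]; exact hd)
  have h2 : ⨍ x in ball z (8*ℓ), Ek n (x - y) ≤ 3/4 * ((2*ℓ)^(n-1))⁻¹ := by
    have hsub : ball z (8*ℓ) ⊆ ball y (10*ℓ) := by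
      refine ball_subset_ball' ?_
      rw [dist_comm]; linarith
    have h3 : ∫ x in ball z (8*ℓ), Ek n (x - y) ≤ ∫ x in ball y (10*ℓ), Ek n (x - y) :=
      setIntegral_mono_set (Ek_integrableOn hn y y _) (Eventually.of_forall fun _ => Ek_nonneg _)
        (HasSubset.Subset.eventuallyLE hsub)
    have h4 : ⨍ x in ball y (10*ℓ), Ek n (x - y) = ((n:ℝ)+1)/2 * ((10*ℓ)^(n-1))⁻¹ := by
      rw [avg_sub (Ek n) y y (by positivity), sub_self]
      exact (Ek_ball_int hn (by positivity)).2
    rw [avg_eq] at h4 ⊢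
    have hv := vol_ball_pos (d := n+1) 0 one_pos
    have e10 := vol_ball (d := n+1) y (r := 10*ℓ) (by positivity)
    have e8 := vol_ball (d := n+1) z (r := 8*ℓ) (by positivity)
    rw [e10] at h4
    rw [e8]
    set V := volume.real (ball (0 : Euc (n+1)) 1) with hV
    have h5 : ∫ x in ball y (10*ℓ), Ek n (x - y) =
        ((10*ℓ)^(n+1) * V) * (((n:ℝ)+1)/2 * ((10*ℓ)^(n-1))⁻¹) := by
      rw [← h4]; field_simp
    rw [inv_mul_le_iff₀ (by positivity)]
    refine h3.trans (h5.trans_le ?_)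
    obtain ⟨k, rfl⟩ : ∃ k, n = k + 2 := ⟨n - 2, by omega⟩
    have e1 : k + 2 - 1 = k + 1 := by omega
    rw [e1]
    have h6 := num_ineq k
    have e2 : (10*ℓ)^(k+2+1) * V * ((((k+2:ℕ):ℝ)+1)/2 * ((10*ℓ)^(k+1))⁻¹)
       = V * (ℓ^2 * 64) * (((k:ℝ)+2+1)/2 * (25/16)) := by
      push_cast
      field_simp
      ring
    have e3 : (8*ℓ)^(k+2+1) * V * (3/4 * ((2*ℓ)^(k+1))⁻¹) = V * (ℓ^2 * 64) * (3/4 * 4^(k+1)) := by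
      have : (8*ℓ)^(k+2+1) = (2*ℓ)^(k+1) * 4^(k+1) * (ℓ^2*64) := by
        rw [← mul_pow]; ring
      rw [this]
      have : (2*ℓ)^(k+1) ≠ 0 := by positivity
      field_simp
    rw [e2, e3]
    gcongr
  linarith

lemma avgG_lb (S : Setup n Ω p ν μ C1) {z : Euc (n+1)} (hz : z ∉ Ω) {ℓ : ℝ} (hℓ : 0 < ℓ)
    (hzp : 8 * ℓ < dist z p) :
    1/4 * ((2*ℓ)^(n-1))⁻¹ * ∫ y, bump z ℓ y ∂ν
      ≤ ⨍ x in ball z (8*ℓ), (Ek n (x - p) - pot ν x) := by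
  have := S.finν
  have hne : z ≠ p := fun h => hz (h ▸ S.hpΩ)
  have hR : 0 < 8 * ℓ := by positivity
  have e1 : ⨍ x in ball z (8*ℓ), (Ek n (x - p) - pot ν x)
      = ∫ y, (Ek n (z - y) - ⨍ x in ball z (8*ℓ), Ek n (x - y)) ∂ν := by
    rw [integral_sub (S.Uint hne) (S.avg_pot hR hne).2, ← (S.avg_pot hR hne).1, avg_eq,
      integral_sub (Ek_integrableOn S.hn p z _) (S.potν_int hR hne), mul_sub, ← avg_eq, ← avg_eq,
      Ek_harm S.hn p z _ hR hzp]
    have h1 := S.U_le hne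
    have h2 := S.U_ge hz
    have : Ek n (z - p) = ∫ y, Ek n (z - y) ∂ν := le_antisymm h2 h1
    rw [this]
  rw [e1, ← integral_const_mul]
  refine integral_mono_ae ?_ ((S.Uint hne).sub (S.avg_pot hR hne).2) ?_
  · exact ((bump_cont z ℓ).integrable_of_hasCompactSupport (bump_cs z hℓ)).const_mul _
  · filter_upwards [S.ae_ne z] with y hy
    show 1/4 * ((2*ℓ)^(n-1))⁻¹ * bump z ℓ y ≤ Ek n (z - y) - ⨍ x in ball z (8*ℓ), Ek n (x - y)
    by_cases hd : dist y z ≤ 2 * ℓ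
    · refine le_trans ?_ (phi_lb S.hn hℓ hy hd)
      refine mul_le_of_le_one_right (by positivity) (bump_le_one _ _ _)
    · push Not at hd
      rw [bump_zero hℓ hd.le, mul_zero, sub_nonneg]
      exact Ek_super S.hn y z hy.symm _ hR

end Setup

end Part11

section Part12

namespace Setup
variable {n : ℕ} {Ω : Set (Euc (n+1))} {p : Euc (n+1)} {ν μ : Measure (Euc (n+1))} {C1 : ℝ}

/-- pointwise upper bound for the Green potential near `Q` -/
lemma ptw (hn : 2 ≤ n) : ∃ K : ℝ, 0 ≤ K ∧ ∀ {Ω : Set (Euc (n+1))} {p : Euc (n+1)}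
    {ν μ : Measure (Euc (n+1))} {C1 : ℝ}, Setup n Ω p ν μ C1 →
    ∀ {Q : Set (Euc (n+1))} {z : Euc (n+1)} {ℓ a0 T : ℝ}, MeasurableSet Q → 0 < ℓ → 0 < a0 → 0 ≤ T →
    Q ⊆ closedBall z ℓ → a0 * ℓ^n ≤ μ.real Q →
    (∀ s, ℓ ≤ s → ν (closedBall z s) ≤ ENNReal.ofReal (T * s^n)) → 15 * ℓ ≤ dist z p →
    ∀ x, dist x z ≤ 8 * ℓ → Ek n (x - p) - pot ν x ≤ K * ℓ^2 * (‖z - p‖^(n+1))⁻¹ +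
      (2 * a0⁻¹ * C1 * (2^n+1) * 12^n + K * 2^(n+1) / 12) * T * ℓ := by
  obtain ⟨K, hK, hH⟩ := H_far hn
  refine ⟨K, hK, ?_⟩
  intro Ω p ν μ C1 S Q z ℓ a0 T hQm hℓ ha0 hT hQ hμQ hνub hzp x hx
  have := S.finν
  have hC1 := S.hC1
  set a := μ.real Q with ha
  have hapos : 0 < a := lt_of_lt_of_le (by positivity) hμQ
  have hμne : μ Q ≠ 0 := by intro h; rw [measureReal_def, h] at ha; simp at ha; linarith
  have hμtop : μ Q ≠ ⊤ := by
    intro h; rw [measureReal_def, h] at ha; simp at ha; linarith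
  set m := μ.restrict Q with hm
  have hmu := S.huniv hℓ hQ
  have hmfin : IsFiniteMeasure m := ⟨hmu.trans_lt ENNReal.ofReal_lt_top⟩
  set σ := (μ Q)⁻¹ • m with hσ
  have hσp : IsProbabilityMeasure σ := ⟨by
    rw [hσ, Measure.smul_apply, hm, Measure.restrict_apply_univ, smul_eq_mul,
      ENNReal.inv_mul_cancel hμne hμtop]⟩
  have hainv : ((μ Q)⁻¹).toReal = a⁻¹ := by rw [ENNReal.toReal_inv, ha, measureReal_def]
  have hpσ : ∀ y, pot σ y = a⁻¹ * pot m y := by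
    intro y
    unfold pot
    rw [hσ, integral_smul_measure, hainv, smul_eq_mul]
  have hmem : ∀ᵐ u ∂σ, u ∈ closedBall z ℓ := by
    refine Measure.ae_smul_measure ?_ _
    filter_upwards [ae_restrict_mem hQm] with y hy using hQ hy
  have hintm : ∀ y, Integrable (fun u => Ek n (y - u)) m := fun y =>
    pot_int S.hn hC1.le (S.hub' Q) hℓ hmu y
  have hintσ : ∀ y, Integrable (fun u => Ek n (y - u)) σ := fun y =>
    (hintm y).smul_measure (ENNReal.inv_ne_top.2 hμne)
  have hpm : ∀ y, pot m y ≤ C1 * (2^n+1) * ℓ := pot_le S.hn hC1.le (S.hub' Q) hℓ hmu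
  obtain ⟨hT2, hT2i⟩ := S.pot_T2 hQm hℓ hQ
  set b := ∫ u, u ∂σ with hb
  have hbz : dist b z ≤ ℓ := by
    rw [← mem_closedBall]
    refine (convex_closedBall z ℓ).integral_mem isClosed_closedBall hmem ?_
    refine Integrable.of_bound measurable_id.aestronglyMeasurable (‖z‖ + ℓ) ?_
    filter_upwards [hmem] with u hu
    rw [mem_closedBall, dist_eq_norm] at hu
    calc ‖u‖ = ‖z + (u - z)‖ := by congr 1; abel
      _ ≤ ‖z‖ + ‖u - z‖ := norm_add_le _ _
      _ ≤ _ := by linarith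
  set x1 := (2:ℝ) • b - x with hx1
  have hx1z : dist x1 z ≤ 10 * ℓ := by
    rw [dist_eq_norm]
    have : x1 - z = (2:ℝ) • (b - z) - (x - z) := by
      rw [hx1, smul_sub, two_smul ℝ z]; abel
    rw [this]
    rw [dist_eq_norm] at hbz hx
    calc _ ≤ ‖(2:ℝ) • (b - z)‖ + ‖x - z‖ := norm_sub_le _ _
      _ = 2 * ‖b - z‖ + ‖x - z‖ := by rw [norm_smul]; simp
      _ ≤ _ := by linarith
  have hxp : x ≠ p := by
    rintro rfl; rw [dist_comm] at hx; linarith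
  have hx1p : x1 ≠ p := by
    intro h; rw [h, dist_comm] at hx1z; linarith
  have hG1 := S.U_le hx1p
  -- H
  set H : Euc (n+1) → ℝ := fun y => Ek n (x - y) + Ek n (x1 - y) - 2 * pot σ y with hHd
  have hσi : Integrable (pot σ) ν := by
    have : pot σ = fun y => a⁻¹ * pot m y := funext hpσ
    rw [this]; exact hT2i.const_mul _
  have hσint : ∫ y, pot σ y ∂ν = pot σ p := by
    rw [hpσ p, ← hT2, ← integral_const_mul]
    exact integral_congr_ae (Eventually.of_forall hpσ)
  have hsum : Integrable (fun y => Ek n (x - y) + Ek n (x1 - y)) ν := (S.Uint hxp).add (S.Uint hx1p)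
  have h2σ : Integrable (fun y => 2 * pot σ y) ν := hσi.const_mul 2
  have hHi : Integrable H ν := hsum.sub h2σ
  have hHint : ∫ y, H y ∂ν = pot ν x + pot ν x1 - 2 * pot σ p := by
    rw [hHd, integral_sub hsum h2σ, integral_add (S.Uint hxp) (S.Uint hx1p), integral_const_mul, hσint]
    rfl
  have hfar : ∀ y, 12 * ℓ ≤ ‖z - y‖ → |H y| ≤ K * ℓ^2 * (‖z - y‖^(n+1))⁻¹ := fun y hy =>
    hH σ z x y ℓ hℓ hmem hx hy (hintσ y)
  have hHp : H p ≤ K * ℓ^2 * (‖z - p‖^(n+1))⁻¹ := by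
    refine (le_abs_self _).trans (hfar p ?_)
    rw [← dist_eq_norm]; linarith
  set M0 := 2 * (a⁻¹ * (C1 * (2^n+1) * ℓ)) with hM0
  have hM0n : 0 ≤ M0 := by positivity
  set W1 : Euc (n+1) → ℝ := (ball z (12*ℓ)).indicator fun _ => M0 with hW1
  set W2 : Euc (n+1) → ℝ := (ball z (12*ℓ))ᶜ.indicator fun y => K * ℓ^2 * (‖z - y‖^(n+1))⁻¹ with hW2
  have hmeasf : Measurable fun y : Euc (n+1) => (‖z - y‖^(n+1))⁻¹ := by fun_prop
  have hfl := far_lint (ν := ν) hT z (R := 12*ℓ) (by positivity) (fun s hs => hνub s (by linarith))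
  have hfi : IntegrableOn (fun y => (‖z - y‖^(n+1))⁻¹) (ball z (12*ℓ))ᶜ ν := by
    refine ⟨hmeasf.aestronglyMeasurable, ?_⟩
    rw [hasFiniteIntegral_iff_ofReal (Eventually.of_forall fun y => by positivity)]
    exact hfl.trans_lt ENNReal.ofReal_lt_top
  have hfi2 : ∫ y in (ball z (12*ℓ))ᶜ, (‖z - y‖^(n+1))⁻¹ ∂ν ≤ T * 2^(n+1) * (12*ℓ)⁻¹ := by
    rw [integral_eq_lintegral_of_nonneg_ae (Eventually.of_forall fun y => by positivity)
      hmeasf.aestronglyMeasurable]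
    exact ENNReal.toReal_le_of_le_ofReal (by positivity) hfl
  have hW1i : Integrable W1 ν := (integrable_const M0).indicator measurableSet_ball
  have hW2i : Integrable W2 ν := (integrable_indicator_iff measurableSet_ball.compl).2 (Integrable.const_mul hfi _)
  have hW1int : ∫ y, W1 y ∂ν ≤ M0 * (T * (12*ℓ)^n) := by
    rw [hW1, integral_indicator measurableSet_ball, setIntegral_const, smul_eq_mul, mul_comm]
    gcongr
    rw [measureReal_def]
    exact ENNReal.toReal_le_of_le_ofReal (by positivity)
      ((measure_mono ball_subset_closedBall).trans (hνub _ (by linarith)))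
  have hW2int : ∫ y, W2 y ∂ν ≤ K * ℓ^2 * (T * 2^(n+1) * (12*ℓ)⁻¹) := by
    rw [hW2, integral_indicator measurableSet_ball.compl, integral_const_mul]
    gcongr
  have hWH : ∀ y, - H y ≤ W1 y + W2 y := by
    intro y
    by_cases hy : y ∈ ball z (12*ℓ)
    · rw [hW1, hW2, indicator_of_mem hy, indicator_of_notMem (by simpa using hy), hHd]
      have h1 := Ek_nonneg (n := n) (x - y)
      have h2 := Ek_nonneg (n := n) (x1 - y)
      have h3 : 2 * pot σ y ≤ M0 := by
        rw [hpσ, hM0]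
        have := hpm y
        gcongr
      show -(Ek n (x - y) + Ek n (x1 - y) - 2 * pot σ y) ≤ _
      linarith
    · rw [hW1, hW2, indicator_of_notMem hy, indicator_of_mem (by simpa using hy)]
      have h1 : 12 * ℓ ≤ ‖z - y‖ := by
        rw [mem_ball, not_lt, dist_comm, dist_eq_norm] at hy; exact hy
      have := hfar y h1
      linarith [neg_abs_le (H y)]
  have hInt : ∫ y, -H y ∂ν ≤ ∫ y, W1 y ∂ν + ∫ y, W2 y ∂ν := by
    rw [← integral_add hW1i hW2i]
    exact integral_mono hHi.neg (hW1i.add hW2i) hWH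
  rw [integral_neg, hHint] at hInt
  have hM0T : M0 * (T * (12*ℓ)^n) ≤ 2 * a0⁻¹ * C1 * (2^n+1) * 12^n * T * ℓ := by
    have h1 : a⁻¹ ≤ (a0 * ℓ^n)⁻¹ := inv_anti₀ (by positivity) hμQ
    calc M0 * (T * (12*ℓ)^n) ≤ 2 * ((a0 * ℓ^n)⁻¹ * (C1 * (2^n+1) * ℓ)) * (T * (12*ℓ)^n) := by
          rw [hM0]; gcongr
      _ = _ := by rw [mul_pow]; field_simp
  have hK2 : K * ℓ^2 * (T * 2^(n+1) * (12*ℓ)⁻¹) = K * 2^(n+1) / 12 * T * ℓ := by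
    field_simp
  have hHp' : Ek n (x - p) + Ek n (x1 - p) - 2 * pot σ p ≤ K * ℓ^2 * (‖z - p‖^(n+1))⁻¹ := hHp
  nlinarith

end Setup

end Part12

section Part13

namespace Setup
variable {n : ℕ} {Ω : Set (Euc (n+1))} {p : Euc (n+1)} {ν μ : Measure (Euc (n+1))} {C1 : ℝ}

/-- volume of the part of the ball close to the boundary -/
lemma thin_vol (S : Setup n Ω p ν μ C1) {z : Euc (n+1)} (hz : z ∉ Ω) {ℓ κ : ℝ} (hℓ : 0 < ℓ)
    (hκ : 0 < κ) (hκ1 : κ ≤ 1)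
    (hlb : ∀ x ∉ Ω, ENNReal.ofReal (C1⁻¹ * (κ*ℓ)^n) ≤ μ (ball x (κ*ℓ))) :
    volume.real {x ∈ ball z (8*ℓ) | infDist x Ωᶜ < κ * ℓ} ≤
      C1^2 * 2^(n+1) * 10^n * κ * ℓ^(n+1) * volume.real (ball (0 : Euc (n+1)) 1) := by
  have hC1 := S.hC1
  set s := κ * ℓ with hs
  have hsp : 0 < s := by positivity
  have hsl : s ≤ ℓ := by rw [hs]; nlinarith
  set V := volume.real (ball (0 : Euc (n+1)) 1) with hV
  have hVp : 0 < V := vol_ball_pos _ one_pos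
  set m := μ.restrict (closedBall z (10*ℓ)) with hm
  have hmu : m univ ≤ ENNReal.ofReal (C1 * (10*ℓ)^n) := by
    rw [hm, Measure.restrict_apply_univ]; exact S.hub _ _ (by positivity)
  have hmfin : IsFiniteMeasure m := ⟨hmu.trans_lt ENNReal.ofReal_lt_top⟩
  set A : Set (Euc (n+1) × Euc (n+1)) := {q | dist q.1 q.2 ≤ 2 * s} with hA
  have hAm : MeasurableSet A := (isClosed_le (by fun_prop) (by fun_prop)).measurableSet
  set th := {x ∈ ball z (8*ℓ) | infDist x Ωᶜ < s} with hth
  have hthm : MeasurableSet th :=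
    measurableSet_ball.inter ((isOpen_lt (continuous_infDist_pt _) continuous_const).measurableSet)
  have h1 := Measure.prod_apply (μ := (volume : Measure (Euc (n+1)))) (ν := m) hAm
  have h2 := Measure.prod_apply_symm (μ := (volume : Measure (Euc (n+1)))) (ν := m) hAm
  have hup : (volume.prod m) A ≤ ENNReal.ofReal ((2*s)^(n+1) * V) * ENNReal.ofReal (C1 * (10*ℓ)^n) := by
    rw [h2]
    calc _ ≤ ∫⁻ y, ENNReal.ofReal ((2*s)^(n+1) * V) ∂m := by
          refine lintegral_mono fun y => ?_
          have e : (fun x => (x, y)) ⁻¹' A = closedBall y (2*s) := by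
            ext x; simp [hA]
          rw [e, ← vol_ball y (by positivity : 0 < 2 * s), Measure.addHaar_closedBall_eq_addHaar_ball,
            measureReal_def, ENNReal.ofReal_toReal measure_ball_lt_top.ne]
      _ ≤ _ := by
          rw [lintegral_const]; gcongr
  have hlow : ENNReal.ofReal (C1⁻¹ * s^n) * volume th ≤ (volume.prod m) A := by
    rw [h1, ← setLIntegral_const]
    refine le_trans (setLIntegral_mono' hthm fun x hx => ?_) (setLIntegral_le_lintegral th _)
    obtain ⟨ξ, hξ, hd⟩ := (infDist_lt_iff ⟨z, hz⟩).1 hx.2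
    refine (hlb ξ hξ).trans ?_
    have hsub : ball ξ s ⊆ closedBall z (10*ℓ) := by
      intro y hy
      rw [mem_ball] at hy
      have h3 := hx.1
      rw [mem_ball] at h3
      rw [mem_closedBall]
      have := dist_triangle4 y ξ x z
      rw [dist_comm ξ x] at this
      linarith
    have hsub2 : ball ξ s ⊆ Prod.mk x ⁻¹' A := by
      intro y hy
      rw [mem_ball] at hy
      show dist x y ≤ 2 * s
      have := dist_triangle x ξ y
      rw [dist_comm ξ y] at this
      linarith
    calc μ (ball ξ s) = m (ball ξ s) := by
          rw [hm, Measure.restrict_apply measurableSet_ball, inter_eq_left.2 hsub]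
      _ ≤ _ := measure_mono hsub2
  have h3 := hlow.trans hup
  rw [← ENNReal.ofReal_mul (by positivity)] at h3
  have h4 := ENNReal.toReal_le_of_le_ofReal (by positivity) h3
  rw [ENNReal.toReal_mul, ENNReal.toReal_ofReal (by positivity), ← measureReal_def] at h4
  have h5 : C1⁻¹ * s^n * volume.real th ≤ C1⁻¹ * s^n *
      (C1^2 * 2^(n+1) * 10^n * κ * ℓ^(n+1) * V) := by
    refine h4.trans (le_of_eq ?_)
    rw [hs]
    field_simp
    ring
  exact le_of_mul_le_mul_left h5 (by positivity)

lemma exists_pt (S : Setup n Ω p ν μ C1) {z : Euc (n+1)} (hz : z ∉ Ω) {ℓ κ B lam : ℝ} (hℓ : 0 < ℓ)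
    (hzp : 15 * ℓ ≤ dist z p)
    (hκ : 0 < κ) (hκ1 : κ ≤ 1) (hB : 0 ≤ B) (hlam : 0 < lam)
    (hlb : ∀ x ∉ Ω, ENNReal.ofReal (C1⁻¹ * (κ*ℓ)^n) ≤ μ (ball x (κ*ℓ)))
    (hG : ∀ x, dist x z ≤ 8 * ℓ → Ek n (x - p) - pot ν x ≤ B)
    (hlow : lam ≤ 1/4 * ((2*ℓ)^(n-1))⁻¹ * ∫ y, bump z ℓ y ∂ν)
    (hsm : B * (C1^2 * 2^(n+1) * 10^n * κ / 8^(n+1)) ≤ lam/4) :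
    ∃ x ∈ ball z (8*ℓ), x ∈ Ω ∧ κ * ℓ ≤ infDist x Ωᶜ ∧ lam/4 < greenFn n Ω p x := by
  by_contra hcon
  push Not at hcon
  have hthin := S.thin_vol hz hℓ hκ hκ1 hlb
  set th := {x ∈ ball z (8*ℓ) | infDist x Ωᶜ < κ * ℓ} with hth
  have hthm : MeasurableSet th :=
    measurableSet_ball.inter ((isOpen_lt (continuous_infDist_pt _) continuous_const).measurableSet)
  have hne : z ≠ p := fun h => hz (h ▸ S.hpΩ)
  have hR : 0 < 8 * ℓ := by positivity
  have hbd : ∀ x ∈ ball z (8*ℓ), Ek n (x - p) - pot ν x ≤ lam/4 + th.indicator (fun _ => B) x := by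
    intro x hx
    by_cases hxt : x ∈ th
    · rw [indicator_of_mem hxt]
      have := hG x (mem_ball.1 hx).le
      linarith
    · rw [indicator_of_notMem hxt, add_zero]
      have h1 : κ * ℓ ≤ infDist x Ωᶜ := by
        by_contra h; push Not at h; exact hxt ⟨hx, h⟩
      have hxΩ : x ∈ Ω := by
        by_contra h
        rw [infDist_zero_of_mem (show x ∈ Ωᶜ from h)] at h1
        have : 0 < κ * ℓ := by positivity
        linarith
      exact (S.green_ge hxΩ).trans (hcon x hx hxΩ h1)
  have hci : IntegrableOn (fun _ : Euc (n+1) => lam/4) (ball z (8*ℓ)) :=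
    integrableOn_const measure_ball_lt_top.ne
  have hBi : IntegrableOn (th.indicator (fun _ => B)) (ball z (8*ℓ)) :=
    Integrable.indicator (integrableOn_const measure_ball_lt_top.ne) hthm
  have hsumi : IntegrableOn (fun x => lam/4 + th.indicator (fun _ => B) x) (ball z (8*ℓ)) :=
    hci.add hBi
  have hsubi : IntegrableOn (fun x => Ek n (x - p) - pot ν x) (ball z (8*ℓ)) :=
    (Ek_integrableOn S.hn p z _).sub (S.potν_int hR hne)
  have h1 := avg_mono z hR hsubi hsumi hbd
  have h2 := S.avgG_lb hz hℓ (by linarith)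
  have h3 : ⨍ x in ball z (8*ℓ), (lam/4 + th.indicator (fun _ => B) x) ≤ lam/4 + lam/4 := by
    have hv := vol_ball_pos z hR
    have e8 := vol_ball (d := n+1) z hR
    have e1 : ∫ x in ball z (8*ℓ), (lam/4 + th.indicator (fun _ => B) x)
        = volume.real (ball z (8*ℓ)) * (lam/4) + volume.real th * B := by
      rw [integral_add hci hBi, setIntegral_const, smul_eq_mul, setIntegral_indicator hthm,
        setIntegral_const, smul_eq_mul, inter_eq_right.2 (fun x hx => hx.1)]
    rw [avg_eq, e1, inv_mul_le_iff₀ hv, mul_add]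
    refine add_le_add le_rfl ?_
    rw [e8]
    set V := volume.real (ball (0 : Euc (n+1)) 1) with hV
    have hVp : 0 < V := vol_ball_pos _ one_pos
    calc volume.real th * B ≤ C1^2 * 2^(n+1) * 10^n * κ * ℓ^(n+1) * V * B := by gcongr
      _ = (8*ℓ)^(n+1) * V * (B * (C1^2 * 2^(n+1) * 10^n * κ / 8^(n+1))) := by
          rw [mul_pow]; field_simp
      _ ≤ _ := by gcongr
  linarith

end Setup

end Part13

section Part14

section Lat
variable {n : ℕ} {F : Set (Euc (n+1))} {μ : Measure (Euc (n+1))} {Cl : ℝ}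

lemma sideLen_pos (q : Cube n) : 0 < sideLen q := by unfold sideLen; positivity

lemma lat_dist (L : DSLattice n F μ Cl) {q : Cube n} (hq : L.mem q) {x y : Euc (n+1)} (hx : x ∈ q.2)
    (hy : y ∈ q.2) : dist x y ≤ sideLen q := by
  have h1 := (Metric.edist_le_ediam_of_mem hx hy).trans (L.diam_le q.1 q.2 hq)
  rw [edist_dist] at h1
  exact (ENNReal.ofReal_le_ofReal_iff (sideLen_pos q).le).1 h1

lemma lat_fin (L : DSLattice n F μ Cl) {q : Cube n} (hq : L.mem q) : μ q.2 ≠ ⊤ :=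
  ((L.measure_ub q.1 q.2 hq).trans_lt ENNReal.ofReal_lt_top).ne

lemma lat_ub (L : DSLattice n F μ Cl) {q : Cube n} (hq : L.mem q) :
    (μ q.2).toReal ≤ Cl * sideLen q ^ n := by
  have := L.one_le_Cl
  have := sideLen_pos q
  exact ENNReal.toReal_le_of_le_ofReal (by positivity) (L.measure_ub q.1 q.2 hq)

lemma lat_lb (L : DSLattice n F μ Cl) {q : Cube n} (hq : L.mem q) :
    Cl⁻¹ * sideLen q ^ n ≤ (μ q.2).toReal := by
  exact (ENNReal.ofReal_le_iff_le_toReal (lat_fin L hq)).1 (L.measure_lb q.1 q.2 hq)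

lemma lat_pos (L : DSLattice n F μ Cl) {q : Cube n} (hq : L.mem q) : 0 < (μ q.2).toReal := by
  have := L.one_le_Cl
  have := sideLen_pos q
  exact lt_of_lt_of_le (by positivity) (lat_lb L hq)

lemma exists_max (hn : 2 ≤ n) (L : DSLattice n F μ Cl) {R₀ : Cube n} (hR : L.mem R₀) {P : Cube n → Prop}
    (hP : ∀ q, P q → L.mem q ∧ q.2 ⊆ R₀.2) {q : Cube n} (hq : P q) :
    ∃ q', MaximalWith L P q' ∧ q.2 ⊆ q'.2 := by
  have hCl := L.one_le_Cl
  have hL := sideLen_pos R₀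
  have hbd : ∀ q, P q → sideLen q ≤ Cl^2 * sideLen R₀ := by
    intro q hq
    obtain ⟨h1, h2⟩ := hP q hq
    have h3 := lat_lb L h1
    have h4 := lat_ub L hR
    have h5 : (μ q.2).toReal ≤ (μ R₀.2).toReal := ENNReal.toReal_mono (lat_fin L hR) (measure_mono h2)
    have h6 : Cl⁻¹ * sideLen q ^ n ≤ Cl * sideLen R₀ ^ n := by linarith
    rw [inv_mul_le_iff₀ (by positivity)] at h6
    refine le_of_pow_le_pow_left₀ (by omega : n ≠ 0) (by positivity) (h6.trans ?_)
    rw [mul_pow, ← mul_assoc]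
    gcongr
    calc Cl * Cl = Cl^2 := by ring
      _ = (Cl^2)^1 := by ring
      _ ≤ (Cl^2)^n := pow_le_pow_right₀ (one_le_pow₀ hCl) (by omega)
  obtain ⟨b, hb⟩ := pow_unbounded_of_one_lt (Cl^2 * sideLen R₀) (one_lt_two (α := ℝ))
  have hgen : ∀ q, P q → -(b:ℤ) ≤ q.1 := by
    intro q hq
    have h1 := (hbd q hq).trans_lt hb
    unfold sideLen at h1
    rw [← zpow_natCast] at h1
    have := (zpow_lt_zpow_iff_right₀ (one_lt_two (α := ℝ))).1 h1
    omega
  obtain ⟨j, ⟨q', hq', hsub, hj⟩, hmin⟩ := Int.exists_least_of_bdd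
    (P := fun j => ∃ q' : Cube n, P q' ∧ q.2 ⊆ q'.2 ∧ q'.1 = j)
    ⟨-(b:ℤ), by rintro j ⟨q', h1, -, rfl⟩; exact hgen q' h1⟩ ⟨q.1, q, hq, subset_rfl, rfl⟩
  refine ⟨q', ⟨hq', fun q'' hm hlt hs hPq => ?_⟩, hsub⟩
  have := hmin q''.1 ⟨q'', hPq, hsub.trans hs, rfl⟩
  omega

end Lat

lemma hMeasure_le_one {d : ℕ} {Ω : Set (Euc d)} {p : Euc d} (hp : PosAt Ω p) (S : Set (Euc d)) :
    hMeasure Ω p S ≤ 1 := by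
  refine perron_le_const hp (M := 1) (fun ξ _ => ?_) (fun ξ _ => ?_)
  · by_cases h : ξ ∈ S <;> simp [h]
  · by_cases h : ξ ∈ S <;> simp [h]

lemma diam_ge {n : ℕ} (hn : 2 ≤ n) {C₀ Cl : ℝ} (hC₀ : 1 ≤ C₀) {F : Set (Euc (n+1))} (hF : ADRegular n C₀ F)
    {μ : Measure (Euc (n+1))} (hμ : μ = (μH[n]).restrict F) (L : DSLattice n F μ Cl) {q : Cube n}
    (hq : L.mem q) : ENNReal.ofReal ((Cl * 5^(n+1) * C₀)⁻¹ * sideLen q) ≤ Metric.ediam F := by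
  by_cases htop : Metric.ediam F = ⊤
  · rw [htop]; exact le_top
  set D := (Metric.ediam F).toReal with hD
  have hDe : Metric.ediam F = ENNReal.ofReal D := (ENNReal.ofReal_toReal htop).symm
  have hCl := L.one_le_Cl
  have hL := sideLen_pos q
  have hD0 : 0 ≤ D := ENNReal.toReal_nonneg
  have h1 := adr_total hn hF hD0 hDe
  have h2 : μ q.2 ≤ μH[n] F := by
    rw [hμ]
    exact (measure_mono (subset_univ _)).trans (by rw [Measure.restrict_apply_univ])
  have h3 := (L.measure_lb q.1 q.2 hq).trans (h2.trans h1)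
  have h4 := (ENNReal.ofReal_le_ofReal_iff (by positivity)).1 h3
  rw [hDe]
  refine ENNReal.ofReal_le_ofReal ?_
  rw [inv_mul_le_iff₀ (by positivity)]
  rw [inv_mul_le_iff₀ (by positivity)] at h4
  refine le_of_pow_le_pow_left₀ (by omega : n ≠ 0) (by positivity) (h4.trans ?_)
  have h5 : 1 ≤ Cl * 5^(n+1) * C₀ := by
    have : (1:ℝ) ≤ 5^(n+1) := one_le_pow₀ (by norm_num)
    exact one_le_mul_of_one_le_of_one_le (one_le_mul_of_one_le_of_one_le hCl this) hC₀
  rw [mul_pow]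
  calc Cl * (5^(n+1) * C₀ * D^n) = (Cl * 5^(n+1) * C₀)^1 * D^n := by ring
    _ ≤ _ := by
      gcongr
      omega

lemma exists_gen {s : ℝ} (hs : 0 < s) : ∃ j : ℤ, 2 * s ≤ (2:ℝ)^(-j) ∧ (2:ℝ)^(-j) ≤ 4 * s := by
  obtain ⟨k, h1, h2⟩ := exists_mem_Ico_zpow (x := 2 * s) (y := (2:ℝ)) (by positivity) (by norm_num)
  refine ⟨-(k+1), ?_, ?_⟩
  · rw [neg_neg]; exact h2.le
  · rw [neg_neg, zpow_add₀ (by norm_num)]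
    simp only [zpow_one]
    linarith

end Part14

section Part15

lemma nu_ub {n : ℕ} (hn : 2 ≤ n) {C₀ Cl A : ℝ} (hC₀ : 1 ≤ C₀) (hA : 1 ≤ A) {Ω : Set (Euc (n+1))}
    (hF : ADRegular n C₀ (frontier Ω)) {μ : Measure (Euc (n+1))}
    (hμ : μ = (μH[n]).restrict (frontier Ω)) (L : DSLattice n (frontier Ω) μ Cl) {R₀ Q : Cube n}
    {p : Euc (n+1)} (hR : L.mem R₀) (hp : PosAt Ω p) {ν : Measure (Euc (n+1))} (hfin : ν univ ≤ 1)
    (hν : ∀ f : Euc (n+1) → ℝ, Continuous f → HasCompactSupport f → ∫ y, f y ∂ν ≤ perron Ω f p)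
    (hub : ∀ x s, 0 < s → μ (closedBall x s) ≤ ENNReal.ofReal (5^(n+1) * 3^n * C₀ * s^n))
    (hQ : Q ∈ Gfam Ω μ L p R₀ A) {s : ℝ} (hs : sideLen Q ≤ s) :
    ν (closedBall (L.center Q.2) s) ≤ ENNReal.ofReal
      (((A * (5^(n+1) * 3^n * C₀) * 12^n + (4 * (Cl * 5^(n+1) * C₀))^n * Cl) * (μ R₀.2).toReal⁻¹) * s^n) := by
  have hνf : IsFiniteMeasure ν := ⟨hfin.trans_lt ENNReal.one_lt_top⟩
  obtain ⟨⟨hQm, hQR, hgen⟩, hQG⟩ := hQ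
  have hCl := L.one_le_Cl
  have hℓ := sideLen_pos Q
  have hL := sideLen_pos R₀
  have hs0 : 0 < s := hℓ.trans_le hs
  have hμR := lat_pos L hR
  have hμR2 := lat_ub L hR
  set z := L.center Q.2 with hz
  have hzQ : z ∈ Q.2 := L.center_mem _ _ hQm
  have hzF : z ∈ frontier Ω := L.subset_F _ _ hQm hzQ
  set τ := (μ R₀.2).toReal⁻¹ with hτ
  have hτ0 : 0 < τ := inv_pos.2 hμR
  set Kd := Cl * 5^(n+1) * C₀ with hKd
  have hKd1 : 1 ≤ Kd := by
    have : (1:ℝ) ≤ 5^(n+1) := one_le_pow₀ (by norm_num)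
    exact one_le_mul_of_one_le_of_one_le (one_le_mul_of_one_le_of_one_le hCl this) hC₀
  set C1 := 5^(n+1) * 3^n * C₀ with hC1
  have hC1p : 0 < C1 := by positivity
  have hdiam := diam_ge hn hC₀ hF hμ L hR
  obtain ⟨j, hj1, hj2⟩ := exists_gen hs0
  by_cases hcase : L.mem R₀ ∧ ENNReal.ofReal ((2:ℝ)^(-j)) ≤ Metric.ediam (frontier Ω) ∧ (2:ℝ)^(-j) ≤ sideLen R₀
  · obtain ⟨-, hjd, hjR⟩ := hcase
    obtain ⟨Q', hQ', hzQ'⟩ := L.cover j hjd z hzF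
    set q' : Cube n := (j, Q') with hq'
    have hq'm : L.mem q' := hQ'
    have hside : sideLen q' = (2:ℝ)^(-j) := rfl
    have hjQ : j ≤ Q.1 := by
      have : (2:ℝ)^(-Q.1) ≤ (2:ℝ)^(-j) := by
        have : (2:ℝ)^(-Q.1) ≤ s := hs
        linarith
      have := (zpow_le_zpow_iff_right₀ (one_lt_two (α := ℝ))).1 this
      omega
    have hRj : R₀.1 ≤ j := by
      have := (zpow_le_zpow_iff_right₀ (one_lt_two (α := ℝ))).1 (show (2:ℝ)^(-j) ≤ (2:ℝ)^(-R₀.1) from hjR)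
      omega
    have hQQ' : Q.2 ⊆ Q' := L.nested Q.1 j hjQ _ hQm _ hQ' ⟨z, hzQ, hzQ'⟩
    have hQ'R : Q' ⊆ R₀.2 := L.nested j R₀.1 hRj _ hQ' _ hR ⟨z, hzQ', hQR hzQ⟩
    have hnot : ¬ HDcond Ω μ L p R₀ A q' := by
      intro h
      obtain ⟨q'', h1, h2⟩ := exists_max hn L hR (P := HDcond Ω μ L p R₀ A) (fun q hq => ⟨hq.1, hq.2.1⟩) h
      exact hQG q'' (Or.inl h1) (hQQ'.trans h2)
    have hlt : dens Ω μ p 2 q' < A * dens Ω μ p 2 R₀ := by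
      by_contra h; push Not at h; exact hnot ⟨hq'm, hQ'R, h⟩
    -- the dilated cube is contained in a ball
    have hsub : dilCube (frontier Ω) 2 q' ⊆ closedBall z (12 * s) := by
      rintro x ⟨hxF, hx⟩
      have : infDist x Q' < 2 * (2:ℝ)^(-j) := by
        have h1 : infDist x Q' ≤ (2 - 1) * (2:ℝ)^(-j) := hx
        have : (0:ℝ) < (2:ℝ)^(-j) := by positivity
        linarith
      obtain ⟨y, hy, hd⟩ := (infDist_lt_iff ⟨z, hzQ'⟩).1 this
      have h2 := lat_dist L hq'm hy hzQ'
      rw [hside] at h2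
      rw [mem_closedBall]
      have := dist_triangle x y z
      linarith
    have hsubF : ∀ q : Cube n, L.mem q → q.2 ⊆ dilCube (frontier Ω) 2 q := by
      intro q hq x hx
      refine ⟨L.subset_F _ _ hq hx, ?_⟩
      rw [infDist_zero_of_mem hx]
      have := sideLen_pos q
      linarith
    have hmuTle : μ (dilCube (frontier Ω) 2 q') ≤ ENNReal.ofReal (C1 * (12*s)^n) :=
      (measure_mono hsub).trans (hub _ _ (by positivity))
    have hμ2 : (μ (dilCube (frontier Ω) 2 q')).toReal ≤ C1 * (12*s)^n :=
      ENNReal.toReal_le_of_le_ofReal (by positivity) hmuTle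
    have hmuTpos : 0 < (μ (dilCube (frontier Ω) 2 q')).toReal :=
      (lat_pos L hq'm).trans_le
        (ENNReal.toReal_mono (hmuTle.trans_lt ENNReal.ofReal_lt_top).ne (measure_mono (hsubF q' hq'm)))
    have hμR2top : μ (dilCube (frontier Ω) 2 R₀) ≠ ⊤ := by
      have hsubR : dilCube (frontier Ω) 2 R₀ ⊆ closedBall z (3 * sideLen R₀) := by
        rintro x ⟨hxF, hx⟩
        have : infDist x R₀.2 < 2 * sideLen R₀ := by linarith
        obtain ⟨y, hy, hd⟩ := (infDist_lt_iff ⟨z, hQR hzQ⟩).1 this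
        have h2 := lat_dist L hR hy (hQR hzQ)
        rw [mem_closedBall]
        have := dist_triangle x y z
        linarith
      exact (((measure_mono hsubR).trans (hub _ _ (by positivity))).trans_lt ENNReal.ofReal_lt_top).ne
    have hdR : dens Ω μ p 2 R₀ ≤ τ := by
      have h1 : (μ R₀.2).toReal ≤ (μ (dilCube (frontier Ω) 2 R₀)).toReal :=
        ENNReal.toReal_mono hμR2top (measure_mono (hsubF R₀ hR))
      unfold dens
      rw [div_le_iff₀ (hμR.trans_le h1)]
      refine (hMeasure_le_one hp _).trans ?_
      calc (1:ℝ) = τ * (μ R₀.2).toReal := by rw [hτ, inv_mul_cancel₀ hμR.ne']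
        _ ≤ _ := by gcongr
    have hω : hMeasure Ω p (dilCube (frontier Ω) 2 q') ≤ A * τ * (C1 * (12*s)^n) := by
      unfold dens at hlt
      rw [div_lt_iff₀ hmuTpos] at hlt
      refine hlt.le.trans ?_
      calc A * dens Ω μ p 2 R₀ * (μ (dilCube (frontier Ω) 2 q')).toReal
          ≤ A * τ * (μ (dilCube (frontier Ω) 2 q')).toReal := by gcongr
        _ ≤ _ := by gcongr
    have hbump : ∫ y, bump z s y ∂ν ≤ hMeasure Ω p (dilCube (frontier Ω) 2 q') := by
      refine (hν _ (bump_cont z s) (bump_cs z hs0)).trans ?_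
      refine perron_mono hp (M := 1) (fun ξ _ => ?_) (fun ξ _ => ?_) (fun ξ hξ => ?_)
      · rw [abs_of_nonneg (bump_nonneg _ _ _)]; exact bump_le_one _ _ _
      · by_cases h : ξ ∈ dilCube (frontier Ω) 2 q' <;> simp [h]
      · by_cases h : ξ ∈ dilCube (frontier Ω) 2 q'
        · rw [indicator_of_mem h]; exact bump_le_one _ _ _
        · rw [indicator_of_notMem h]
          refine (bump_zero hs0 ?_).le
          by_contra hc
          push Not at hc
          refine h ⟨hξ, ?_⟩
          have := infDist_le_dist_of_mem (x := ξ) (s := Q') hzQ'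
          show infDist ξ Q' ≤ (2 - 1) * (2:ℝ)^(-j)
          linarith
    have hνb : ν.real (closedBall z s) ≤ ∫ y, bump z s y ∂ν := by
      have : ν.real (closedBall z s) = ∫ y, (closedBall z s).indicator (fun _ => (1:ℝ)) y ∂ν := by
        rw [integral_indicator isClosed_closedBall.measurableSet, setIntegral_const, smul_eq_mul, mul_one]
      rw [this]
      refine integral_mono ((integrable_const _).indicator isClosed_closedBall.measurableSet)
        ((bump_cont z s).integrable_of_hasCompactSupport (bump_cs z hs0)) fun y => ?_
      by_cases h : y ∈ closedBall z s
      · show (closedBall z s).indicator (fun _ => (1:ℝ)) y ≤ bump z s y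
        rw [indicator_of_mem h, bump_one hs0 (mem_closedBall.1 h)]
      · show (closedBall z s).indicator (fun _ => (1:ℝ)) y ≤ bump z s y
        rw [indicator_of_notMem h]; exact bump_nonneg _ _ _
    rw [ENNReal.le_ofReal_iff_toReal_le (measure_ne_top _ _) (by positivity), ← measureReal_def]
    refine (hνb.trans (hbump.trans hω)).trans ?_
    rw [mul_pow]
    have : 0 ≤ (4 * Kd)^n * Cl * τ * s^n := by positivity
    nlinarith
  · have hsL : sideLen R₀ ≤ 4 * Kd * s := by
      by_contra hc
      push Not at hc
      apply hcase
      refine ⟨hR, ?_, ?_⟩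
      · refine le_trans (ENNReal.ofReal_le_ofReal ?_) hdiam
        rw [le_inv_mul_iff₀ (by positivity)]
        nlinarith
      · nlinarith
    have h1 : (1:ℝ) ≤ (4 * Kd)^n * Cl * τ * s^n := by
      have h2 : (μ R₀.2).toReal ≤ (4 * Kd)^n * Cl * s^n := by
        calc (μ R₀.2).toReal ≤ Cl * sideLen R₀ ^ n := hμR2
          _ ≤ Cl * (4 * Kd * s)^n := by gcongr
          _ = _ := by rw [mul_pow _ s]; ring
      calc (1:ℝ) = (μ R₀.2).toReal * τ := by rw [hτ, mul_inv_cancel₀ hμR.ne']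
        _ ≤ (4 * Kd)^n * Cl * s^n * τ := by gcongr
        _ = _ := by ring
    refine (measure_mono (subset_univ _)).trans (hfin.trans ?_)
    rw [ENNReal.one_le_ofReal]
    have : 0 ≤ A * C1 * 12^n * τ * s^n := by positivity
    nlinarith

end Part15

theorem good_corkscrew_for_G
    (n : ℕ) (hn : 2 ≤ n) (C₀ Cl c c' A : ℝ) (hC₀ : 1 ≤ C₀) (hCl : 1 ≤ Cl)
    (hc : 0 < c) (hc' : 0 < c') (hA : 1 ≤ A) (D : ℝ → ℝ) :
    ∃ κ₀ c₃ : ℝ, 0 < κ₀ ∧ 0 < c₃ ∧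
      ∀ (F : Set (Euc (n+1))), IsClosed F → ADRegular n C₀ F →
      ∀ Ω : Set (Euc (n+1)), Ω = Fᶜ → frontier Ω = F →
      ∀ μ : Measure (Euc (n+1)), μ = (μH[n]).restrict (frontier Ω) →
      ∀ (L : DSLattice n (frontier Ω) μ Cl) (R₀ : Cube n) (p : Euc (n+1)),
        L.mem R₀ → p ∈ Ω → p ∉ cubeBall L 4 R₀ →
        c * sideLen R₀ ≤ infDist p (frontier Ω) →
        infDist p (frontier Ω) ≤ infDist p R₀.2 →
        infDist p R₀.2 ≤ c⁻¹ * sideLen R₀ →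
        c' ≤ hMeasure Ω p R₀.2 →
        WeakAInftyBallWith n Ω p (L.center R₀.2) (4 * sideLen R₀) D →
      ∀ Q ∈ Gfam Ω μ L p R₀ A,
        ∃ x ∈ cubeBall L 2 Q ∩ Ω,
          κ₀ * sideLen Q ≤ infDist x (frontier Ω) ∧
          c₃ * sideLen Q / (μ R₀.2).toReal < greenFn n Ω p x := by
  obtain ⟨K, hK, hptw⟩ := Setup.ptw hn
  set C1 : ℝ := 5^(n+1) * 3^n * C₀ with hC1
  have hC1p : 0 < C1 := by positivity
  set Kd : ℝ := Cl * 5^(n+1) * C₀ with hKd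
  have h51 : (1:ℝ) ≤ 5^(n+1) := one_le_pow₀ (by norm_num)
  have h31 : (1:ℝ) ≤ 3^n := one_le_pow₀ (by norm_num)
  have hKd1 : 1 ≤ Kd :=
    one_le_mul_of_one_le_of_one_le (one_le_mul_of_one_le_of_one_le hCl h51) hC₀
  have hC1C₀ : C₀ ≤ C1 := by
    rw [hC1]
    exact le_mul_of_one_le_left (by linarith) (one_le_mul_of_one_le_of_one_le h51 h31)
  set CT : ℝ := A * C1 * 12^n + (4 * Kd)^n * Cl with hCT
  have hCTp : 0 ≤ CT := by positivity
  set K2 : ℝ := 2 * (Cl⁻¹)⁻¹ * C1 * (2^n+1) * 12^n + K * 2^(n+1) / 12 with hK2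
  have hK2p : 0 ≤ K2 := by positivity
  set bB : ℝ := K * Cl + K2 * CT with hbB
  have hbBp : 0 ≤ bB := by positivity
  set cl : ℝ := 1/4 * (2^(n-1))⁻¹ * (A⁻¹ * c' * Cl⁻¹) with hcl
  have hclp : 0 < cl := by positivity
  set Y : ℝ := C1^2 * 2^(n+1) * 10^n / 8^(n+1) with hY
  have hYp : 0 < Y := by positivity
  set κ : ℝ := min Kd⁻¹ (cl / (4 * (bB + 1) * Y)) with hκ
  have hκp : 0 < κ := lt_min (by positivity) (by positivity)
  have hκd : κ ≤ Kd⁻¹ := min_le_left _ _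
  have hκ1 : κ ≤ 1 := hκd.trans (inv_le_one_of_one_le₀ hKd1)
  have hκY : bB * Y * κ ≤ cl / 4 := by
    have h1 : κ ≤ cl / (4 * (bB + 1) * Y) := min_le_right _ _
    rw [le_div_iff₀ (by positivity)] at h1
    have : 0 ≤ κ * Y := by positivity
    nlinarith
  refine ⟨κ, cl/4, hκp, by positivity, ?_⟩
  intro F hFc hF Ω hΩ hfr μ hμ L R₀ p hR hpΩ hpB _ _ _ hω _ Q hQ
  have hΩo : IsOpen Ω := by rw [hΩ]; exact hFc.isOpen_compl
  have hfrΩ : frontier Ω = Ωᶜ := by rw [hfr, hΩ, compl_compl]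
  have hF' : ADRegular n C₀ (frontier Ω) := by rw [hfr]; exact hF
  have hp : PosAt Ω p := posAt_of_hMeasure hc' hω
  have hQ0 := hQ
  obtain ⟨⟨hQm, hQR, hgen⟩, hQG⟩ := hQ0
  have hℓ := sideLen_pos Q
  have hL := sideLen_pos R₀
  set ℓ := sideLen Q with hℓd
  set z := L.center Q.2 with hz
  have hzQ : z ∈ Q.2 := L.center_mem _ _ hQm
  have hzF : z ∈ frontier Ω := L.subset_F _ _ hQm hzQ
  have hzΩ : z ∉ Ω := by rw [hfrΩ] at hzF; exact hzF
  have hℓL : ℓ ≤ sideLen R₀ := by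
    refine zpow_le_zpow_right₀ (by norm_num) ?_
    omega
  have hμR := lat_pos L hR
  have hμR2 := lat_ub L hR
  set τ := (μ R₀.2).toReal⁻¹ with hτ
  have hτ0 : 0 < τ := inv_pos.2 hμR
  have hLτ : (sideLen R₀ ^ n)⁻¹ ≤ Cl * τ := by
    rw [hτ, inv_le_iff_one_le_mul₀ (by positivity)]
    calc (1:ℝ) = (μ R₀.2).toReal⁻¹ * (μ R₀.2).toReal := by rw [inv_mul_cancel₀ hμR.ne']
      _ ≤ (μ R₀.2).toReal⁻¹ * (Cl * sideLen R₀ ^ n) := by gcongr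
      _ = _ := by ring
  -- distance to the pole
  have hzp : 15 * sideLen R₀ ≤ dist z p := by
    have h1 : 16 * sideLen R₀ ≤ dist p (L.center R₀.2) := by
      unfold cubeBall at hpB
      rw [mem_ball, not_lt] at hpB
      linarith
    have h2 := lat_dist L hR (hQR hzQ) (L.center_mem _ _ hR)
    have h3 := dist_triangle p z (L.center R₀.2)
    rw [dist_comm p z] at h3
    linarith
  have hzp' : 15 * ℓ ≤ dist z p := by linarith
  -- regularity
  have hub : ∀ x s, 0 < s → μ (closedBall x s) ≤ ENNReal.ofReal (C1 * s^n) := by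
    intro x s hs
    rw [hμ, Measure.restrict_apply isClosed_closedBall.measurableSet]
    exact adr_ub hn hC₀ hF' x hs
  have hdiam := diam_ge hn hC₀ hF' hμ L hR
  have hlbs : ∀ x ∉ Ω, ∀ s, 0 < s → s ≤ Kd⁻¹ * sideLen R₀ →
      ENNReal.ofReal (C1⁻¹ * s^n) ≤ μ (ball x s) := by
    intro x hx s hs hsle
    have hxF : x ∈ frontier Ω := by rw [hfrΩ]; exact hx
    have h1 := (hF' x hxF s hs ((ENNReal.ofReal_le_ofReal hsle).trans hdiam)).1
    rw [hμ, Measure.restrict_apply measurableSet_ball, inter_comm]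
    refine le_trans (ENNReal.ofReal_le_ofReal ?_) h1
    gcongr
  obtain ⟨ν, hν1, hν2, hν3, hν4⟩ := exists_balayage hp z hℓ
  have S : Setup n Ω p ν μ C1 :=
    { hn := hn
      hΩ := hΩo
      hfr := hfrΩ
      hpΩ := hpΩ
      hp := hp
      fin := hν1
      supp := by
        rw [ae_iff]
        rw [hfrΩ, compl_compl] at hν2
        simpa using hν2
      hν := hν3
      hC1 := hC1p
      μsupp := by
        rw [hμ, ae_restrict_iff' isClosed_frontier.measurableSet]
        refine Eventually.of_forall fun y hy => ?_
        rw [hfrΩ] at hy; exact hy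
      hub := hub
      hlb := ⟨Kd⁻¹ * sideLen R₀, by positivity, hlbs⟩ }
  have hνub : ∀ s, ℓ ≤ s → ν (closedBall z s) ≤ ENNReal.ofReal (CT * τ * s^n) := fun s hs =>
    nu_ub hn hC₀ hA hF' hμ L hR hp hν1 hν3 hub hQ hs
  have hQball : Q.2 ⊆ closedBall z ℓ := fun y hy => mem_closedBall.2 (lat_dist L hQm hy hzQ)
  have hG : ∀ x, dist x z ≤ 8 * ℓ → Ek n (x - p) - pot ν x ≤ bB * (ℓ * τ) := by
    intro x hx
    have h1 := hptw S (L.measurableSet _ _ hQm) hℓ (inv_pos.2 (by linarith : 0 < Cl))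
      (mul_nonneg hCTp hτ0.le) hQball (lat_lb L hQm) hνub hzp' x hx
    have h2 : ℓ^2 * (‖z - p‖^(n+1))⁻¹ ≤ ℓ * (Cl * τ) := by
      rw [← dist_eq_norm]
      have h3 : sideLen R₀ ^ n * ℓ ≤ dist z p ^ (n+1) := by
        rw [pow_succ]
        gcongr <;> linarith
      calc ℓ^2 * (dist z p ^ (n+1))⁻¹ ≤ ℓ^2 * (sideLen R₀ ^ n * ℓ)⁻¹ := by gcongr
        _ = ℓ * (sideLen R₀ ^ n)⁻¹ := by field_simp
        _ ≤ _ := by gcongr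
    have h3 : K * ℓ^2 * (‖z - p‖^(n+1))⁻¹ ≤ K * (ℓ * (Cl * τ)) := by
      rw [mul_assoc]; gcongr
    calc _ ≤ _ := h1
      _ ≤ K * (ℓ * (Cl * τ)) + K2 * (CT * τ) * ℓ := by gcongr
      _ = _ := by rw [hbB]; ring
  -- lower bound for the harmonic measure
  have hωQ : A⁻¹ * c' * Cl⁻¹ * (ℓ^n * τ) ≤ hMeasure Ω p Q.2 := by
    have hnot : ¬ LDcond Ω μ L p R₀ A Q := by
      intro h
      obtain ⟨q'', h1, h2⟩ := exists_max hn L hR (P := LDcond Ω μ L p R₀ A) (fun q hq => ⟨hq.1, hq.2.1⟩) h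
      exact hQG q'' (Or.inr h1) h2
    have hlt : A⁻¹ * (hMeasure Ω p R₀.2 / (μ R₀.2).toReal) < hMeasure Ω p Q.2 / (μ Q.2).toReal := by
      by_contra h; push Not at h; exact hnot ⟨hQm, hQR, h⟩
    rw [lt_div_iff₀ (lat_pos L hQm)] at hlt
    refine le_trans ?_ hlt.le
    have h1 := lat_lb L hQm
    have h2 : c' * τ ≤ hMeasure Ω p R₀.2 / (μ R₀.2).toReal := by
      rw [div_eq_mul_inv]; gcongr
    calc A⁻¹ * c' * Cl⁻¹ * (ℓ^n * τ) = A⁻¹ * (c' * τ) * (Cl⁻¹ * ℓ^n) := by ring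
      _ ≤ _ := by
          have h0 : 0 ≤ hMeasure Ω p R₀.2 / (μ R₀.2).toReal := le_trans (by positivity) h2
          exact mul_le_mul (by gcongr) h1 (by positivity) (mul_nonneg (by positivity) h0)
  have hbl : A⁻¹ * c' * Cl⁻¹ * (ℓ^n * τ) ≤ ∫ y, bump z ℓ y ∂ν := by
    refine hωQ.trans (le_trans ?_ hν4)
    refine perron_mono hp (M := 1) (fun ξ _ => ?_) (fun ξ _ => ?_) (fun ξ _ => ?_)
    · by_cases h : ξ ∈ Q.2 <;> simp [h]
    · rw [abs_of_nonneg (bump_nonneg _ _ _)]; exact bump_le_one _ _ _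
    · by_cases h : ξ ∈ Q.2
      · rw [indicator_of_mem h, bump_one hℓ (mem_closedBall.1 (hQball h))]
      · rw [indicator_of_notMem h]; exact bump_nonneg _ _ _
  have hlow : cl * (ℓ * τ) ≤ 1/4 * ((2*ℓ)^(n-1))⁻¹ * ∫ y, bump z ℓ y ∂ν := by
    calc cl * (ℓ * τ) = 1/4 * ((2*ℓ)^(n-1))⁻¹ * (A⁻¹ * c' * Cl⁻¹ * (ℓ^n * τ)) := by
          obtain ⟨k, rfl⟩ : ∃ k, n = k + 1 := ⟨n - 1, by omega⟩
          rw [hcl, Nat.add_sub_cancel, mul_pow, pow_succ ℓ]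
          field_simp
      _ ≤ _ := by gcongr
  obtain ⟨x, hx1, hx2, hx3, hx4⟩ := S.exists_pt hzΩ hℓ hzp' hκp hκ1 (B := bB * (ℓ * τ))
    (lam := cl * (ℓ * τ)) (by positivity) (by positivity)
    (fun y hy => hlbs y hy _ (by positivity) (by gcongr)) hG hlow (by
      have h1 : bB * (ℓ*τ) * (C1^2 * 2^(n+1) * 10^n * κ / 8^(n+1)) = bB * Y * κ * (ℓ * τ) := by
        rw [hY]; ring
      rw [h1]
      calc bB * Y * κ * (ℓ * τ) ≤ cl / 4 * (ℓ * τ) := by gcongr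
        _ = _ := by ring)
  refine ⟨x, ⟨?_, hx2⟩, ?_, ?_⟩
  · unfold cubeBall
    have : (2:ℝ) * (4 * sideLen Q) = 8 * ℓ := by rw [hℓd]; ring
    rw [this]; exact hx1
  · rw [hfrΩ]; exact hx3
  · refine lt_of_eq_of_lt ?_ hx4
    rw [hτ, div_eq_mul_inv]; ring

end HarmMeas
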